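/- Let k be a field of characteristic p > 0 with at least 3 elements and let n ≥ 2 be an integer. Then there exist a finitely generated field extension K of k of transcendence degree n over k, a finite separable field extension K* of K (so K* also has transcendence degree n over k), a valuation ring V* of K* containing k with V* ≠ K*, and n-dimensional regular algebraic local rings A of K over k and B of K* over k, such that V* dominates B and B dominates A, and there do NOT exist regular algebraic local rings A' of K over k and B' of K* over k such that V* dominates B', B' dominates A', A' dominates A, B' dominates B, and the inclusion A' → B' is a monomial extension. (In particular both local monomialization and weak local monomialization fail for A → B along the valuation determined by V*.) -/

import Mathlib

/-! Counterexamples to local monomialization in positive characteristic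
(Cutkosky).  Statement 0: existence of a counterexample to (weak) local
monomialization over any field `k` of characteristic `p > 0` with at least
three elements, in any dimension `n ≥ 2`. -/

section Defs

variable {F : Type} [Field F]

/-- `V` is a valuation ring of the field `F`: a proper subring such that for
every nonzero `f ∈ F`, either `f ∈ V` or `f⁻¹ ∈ V`. -/
def IsValuationSubring (V : Subring F) : Prop :=
  V ≠ ⊤ ∧ ∀ z : F, z ≠ 0 → z ∈ V ∨ z⁻¹ ∈ V

/-- `S` dominates `R`: `R ⊆ S` and `m_S ∩ R = m_R`, i.e. an element of `R` is
a non-unit of `S` if and only if it is a non-unit of `R`. -/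
def Dominates (S R : Subring F) : Prop :=
  ∃ _ : R ≤ S, ∀ (z : F) (hR : z ∈ R) (hS : z ∈ S),
    (¬ IsUnit (⟨z, hS⟩ : S) ↔ ¬ IsUnit (⟨z, hR⟩ : R))

/-- `A` is a regular local ring of Krull dimension `n`: a Noetherian local
ring whose maximal ideal (= the ideal of non-units) is generated by
`n = dim A` elements (a regular system of parameters). -/
def IsRegularLocalOfDim (A : Subring F) (n : ℕ) : Prop :=
  IsNoetherianRing A ∧ IsLocalRing A ∧ ringKrullDim A = n ∧
  ∃ s : Fin n → A, ∀ z : A, z ∈ Ideal.span (Set.range s) ↔ ¬ IsUnit z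

/-- `A → B` is a monomial extension: `A` and `B` are regular local rings of a
common dimension `n` and there are regular systems of parameters
`x₁, …, xₙ` of `A` and `y₁, …, yₙ` of `B`, units `δ₁, …, δₙ` of `B` and an
`n × n` matrix `(a_{ij})` of natural numbers with nonzero determinant such
that `xᵢ = δᵢ ∏_j y_j^(a_{ij})` for all `i`. -/
def IsMonomialExtension (A B : Subring F) : Prop :=
  ∃ (n : ℕ) (hAB : A ≤ B),
    IsRegularLocalOfDim A n ∧ IsRegularLocalOfDim B n ∧
    ∃ (xs : Fin n → A) (ys : Fin n → B) (δ : Fin n → B)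
      (M : Matrix (Fin n) (Fin n) ℕ),
      (∀ z : A, z ∈ Ideal.span (Set.range xs) ↔ ¬ IsUnit z) ∧
      (∀ z : B, z ∈ Ideal.span (Set.range ys) ↔ ¬ IsUnit z) ∧
      (∀ i, IsUnit (δ i)) ∧
      (M.map ((↑·) : ℕ → ℚ)).det ≠ 0 ∧
      (∀ i, Subring.inclusion hAB (xs i) = δ i * ∏ j, (ys j) ^ (M i j))

variable (k : Type) [Field k] [Algebra k F]

/-- `A` is an algebraic local ring of `L` over `k`: a local domain with
quotient field `L` which is essentially of finite type over `k`, i.e. a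
localization of a finitely generated `k`-subalgebra `C` of `L` at a prime
ideal (necessarily `C ∩ m_A`): every element of `A` can be written as `a/b`
with `a, b ∈ C` and `b` a unit of `A`. -/
def IsAlgebraicLocalRingOf (L : IntermediateField k F) (A : Subring F) : Prop :=
  (A : Set F) ⊆ L ∧
  IsLocalRing A ∧
  (∀ z ∈ L, ∃ a ∈ A, ∃ b ∈ A, b ≠ 0 ∧ z * b = a) ∧
  ∃ C : Subalgebra k F, C.FG ∧ (C : Set F) ⊆ A ∧
    ∀ z ∈ A, ∃ a ∈ C, ∃ b ∈ C, (∃ b' ∈ A, b * b' = 1) ∧ z * b = a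

end Defs

/-- The data of a counterexample to local (and weak local) monomialization:
a finitely generated field extension `K` of `k` of transcendence degree `n`,
a finite separable extension `K*` of `K` (of the same transcendence degree
`n` over `k`), a valuation ring `V* ≠ K*` of `K*` containing `k`, and
`n`-dimensional regular algebraic local rings `A` of `K` over `k` and `B` of
`K*` over `k` with `V*` dominating `B` and `B` dominating `A`, such that
there exist no regular algebraic local rings `A'` of `K` over `k` and `B'`
of `K*` over `k` with `V*` dominating `B'`, `B'` dominating `A'`, `A'`
dominating `A`, `B'` dominating `B` and `A' → B'` monomial. -/
structure MonomializationCounterexample (k : Type) [Field k] (n : ℕ) : Type 1 where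
  Kstar : Type
  [fieldKstar : Field Kstar]
  [algKstar : Algebra k Kstar]
  /-- the subfield `K` of `K*` -/
  K : IntermediateField k Kstar
  /-- `K` is a finitely generated field extension of `k` -/
  K_fg : K.FG
  /-- `K` has transcendence degree `n` over `k` -/
  trdegK : ∃ b : Fin n → K, IsTranscendenceBasis k b
  /-- `K*` has transcendence degree `n` over `k` -/
  trdegKstar : ∃ b : Fin n → Kstar, IsTranscendenceBasis k b
  /-- `K*/K` is a finite extension -/
  finiteExt : FiniteDimensional K Kstar
  /-- `K*/K` is a separable extension -/
  sepExt : Algebra.IsSeparable K Kstar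
  /-- the valuation ring `V*` of `K*` -/
  V : Subring Kstar
  V_val : IsValuationSubring V
  /-- `V*` contains `k` -/
  V_k : ∀ c : k, algebraMap k Kstar c ∈ V
  /-- the local ring `A` of `K` -/
  A : Subring Kstar
  /-- the local ring `B` of `K*` -/
  B : Subring Kstar
  A_alg : IsAlgebraicLocalRingOf k K A
  B_alg : IsAlgebraicLocalRingOf k (⊤ : IntermediateField k Kstar) B
  A_reg : IsRegularLocalOfDim A n
  B_reg : IsRegularLocalOfDim B n
  VdomB : Dominates V B
  BdomA : Dominates B A
  /-- no (weak) local monomialization of `A → B` along `V*` -/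
  noMonomialization :
    ¬ ∃ A' B' : Subring Kstar,
        IsAlgebraicLocalRingOf k K A' ∧
        IsAlgebraicLocalRingOf k (⊤ : IntermediateField k Kstar) B' ∧
        (∃ m, IsRegularLocalOfDim A' m) ∧
        (∃ m, IsRegularLocalOfDim B' m) ∧
        Dominates V B' ∧ Dominates B' A' ∧
        Dominates A' A ∧ Dominates B' B ∧
        IsMonomialExtension A' B'

section Monomials

variable {M ι : Type*} [CommMonoid M] [Fintype ι]

/-- The monomial `∏ y_j ^ a_j`. -/
def monom (y : ι → M) (a : ι → ℕ) : M := ∏ j, y j ^ a j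

lemma monom_add (y : ι → M) (a b : ι → ℕ) : monom y (a + b) = monom y a * monom y b := by
  simp [monom, pow_add, Finset.prod_mul_distrib]

lemma monom_zero (y : ι → M) : monom y 0 = 1 := by simp [monom]

lemma monom_single [DecidableEq ι] (y : ι → M) (j : ι) : monom y (Pi.single j 1) = y j := by
  rw [monom, Finset.prod_eq_single j] <;> simp +contextual

end Monomials

/-- A regular system of parameters of a regular local ring, indexed by a finite type. -/
structure IsRegularSystem {R ι : Type*} [CommRing R] [Fintype ι] (y : ι → R) : Prop where
  isNoetherianRing : IsNoetherianRing R
  isLocalRing : IsLocalRing R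
  ringKrullDim_eq : ringKrullDim R = Fintype.card ι
  mem_span_iff : ∀ z, z ∈ Ideal.span (Set.range y) ↔ ¬ IsUnit z

namespace IsRegularSystem

variable {R ι : Type*} [CommRing R] [Fintype ι] {y : ι → R}

lemma not_isUnit (hy : IsRegularSystem y) (j : ι) : ¬ IsUnit (y j) :=
  (hy.mem_span_iff _).1 (Ideal.subset_span ⟨j, rfl⟩)

/-- The ideal generated by the monomials whose integral weight is at least `d`. -/
def weightIdeal (y : ι → R) (w : ι → ℕ) (d : ℕ) : Ideal R :=
  Ideal.span (monom y '' {b | d ≤ ∑ j, w j * b j})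

lemma monom_mem_weightIdeal {w : ι → ℕ} {d : ℕ} {b : ι → ℕ} (h : d ≤ ∑ j, w j * b j) :
    monom y b ∈ weightIdeal y w d := Ideal.subset_span ⟨b, h, rfl⟩

lemma weightIdeal_mul_mem {w : ι → ℕ} {d e : ℕ} {f g : R} (hf : f ∈ weightIdeal y w d)
    (hg : g ∈ weightIdeal y w e) : f * g ∈ weightIdeal y w (d + e) := by
  have h : weightIdeal y w d * weightIdeal y w e ≤ weightIdeal y w (d + e) := by
    rw [weightIdeal, weightIdeal, Ideal.span_mul_span', Ideal.span_le]
    rintro _ ⟨_, ⟨a, ha, rfl⟩, _, ⟨b, hb, rfl⟩, rfl⟩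
    simp only [← monom_add]
    apply monom_mem_weightIdeal
    simp only [Pi.add_apply, mul_add, Finset.sum_add_distrib]
    exact add_le_add ha hb
  exact h (Ideal.mul_mem_mul hf hg)

lemma weightIdeal_pow_mem {w : ι → ℕ} {d : ℕ} {f : R} (hf : f ∈ weightIdeal y w d) (M : ℕ) :
    f ^ M ∈ weightIdeal y w (M * d) := by
  induction M with
  | zero =>
    simpa [monom_zero] using monom_mem_weightIdeal (y := y) (w := w) (b := 0) (d := 0) (by simp)
  | succ M ih => rw [pow_succ, Nat.succ_mul]; exact weightIdeal_mul_mem ih hf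

lemma map_weightIdeal_le {S : Type*} [CommRing S] (q : R →+* S) {w : ι → ℕ} {W : ℕ}
    (hw : ∀ j, w j ∣ W) (hW : 0 < W) {τ : S} (hτ : ∀ j, q (y j) ^ (W / w j) = τ) {Q d : ℕ}
    (hd : (Q + Fintype.card ι) * W ≤ d) {f : R} (hf : f ∈ weightIdeal y w d) : τ ^ Q ∣ q f := by
  suffices h : weightIdeal y w d ≤ (Ideal.span {τ ^ Q}).comap q by
    exact Ideal.mem_span_singleton.1 (h hf)
  rw [weightIdeal, Ideal.span_le]
  rintro _ ⟨b, hb, rfl⟩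
  simp only [Set.mem_ofPred_eq] at hb
  have he : ∀ j, w j * (W / w j) = W := fun j => Nat.mul_div_cancel' (hw j)
  have hsum : Q ≤ ∑ j, b j / (W / w j) := by
    have h1 : ∀ j, w j * b j ≤ W * (b j / (W / w j)) + W := fun j => by
      have hpos : 0 < W / w j := by
        rcases Nat.eq_zero_or_pos (W / w j) with h | h
        · have := he j; rw [h] at this; omega
        · exact h
      calc w j * b j ≤ w j * ((W / w j) * (b j / (W / w j)) + (W / w j)) := by
            gcongr
            have := Nat.div_add_mod (b j) (W / w j)
            have := Nat.mod_lt (b j) hpos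
            omega
        _ = _ := by rw [mul_add, ← mul_assoc, he]
    have h2 : ∑ j, w j * b j ≤ W * ∑ j, b j / (W / w j) + Fintype.card ι * W := by
      refine (Finset.sum_le_sum fun j _ => h1 j).trans ?_
      rw [Finset.sum_add_distrib, Finset.mul_sum]
      simp
    have h3 : Q * W ≤ (∑ j, b j / (W / w j)) * W := by nlinarith
    exact Nat.le_of_mul_le_mul_right h3 hW
  rw [SetLike.mem_coe, Ideal.mem_comap, Ideal.mem_span_singleton]
  refine (pow_dvd_pow τ hsum).trans ?_
  rw [monom, map_prod, ← Finset.prod_pow_eq_pow_sum]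
  refine Finset.prod_dvd_prod_of_dvd _ _ fun j _ => ?_
  rw [map_pow, ← hτ j, ← pow_mul]
  exact pow_dvd_pow _ (Nat.mul_div_le _ _)

/-- Monomials are independent for integral weights. -/
lemma monom_notMem_weightIdeal (hy : IsRegularSystem y) {w : ι → ℕ} (hw : ∀ j, 0 < w j)
    (a : ι → ℕ) : monom y a ∉ weightIdeal y w (∑ j, w j * a j + 1) := by
  classical
  intro hmem
  have := hy.isNoetherianRing
  have := hy.isLocalRing
  rcases isEmpty_or_nonempty ι with hι | ⟨⟨j0⟩⟩
  · have : weightIdeal y w (∑ j, w j * a j + 1) = ⊥ := by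
      rw [weightIdeal, Ideal.span_eq_bot]
      rintro _ ⟨b, hb, rfl⟩
      simp at hb
    rw [this, Ideal.mem_bot] at hmem
    simp [monom] at hmem
  set W := ∏ j, w j with hWdef
  have hdvd : ∀ j, w j ∣ W := fun j => Finset.dvd_prod_of_mem _ (Finset.mem_univ j)
  have hW : 0 < W := Finset.prod_pos fun j _ => hw j
  let s : Finset R := (Finset.univ.erase j0).image fun j => y j ^ (W / w j) - y j0 ^ (W / w j0)
  have hpos : ∀ j, W / w j ≠ 0 := fun j => (Nat.div_pos (Nat.le_of_dvd hW (hdvd j)) (hw j)).ne'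
  have hmax : ∀ j, y j ^ (W / w j) ∈ IsLocalRing.maximalIdeal R := fun j =>
    Ideal.pow_mem_of_mem _ (hy.not_isUnit j) _ (Nat.pos_of_ne_zero (hpos j))
  let q := Ideal.Quotient.mk (Ideal.span (s : Set R))
  have hτ : ∀ j, q (y j) ^ (W / w j) = q (y j0) ^ (W / w j0) := fun j => by
    rw [← map_pow, ← map_pow, Ideal.Quotient.mk_eq_mk_iff_sub_mem]
    by_cases hj : j = j0
    · subst hj; simp
    · exact Ideal.subset_span (by simpa [s] using ⟨j, hj, rfl⟩)
  set τ := q (y j0) ^ (W / w j0)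
  set n := Fintype.card ι
  set A := ∑ j, w j * a j
  have h1 : monom y a ^ (W * (n + 1)) ∈ weightIdeal y w (W * (n + 1) * (A + 1)) :=
    weightIdeal_pow_mem hmem _
  have h2 : τ ^ ((n + 1) * A + 1) ∣ q (monom y a ^ (W * (n + 1))) :=
    map_weightIdeal_le q hdvd hW hτ (le_of_eq (by ring)) h1
  have h3 : q (monom y a ^ (W * (n + 1))) = τ ^ ((n + 1) * A) := by
    rw [monom, ← Finset.prod_pow, map_prod, Finset.mul_sum, ← Finset.prod_pow_eq_pow_sum]
    refine Finset.prod_congr rfl fun j _ => ?_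
    rw [← hτ j, map_pow, map_pow, ← pow_mul, ← pow_mul]
    congr 1
    rw [show W / w j * ((n + 1) * (w j * a j)) = (w j * (W / w j)) * ((n + 1) * a j) by ring,
      Nat.mul_div_cancel' (hdvd j)]
    ring
  rw [h3] at h2
  obtain ⟨r, hr⟩ := h2
  obtain ⟨r, rfl⟩ := Ideal.Quotient.mk_surjective r
  have hu : IsUnit (1 - y j0 ^ (W / w j0) * r) := by
    by_contra h
    exact Ideal.mul_mem_right r (IsLocalRing.maximalIdeal R) (hmax j0)
      (IsLocalRing.isUnit_of_mem_nonunits_one_sub_self _ h)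
  have hnil : τ ^ ((n + 1) * A) = 0 := by
    have h4 : τ ^ ((n + 1) * A) * q (1 - y j0 ^ (W / w j0) * r) = 0 := by
      rw [map_sub, map_mul, map_pow, map_one, mul_sub, mul_one, ← mul_assoc, ← pow_succ]
      exact sub_eq_zero.2 hr
    exact (hu.map q).mul_left_eq_zero.1 h4
  have hdim : Ring.KrullDimLE 0 (R ⧸ Ideal.span (s : Set R)) := by
    rw [Ring.krullDimLE_zero_iff]
    intro P hP
    have hle : IsLocalRing.maximalIdeal R ≤ P.comap q := by
      intro z hz
      refine (Ideal.span_le (I := P.comap q)).2 ?_ ((hy.mem_span_iff z).2 hz)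
      rintro _ ⟨j, rfl⟩
      refine hP.mem_of_pow_mem (W / w j) ?_
      rw [hτ j]
      exact hP.mem_of_pow_mem _ (hnil ▸ P.zero_mem)
    have hmx : (P.comap q).IsMaximal := by
      have := (IsLocalRing.maximalIdeal.isMaximal R).eq_of_le
        (Ideal.comap_ne_top q hP.ne_top) hle
      rw [← this]; infer_instance
    rw [← Ideal.map_comap_of_surjective q Ideal.Quotient.mk_surjective P]
    refine (Ideal.map_eq_top_or_isMaximal_of_surjective q Ideal.Quotient.mk_surjective
      hmx).resolve_left ?_
    rw [Ideal.map_comap_of_surjective q Ideal.Quotient.mk_surjective P]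
    exact hP.ne_top
  have h0 : ringKrullDim (R ⧸ Ideal.span (s : Set R)) ≤ 0 := by
    rw [← Nat.cast_zero]; exact Order.KrullDimLE.krullDim_le
  have hs : (s : Set R) ⊆ Ring.jacobson R := by
    rw [IsLocalRing.ringJacobson_eq_maximalIdeal]
    intro z hz
    simp only [s, Finset.coe_image, Set.mem_image] at hz
    obtain ⟨j, -, rfl⟩ := hz
    exact sub_mem (hmax j) (hmax j0)
  have h5 := ringKrullDim_le_ringKrullDim_quotient_add_card s hs
  rw [hy.ringKrullDim_eq] at h5
  have hcard : s.card < n := by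
    refine Finset.card_image_le.trans_lt ?_
    rw [Finset.card_erase_of_mem (Finset.mem_univ _), Finset.card_univ]
    exact Nat.sub_lt (Fintype.card_pos_iff.2 ⟨j0⟩) one_pos
  have h6 : (n : WithBot ℕ∞) ≤ 0 + (s.card : WithBot ℕ∞) := h5.trans (by gcongr)
  rw [zero_add] at h6
  exact absurd (by exact_mod_cast h6 : n ≤ s.card) (by omega)

end IsRegularSystem

namespace IsRegularSystem

open Filter Topology

variable {R ι : Type*} [CommRing R] [Fintype ι] {y : ι → R}

/-- A multiplicative weight: natural numbers `q_j ≥ 2` such that the monomials in the `q_j` are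
pairwise distinct. -/
structure IsWeight (q : ι → ℕ) : Prop where
  two_le : ∀ j, 2 ≤ q j
  injective : Function.Injective (monom q)

lemma IsWeight.monom_pos {q : ι → ℕ} (hq : IsWeight q) (a : ι → ℕ) : 0 < monom q a :=
  Finset.prod_pos fun j _ => pow_pos (by have := hq.two_le j; omega) _

lemma exists_nat_weight {q : ι → ℕ} (hq : IsWeight q) (a : ι → ℕ) (s : Set (ι → ℕ))
    (hs : s.Finite) (h : ∀ b ∈ s, monom q a < monom q b) :
    ∃ w : ι → ℕ, (∀ j, 0 < w j) ∧ ∀ b ∈ s, ∑ j, w j * a j + 1 ≤ ∑ j, w j * b j := by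
  have hlog : ∀ c : ι → ℕ, Real.log (monom q c : ℕ) = ∑ j, Real.log (q j) * c j := fun c => by
    rw [monom, Nat.cast_prod, Real.log_prod]
    · exact Finset.sum_congr rfl fun j _ => by rw [Nat.cast_pow, Real.log_pow, mul_comm]
    · intro j _
      have := hq.two_le j
      positivity
  have hlogpos : ∀ j, 0 < Real.log (q j) := fun j =>
    Real.log_pos (by exact_mod_cast (hq.two_le j : 1 < q j))
  have hlim : ∀ j, Tendsto (fun L : ℝ => ((⌊Real.log (q j) * L⌋₊ : ℕ) : ℝ) / L) atTop
      (𝓝 (Real.log (q j))) := fun j => tendsto_nat_floor_mul_div_atTop (hlogpos j).le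
  have hlim2 : ∀ c : ι → ℕ, Tendsto (fun L : ℝ => ∑ j, ((⌊Real.log (q j) * L⌋₊ : ℕ) : ℝ) / L * c j)
      atTop (𝓝 (∑ j, Real.log (q j) * c j)) := fun c =>
    tendsto_finsetSum _ fun j _ => (hlim j).mul_const _
  have h1 : ∀ᶠ L : ℝ in atTop, ∀ j, 0 < ((⌊Real.log (q j) * L⌋₊ : ℕ) : ℝ) / L :=
    eventually_all.2 fun j => (hlim j).eventually_const_lt (hlogpos j)
  have h2 : ∀ᶠ L : ℝ in atTop, ∀ b ∈ s, ∑ j, ((⌊Real.log (q j) * L⌋₊ : ℕ) : ℝ) / L * a j <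
      ∑ j, ((⌊Real.log (q j) * L⌋₊ : ℕ) : ℝ) / L * b j := by
    refine (eventually_all_finite hs).2 fun b hb => ?_
    refine (hlim2 a).eventually_lt (hlim2 b) ?_
    rw [← hlog, ← hlog]
    exact Real.log_lt_log (by exact_mod_cast hq.monom_pos a) (by exact_mod_cast h b hb)
  obtain ⟨L, ⟨h1, h2⟩, hL⟩ := ((h1.and h2).and (eventually_gt_atTop 0)).exists
  refine ⟨fun j => ⌊Real.log (q j) * L⌋₊, fun j => ?_, fun b hb => ?_⟩
  · have := h1 j
    rw [div_pos_iff_of_pos_right hL] at this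
    exact_mod_cast this
  · have := h2 b hb
    simp only [div_mul_eq_mul_div, ← Finset.sum_div] at this
    rw [div_lt_div_iff_of_pos_right hL] at this
    exact_mod_cast this

/-- The ideal generated by the monomials of multiplicative weight larger than `c`. -/
def highIdeal (y : ι → R) (q : ι → ℕ) (c : ℕ) : Ideal R :=
  Ideal.span (monom y '' {b | c < monom q b})

lemma monom_mem_highIdeal {q : ι → ℕ} {c : ℕ} {b : ι → ℕ} (h : c < monom q b) :
    monom y b ∈ highIdeal y q c := Ideal.subset_span ⟨b, h, rfl⟩

lemma highIdeal_antitone (y : ι → R) (q : ι → ℕ) : Antitone (highIdeal y q) :=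
  fun _ _ h => Ideal.span_mono (Set.image_mono fun _ hb => lt_of_le_of_lt h hb)

/-- Monomials are independent for multiplicative weights. -/
lemma monom_notMem_highIdeal (hy : IsRegularSystem y) {q : ι → ℕ} (hq : IsWeight q)
    (a : ι → ℕ) : monom y a ∉ highIdeal y q (monom q a) := by
  intro h
  obtain ⟨T, hT, hmem⟩ := Submodule.mem_span_finite_of_mem_span h
  obtain ⟨s, hs, hsT⟩ := Set.subset_image_iff.1 hT
  classical
  obtain ⟨s', hs', hfin, hss⟩ : ∃ s' ⊆ s, s'.Finite ∧ monom y '' s' = T := by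
    obtain ⟨s', h1, h2⟩ := Set.exists_subset_bijOn s (monom y)
    refine ⟨s', h1, ?_, ?_⟩
    · exact Set.Finite.of_finite_image (by rw [h2.image_eq, hsT]; exact T.finite_toSet) h2.injOn
    · rw [h2.image_eq, hsT]
  obtain ⟨w, hw, hlt⟩ := exists_nat_weight hq a s' hfin fun b hb => hs (hs' hb)
  refine hy.monom_notMem_weightIdeal hw a ?_
  refine Submodule.span_mono ?_ hmem
  rw [← hss]
  exact Set.image_mono fun b hb => hlt b hb

/-- `f` has leading exponent `a` with respect to the weight `q`. -/
def Lead (y : ι → R) (q : ι → ℕ) (f : R) (a : ι → ℕ) : Prop :=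
  ∃ u, IsUnit u ∧ f - u * monom y a ∈ highIdeal y q (monom q a)

lemma Lead.notMem_highIdeal (hy : IsRegularSystem y) {q : ι → ℕ} (hq : IsWeight q) {f : R}
    {a : ι → ℕ} (h : Lead y q f a) : f ∉ highIdeal y q (monom q a) := by
  obtain ⟨u, hu, h⟩ := h
  intro hf
  have h1 : u * monom y a ∈ highIdeal y q (monom q a) := by
    simpa using sub_mem hf h
  rw [(highIdeal y q _).unit_mul_mem_iff_mem hu] at h1
  exact hy.monom_notMem_highIdeal hq a h1

lemma Lead.mem_highIdeal {q : ι → ℕ} {f : R}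
    {a : ι → ℕ} (h : Lead y q f a) {c : ℕ} (hc : c < monom q a) : f ∈ highIdeal y q c := by
  obtain ⟨u, hu, h⟩ := h
  have := add_mem (highIdeal_antitone y q hc.le h)
    ((highIdeal y q c).mul_mem_left u (monom_mem_highIdeal hc))
  simpa using this

lemma Lead.ne_zero (hy : IsRegularSystem y) {q : ι → ℕ} (hq : IsWeight q) {f : R}
    {a : ι → ℕ} (h : Lead y q f a) : f ≠ 0 := by
  rintro rfl
  exact h.notMem_highIdeal hy hq (zero_mem _)

lemma Lead.unique (hy : IsRegularSystem y) {q : ι → ℕ} (hq : IsWeight q) {f : R}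
    {a b : ι → ℕ} (ha : Lead y q f a) (hb : Lead y q f b) : a = b := by
  apply hq.injective
  rcases lt_trichotomy (monom q a) (monom q b) with h | h | h
  · exact absurd (hb.mem_highIdeal h) (ha.notMem_highIdeal hy hq)
  · exact h
  · exact absurd (ha.mem_highIdeal h) (hb.notMem_highIdeal hy hq)

lemma highIdeal_mul_mem {q : ι → ℕ} {f g : R} {a : ι → ℕ} {c : ℕ}
    (hf : f ∈ highIdeal y q c) (hg : g ∈ highIdeal y q (monom q a)) :
    f * g ∈ highIdeal y q (c * monom q a) := by
  have h : highIdeal y q c * highIdeal y q (monom q a) ≤ highIdeal y q (c * monom q a) := by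
    rw [highIdeal, highIdeal, Ideal.span_mul_span', Ideal.span_le]
    rintro _ ⟨_, ⟨a, ha, rfl⟩, _, ⟨b, hb, rfl⟩, rfl⟩
    simp only [← monom_add]
    apply monom_mem_highIdeal
    rw [monom_add]
    exact Nat.mul_lt_mul'' ha hb
  exact h (Ideal.mul_mem_mul hf hg)

lemma monom_mul_mem_highIdeal {q : ι → ℕ} (hq : IsWeight q) {f : R} {c : ℕ}
    (hf : f ∈ highIdeal y q c) (a : ι → ℕ) :
    monom y a * f ∈ highIdeal y q (monom q a * c) := by
  suffices h : highIdeal y q c ≤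
      Submodule.comap (LinearMap.mulLeft R (monom y a)) (highIdeal y q (monom q a * c))
    from h hf
  rw [highIdeal, Ideal.span, Submodule.span_le]
  rintro _ ⟨b, hb, rfl⟩
  simp only [Submodule.comap_coe, Set.mem_preimage, LinearMap.mulLeft_apply, SetLike.mem_coe,
    ← monom_add]
  apply monom_mem_highIdeal
  rw [monom_add]
  exact Nat.mul_lt_mul_of_pos_left hb (hq.monom_pos a)

lemma Lead.mul {q : ι → ℕ} (hq : IsWeight q) {f g : R}
    {a b : ι → ℕ} (hf : Lead y q f a) (hg : Lead y q g b) : Lead y q (f * g) (a + b) := by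
  obtain ⟨u, hu, hf⟩ := hf
  obtain ⟨v, hv, hg⟩ := hg
  refine ⟨u * v, hu.mul hv, ?_⟩
  have h1 := highIdeal_mul_mem hf hg
  have h2 := monom_mul_mem_highIdeal hq hg a
  have h3 := monom_mul_mem_highIdeal hq hf b
  rw [mul_comm (monom q b)] at h3
  rw [monom_add, monom_add]
  have := add_mem (add_mem h1 (Ideal.mul_mem_left _ u h2)) (Ideal.mul_mem_left _ v h3)
  convert this using 1
  ring

lemma lead_monom (y : ι → R) (q : ι → ℕ) (a : ι → ℕ) : Lead y q (monom y a) a :=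
  ⟨1, isUnit_one, by simp⟩

lemma mem_highIdeal_or_exists_lead (hy : IsRegularSystem y) {q : ι → ℕ} (hq : IsWeight q)
    (f : R) (c : ℕ) : f ∈ highIdeal y q c ∨ ∃ a, Lead y q f a := by
  classical
  induction c with
  | zero =>
    left
    have : (1 : R) ∈ highIdeal y q 0 := by
      simpa [monom_zero] using monom_mem_highIdeal (y := y) (hq.monom_pos 0)
    rw [(Ideal.eq_top_iff_one _).2 this]
    trivial
  | succ c ih =>
    refine ih.elim (fun hf => ?_) Or.inr
    by_cases hb : ∃ b, monom q b = c + 1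
    · obtain ⟨b, hb⟩ := hb
      have hle : highIdeal y q c ≤ Ideal.span {monom y b} ⊔ highIdeal y q (c + 1) := by
        rw [highIdeal, Ideal.span_le]
        rintro _ ⟨d, hd, rfl⟩
        rcases (show c + 1 ≤ monom q d from hd).eq_or_lt with h | h
        · rw [← hb] at h
          rw [hq.injective h]
          exact Ideal.mem_sup_left (Ideal.mem_span_singleton_self _)
        · exact Ideal.mem_sup_right (monom_mem_highIdeal h)
      obtain ⟨g, hg, h, hh, rfl⟩ := Submodule.mem_sup.1 (hle hf)
      obtain ⟨r, rfl⟩ := Ideal.mem_span_singleton'.1 hg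
      by_cases hr : IsUnit r
      · exact Or.inr ⟨b, r, hr, by simpa [hb] using hh⟩
      · left
        refine add_mem ?_ hh
        have hr' := (hy.mem_span_iff r).2 hr
        suffices h : Ideal.span (Set.range y) ≤
            Submodule.comap (LinearMap.mulLeft R (monom y b)) (highIdeal y q (c + 1)) by
          simpa [mul_comm] using h hr'
        rw [Ideal.span, Submodule.span_le]
        rintro _ ⟨j, rfl⟩
        simp only [Submodule.comap_coe, Set.mem_preimage, LinearMap.mulLeft_apply,
          SetLike.mem_coe]
        rw [← monom_single y j, ← monom_add]
        apply monom_mem_highIdeal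
        rw [monom_add, monom_single, hb]
        have := hq.two_le j
        nlinarith
    · left
      refine Ideal.span_mono (Set.image_mono fun d hd => ?_) hf
      exact lt_of_le_of_ne hd fun h => hb ⟨d, h.symm⟩

lemma exists_lead (hy : IsRegularSystem y) {q : ι → ℕ} (hq : IsWeight q) {f : R} (hf : f ≠ 0) :
    ∃ a, Lead y q f a := by
  by_contra hno
  have hall : ∀ c, f ∈ highIdeal y q c := fun c =>
    (hy.mem_highIdeal_or_exists_lead hq f c).resolve_right hno
  have := hy.isNoetherianRing
  have := hy.isLocalRing
  apply hf
  rw [← Ideal.mem_bot, ← Ideal.iInf_pow_eq_bot_of_isLocalRing (IsLocalRing.maximalIdeal R)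
    Ideal.IsPrime.ne_top', Ideal.mem_iInf]
  intro i
  set Q := ∏ j, q j with hQ
  have hqQ : ∀ j, q j ≤ Q := fun j => Nat.le_of_dvd
    (Finset.prod_pos fun j _ => by have := hq.two_le j; omega)
    (Finset.dvd_prod_of_mem _ (Finset.mem_univ j))
  have hQ1 : 1 ≤ Q := Nat.succ_le_of_lt (Finset.prod_pos fun j _ => by
    have := hq.two_le j; omega)
  refine (Ideal.span_le.2 ?_ : highIdeal y q (Q ^ i) ≤ _) (hall (Q ^ i))
  rintro _ ⟨b, hb, rfl⟩
  have h1 : i ≤ ∑ j, b j := by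
    by_contra hlt
    have h2 : monom q b ≤ Q ^ (∑ j, b j) := by
      rw [← Finset.prod_pow_eq_pow_sum]
      exact Finset.prod_le_prod' fun j _ => Nat.pow_le_pow_left (hqQ j) _
    exact absurd (h2.trans (Nat.pow_le_pow_right hQ1 (by omega))) (not_le.2 hb)
  refine Ideal.pow_le_pow_right h1 ?_
  rw [← Finset.prod_pow_eq_pow_sum]
  exact Ideal.prod_mem_prod fun j _ => Ideal.pow_mem_pow (hy.not_isUnit j) _

lemma isDomain (hy : IsRegularSystem y) {q : ι → ℕ} (hq : IsWeight q) : IsDomain R := by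
  have := hy.isLocalRing
  have : NoZeroDivisors R := ⟨fun {f g} h => by
    by_contra! hne
    obtain ⟨a, ha⟩ := hy.exists_lead hq hne.1
    obtain ⟨b, hb⟩ := hy.exists_lead hq hne.2
    exact (ha.mul hq hb).ne_zero hy hq h⟩
  exact NoZeroDivisors.to_isDomain R

end IsRegularSystem

namespace IsRegularSystem

variable {R ι : Type*} [CommRing R] [Fintype ι] {y : ι → R}

lemma exists_isWeight (ι : Type*) [Fintype ι] : ∃ q : ι → ℕ, IsWeight q := by
  let e := Fintype.equivFin ι
  have hp : ∀ j, (Nat.nth Nat.Prime (e j)).Prime := fun j => Nat.prime_nth_prime _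
  refine ⟨fun j => Nat.nth Nat.Prime (e j), fun j => (hp j).two_le, fun a b hab => ?_⟩
  have key : ∀ c : ι → ℕ, ∀ j, (monom (fun j => Nat.nth Nat.Prime (e j)) c).factorization
      (Nat.nth Nat.Prime (e j)) = c j := fun c j => by
    rw [monom, Nat.factorization_prod fun i _ => pow_ne_zero _ (hp i).ne_zero,
      Finsupp.finsetSum_apply, Finset.sum_eq_single j]
    · simp [Nat.factorization_pow]
    · intro i _ hij
      have hne : Nat.nth Nat.Prime (e i) ≠ Nat.nth Nat.Prime (e j) := fun h =>
        hij (e.injective (Fin.ext (Nat.nth_injective Nat.infinite_setOfPred_prime h)))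
      simp [Nat.factorization_pow, hne]
    · simp
  funext j
  rw [← key a j, ← key b j]
  exact congrArg (fun n => Nat.factorization n _) hab

lemma monom_monom {M ι : Type*} [CommMonoid M] [Fintype ι] (y : ι → M) (m : Matrix ι ι ℕ)
    (a : ι → ℕ) :
    monom (fun i => monom y (m i)) a = monom y (Matrix.vecMul a m) := by
  simp only [monom, Matrix.vecMul, dotProduct, ← Finset.prod_pow_eq_pow_sum, ← Finset.prod_pow]
  rw [Finset.prod_comm]
  exact Finset.prod_congr rfl fun j _ => Finset.prod_congr rfl fun i _ => by
    rw [← pow_mul, mul_comm]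

lemma vecMul_injective_of_det_ne_zero [DecidableEq ι] {m : Matrix ι ι ℕ}
    (hm : (m.map ((↑·) : ℕ → ℚ)).det ≠ 0) : Function.Injective (fun a => Matrix.vecMul a m) := by
  intro a b hab
  have h1 : Function.Injective (fun v => Matrix.vecMul v (m.map ((↑·) : ℕ → ℚ))) :=
    Matrix.vecMul_injective_of_isUnit ((Matrix.isUnit_iff_isUnit_det _).2 hm.isUnit)
  have h2 : (fun j => (a j : ℚ)) = fun j => (b j : ℚ) := by
    apply h1
    funext j
    have := congrFun hab j
    simp only [Matrix.vecMul, dotProduct, Matrix.map_apply] at this ⊢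
    exact_mod_cast this
  funext j
  exact_mod_cast congrFun h2 j

lemma IsWeight.of_matrix [DecidableEq ι] {q : ι → ℕ} (hq : IsWeight q) {m : Matrix ι ι ℕ}
    (hm : (m.map ((↑·) : ℕ → ℚ)).det ≠ 0) : IsWeight fun i => monom q (m i) := by
  have hinj := vecMul_injective_of_det_ne_zero hm
  refine ⟨fun i => ?_, fun a b hab => ?_⟩
  · have h1 : monom q (m i) ≠ 1 := by
      intro h
      rw [← monom_zero q] at h
      have h2 : Matrix.vecMul (Pi.single i 1) m = Matrix.vecMul 0 m := by
        rw [Matrix.single_one_vecMul, Matrix.zero_vecMul]; exact hq.injective h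
      have := congrFun (hinj h2) i
      simp at this
    have := hq.monom_pos (m i)
    omega
  · simp only [monom_monom] at hab
    exact hinj (hq.injective hab)

/-- Leading exponents transform by the exponent matrix under a monomial extension. -/
lemma Lead.map {A : Type*} [CommRing A] {x : ι → A} (g : A →+* R) {δ : ι → R}
    (hδ : ∀ i, IsUnit (δ i)) {m : Matrix ι ι ℕ} (hx : ∀ i, g (x i) = δ i * monom y (m i))
    {q : ι → ℕ} {f : A} {a : ι → ℕ} (h : Lead x (fun i => monom q (m i)) f a) :
    Lead y q (g f) (Matrix.vecMul a m) := by
  have hmon : ∀ b, g (monom x b) = monom δ b * monom y (Matrix.vecMul b m) := fun b => by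
    rw [← monom_monom, monom, map_prod, monom, monom, ← Finset.prod_mul_distrib]
    exact Finset.prod_congr rfl fun i _ => by rw [map_pow, hx, mul_pow]
  have hunit : ∀ b, IsUnit (monom δ b) := fun b => by
    rw [monom, IsUnit.prod_univ_iff]
    exact fun i => (hδ i).pow _
  obtain ⟨u, hu, h⟩ := h
  refine ⟨g u * monom δ a, (hu.map g).mul (hunit a), ?_⟩
  have hle : highIdeal x (fun i => monom q (m i)) (monom (fun i => monom q (m i)) a) ≤
      (highIdeal y q (monom q (Matrix.vecMul a m))).comap g := by
    rw [highIdeal, Ideal.span_le]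
    rintro _ ⟨b, hb, rfl⟩
    simp only [SetLike.mem_coe, Ideal.mem_comap, hmon]
    refine Ideal.mul_mem_left _ _ (monom_mem_highIdeal ?_)
    rw [Set.mem_ofPred_eq, monom_monom, monom_monom] at hb
    exact hb
  have := hle h
  rw [Ideal.mem_comap, map_sub, map_mul, hmon, ← mul_assoc] at this
  exact this

/-- The quotient by one of the parameters is again regular. -/
lemma quotient [DecidableEq ι] (hy : IsRegularSystem y) (j : ι) :
    IsRegularSystem fun i : {i // i ≠ j} => Ideal.Quotient.mk (Ideal.span {y j}) (y i) := by
  obtain ⟨q, hq⟩ := exists_isWeight ι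
  have := hy.isNoetherianRing
  have := hy.isLocalRing
  have := hy.isDomain hq
  have hne : Ideal.span {y j} ≠ ⊤ := by
    rw [Ne, Ideal.span_singleton_eq_top]; exact hy.not_isUnit j
  have : Nontrivial (R ⧸ Ideal.span {y j}) := Ideal.Quotient.nontrivial_iff.2 hne
  have hloc : IsLocalRing (R ⧸ Ideal.span {y j}) :=
    IsLocalRing.of_surjective' _ Ideal.Quotient.mk_surjective
  have hlochom : IsLocalHom (Ideal.Quotient.mk (Ideal.span {y j})) :=
    IsLocalHom.of_surjective _ Ideal.Quotient.mk_surjective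
  have hy0 : y j ≠ 0 := by
    have := lead_monom y q (Pi.single j 1)
    rw [monom_single] at this
    exact this.ne_zero hy hq
  refine ⟨inferInstance, hloc, ?_, fun z => ?_⟩
  · have h := ringKrullDim_quotient_span_singleton_succ_eq_ringKrullDim_of_mem_nonZeroDivisors
      (mem_nonZeroDivisors_of_ne_zero hy0) (hy.not_isUnit j)
    rw [hy.ringKrullDim_eq] at h
    have hc : Fintype.card ι = Fintype.card {i // i ≠ j} + 1 := by
      have := Fintype.card_subtype_compl (fun i => i = j)
      have h2 : 0 < Fintype.card ι := Fintype.card_pos_iff.2 ⟨j⟩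
      simp only [Fintype.card_unique] at this
      simp only [Ne]
      omega
    rw [hc, Nat.cast_add, Nat.cast_one] at h
    exact (ENat.WithBot.add_one_cancel).1 h
  · obtain ⟨z, rfl⟩ := Ideal.Quotient.mk_surjective z
    rw [isUnit_map_iff, ← hy.mem_span_iff]
    have h1 : Ideal.span
        (Set.range fun i : {i // i ≠ j} => Ideal.Quotient.mk (Ideal.span {y j}) (y i))
        = (Ideal.span (Set.range y)).map (Ideal.Quotient.mk (Ideal.span {y j})) := by
      rw [Ideal.map_span]
      apply le_antisymm
      · apply Ideal.span_mono
        rintro _ ⟨i, rfl⟩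
        exact ⟨_, ⟨i, rfl⟩, rfl⟩
      · rw [Ideal.span_le]
        rintro _ ⟨_, ⟨i, rfl⟩, rfl⟩
        by_cases hi : i = j
        · subst hi
          have : Ideal.Quotient.mk (Ideal.span {y i}) (y i) = 0 :=
            Ideal.Quotient.eq_zero_iff_mem.2 (Ideal.mem_span_singleton_self _)
          rw [this]; exact zero_mem _
        · exact Ideal.subset_span ⟨⟨i, hi⟩, rfl⟩
    rw [h1, Ideal.mem_map_iff_of_surjective _ Ideal.Quotient.mk_surjective]
    constructor
    · rintro ⟨w, hw, hwz⟩
      rw [Ideal.Quotient.mk_eq_mk_iff_sub_mem] at hwz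
      have h2 : w - z ∈ Ideal.span (Set.range y) :=
        Ideal.span_mono (by rintro _ rfl; exact ⟨j, rfl⟩) hwz
      simpa using sub_mem hw h2
    · exact fun h => ⟨z, h, rfl⟩

lemma ne_zero (hy : IsRegularSystem y) (j : ι) : y j ≠ 0 := by
  classical
  obtain ⟨q, hq⟩ := exists_isWeight ι
  have := lead_monom y q (Pi.single j 1)
  rw [monom_single] at this
  exact this.ne_zero hy hq

lemma prime (hy : IsRegularSystem y) (j : ι) : Prime (y j) := by
  classical
  obtain ⟨q, hq⟩ := exists_isWeight {i // i ≠ j}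
  have := (hy.quotient j).isDomain hq
  rw [← Ideal.span_singleton_prime (hy.ne_zero j)]
  exact (Ideal.Quotient.isDomain_iff_prime _).1 this

lemma not_dvd (hy : IsRegularSystem y) {i j : ι} (hij : i ≠ j) : ¬ y i ∣ y j := by
  classical
  obtain ⟨q, hq⟩ := exists_isWeight {l // l ≠ i}
  intro h
  have := (hy.quotient i).ne_zero ⟨j, hij.symm⟩
  exact this (Ideal.Quotient.eq_zero_iff_mem.2 (Ideal.mem_span_singleton.2 h))

/-- A regular system of parameters is algebraically independent over a field of coefficients. -/
lemma algebraicIndependent (hy : IsRegularSystem y) (k : Type*) [Field k] [Algebra k R] :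
    AlgebraicIndependent k y := by
  obtain ⟨q, hq⟩ := exists_isWeight ι
  rw [algebraicIndependent_iff]
  intro P hP
  by_contra hne
  obtain ⟨b, hb, hmin⟩ := Finset.exists_min_image P.support (fun b : ι →₀ ℕ => monom q b)
    (MvPolynomial.support_nonempty.2 hne)
  have hmon : ∀ b : ι →₀ ℕ, (b.prod fun i n => y i ^ n) = monom y b := fun b =>
    Finsupp.prod_fintype _ _ (by simp)
  have hu : IsUnit (algebraMap k R (P.coeff b)) :=
    (IsUnit.mk0 _ (MvPolynomial.mem_support_iff.1 hb)).map _
  rw [MvPolynomial.aeval_def, MvPolynomial.eval₂_eq', ← Finset.add_sum_erase _ _ hb] at hP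
  apply hy.monom_notMem_highIdeal hq b
  rw [← (highIdeal y q _).unit_mul_mem_iff_mem hu]
  rw [add_eq_zero_iff_eq_neg] at hP
  change algebraMap k R (P.coeff b) * ∏ i, y i ^ b i ∈ _
  rw [hP]
  refine neg_mem (sum_mem fun c hc => Ideal.mul_mem_left _ _ ?_)
  apply monom_mem_highIdeal
  refine lt_of_le_of_ne (hmin c (Finset.mem_of_mem_erase hc)) fun h => ?_
  exact Finset.ne_of_mem_erase hc (DFunLike.coe_injective (hq.injective h)).symm

end IsRegularSystem

namespace IsRegularSystem

variable {R ι F : Type*} [CommRing R] [Fintype ι] {y : ι → R} [Field F] [Algebra R F]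
  [IsFractionRing R F] {q : ι → ℕ}

/-- The leading exponent extends to a group homomorphism on the fraction field. -/
lemma exists_exponentHom (hy : IsRegularSystem y) (hq : IsWeight q) :
    ∃ lam : Fˣ →* Multiplicative (ι → ℤ), ∀ (u : Fˣ) (f : R) (a : ι → ℕ), Lead y q f a →
      (u : F) = algebraMap R F f → lam u = Multiplicative.ofAdd fun j => (a j : ℤ) := by
  have := hy.isDomain hq
  have hinj : Function.Injective (algebraMap R F) := IsFractionRing.injective R F
  have hex : ∀ u : Fˣ, ∃ c : ι → ℤ, ∃ f g a b, Lead y q f a ∧ Lead y q g b ∧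
      (u : F) * algebraMap R F g = algebraMap R F f ∧ c = fun j => (a j : ℤ) - b j := fun u => by
    obtain ⟨f, g, hg, hfg⟩ := IsFractionRing.div_surjective R (u : F)
    have hg0 : g ≠ 0 := nonZeroDivisors.ne_zero hg
    have hg1 : algebraMap R F g ≠ 0 := fun h => hg0 (hinj (by simpa using h))
    have hf0 : f ≠ 0 := by
      rintro rfl
      rw [map_zero, zero_div] at hfg
      exact u.ne_zero hfg.symm
    obtain ⟨a, ha⟩ := hy.exists_lead hq hf0
    obtain ⟨b, hb⟩ := hy.exists_lead hq hg0
    exact ⟨_, f, g, a, b, ha, hb, by rw [← hfg, div_mul_cancel₀ _ hg1], rfl⟩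
  have hun : ∀ (u : Fˣ) (f g f' g' : R) (a b a' b' : ι → ℕ), Lead y q f a → Lead y q g b →
      Lead y q f' a' → Lead y q g' b' → (u : F) * algebraMap R F g = algebraMap R F f →
      (u : F) * algebraMap R F g' = algebraMap R F f' →
      ∀ j, (a j : ℤ) - b j = a' j - b' j := by
    intro u f g f' g' a b a' b' ha hb ha' hb' h h' j
    have h1 : f * g' = f' * g := by
      apply hinj
      rw [map_mul, map_mul, ← h, ← h']
      ring
    have h2 := congrFun ((ha.mul hq hb').unique hy hq (h1 ▸ ha'.mul hq hb)) j
    simp only [Pi.add_apply] at h2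
    omega
  choose c hc using hex
  refine ⟨⟨⟨fun u => Multiplicative.ofAdd (c u), ?_⟩, fun u v => ?_⟩, fun u f a ha hu => ?_⟩
  · obtain ⟨f, g, a, b, ha, hb, h, hc'⟩ := hc 1
    rw [hc']
    have := hun 1 f g 1 1 a b 0 0 ha hb (monom_zero y ▸ lead_monom y q 0)
      (monom_zero y ▸ lead_monom y q 0) h (by simp)
    simp only [this]
    simp
    rfl
  · obtain ⟨f, g, a, b, ha, hb, h, hc1⟩ := hc u
    obtain ⟨f', g', a', b', ha', hb', h', hc2⟩ := hc v
    obtain ⟨f'', g'', a'', b'', ha'', hb'', h'', hc3⟩ := hc (u * v)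
    have := hun (u * v) f'' g'' (f * f') (g * g') _ _ _ _ ha'' hb'' (ha.mul hq ha')
      (hb.mul hq hb') h'' (by rw [Units.val_mul, map_mul, map_mul, ← h, ← h']; ring)
    change Multiplicative.ofAdd (c (u * v)) = Multiplicative.ofAdd (c u + c v)
    rw [hc1, hc2, hc3]
    congr 1
    funext j
    have := this j
    simp only [Pi.add_apply] at this ⊢
    push_cast at this
    omega
  · obtain ⟨f', g', a', b', ha', hb', h', hc2⟩ := hc u
    have := hun u f' g' f 1 _ _ _ _ ha' hb' ha (monom_zero y ▸ lead_monom y q 0) h' (by simp [hu])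
    change Multiplicative.ofAdd (c u) = _
    rw [hc2]
    congr 1
    funext j
    have := this j
    simpa using this

/-- Elements with pairwise distinct exponents do not cancel. -/
lemma sum_ne_zero (hy : IsRegularSystem y) (hq : IsWeight q)
    {lam : Fˣ →* Multiplicative (ι → ℤ)}
    (hlam : ∀ (u : Fˣ) (f : R) (a : ι → ℕ), Lead y q f a →
      (u : F) = algebraMap R F f → lam u = Multiplicative.ofAdd fun j => (a j : ℤ))
    {κ : Type*} (s : Finset κ) (hs : s.Nonempty) (z : κ → Fˣ)
    (hz : Set.InjOn (fun i => lam (z i)) s) : ∑ i ∈ s, (z i : F) ≠ 0 := by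
  classical
  have := hy.isDomain hq
  have hinj : Function.Injective (algebraMap R F) := IsFractionRing.injective R F
  intro h0
  obtain ⟨g, hg⟩ := IsLocalization.exist_integer_multiples (nonZeroDivisors R) s
    (fun i => (z i : F))
  have hg1 : algebraMap R F g ≠ 0 := fun h =>
    nonZeroDivisors.coe_ne_zero g (hinj (by rw [h, map_zero]))
  choose! f hf using hg
  simp only [Algebra.smul_def] at hf
  have hf0 : ∀ i ∈ s, f i ≠ 0 := fun i hi h => by
    have := hf i hi
    rw [h, map_zero] at this
    exact mul_ne_zero hg1 (z i).ne_zero this.symm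
  have hlead : ∀ i ∈ s, ∃ a, Lead y q (f i) a := fun i hi => hy.exists_lead hq (hf0 i hi)
  choose! a ha using hlead
  have hinjOn : Set.InjOn a s := by
    intro i hi j hj hij
    apply hz hi hj
    have h1 : ∀ i ∈ s, lam (Units.mk0 _ hg1 * z i) = Multiplicative.ofAdd fun l => (a i l : ℤ) :=
      fun i hi => hlam _ _ _ (ha i hi) (by simp [hf i hi])
    have h2 : lam (Units.mk0 _ hg1 * z i) = lam (Units.mk0 _ hg1 * z j) := by
      rw [h1 i hi, h1 j hj, hij]
    rw [map_mul, map_mul] at h2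
    exact mul_left_cancel h2
  have hsum : ∑ i ∈ s, f i = 0 := by
    apply hinj
    rw [map_sum, map_zero, Finset.sum_congr rfl hf, ← Finset.mul_sum, h0, mul_zero]
  obtain ⟨i, hi, hmin⟩ := Finset.exists_min_image s (fun i => monom q (a i)) hs
  rw [← Finset.add_sum_erase _ _ hi, add_eq_zero_iff_eq_neg] at hsum
  apply (ha i hi).notMem_highIdeal hy hq
  rw [hsum]
  refine neg_mem (sum_mem fun j hj => ?_)
  have hjs := Finset.mem_of_mem_erase hj
  refine (ha j hjs).mem_highIdeal (lt_of_le_of_ne (hmin j hjs) fun h => ?_)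
  exact Finset.ne_of_mem_erase hj (hinjOn hi hjs (hq.injective h)).symm

end IsRegularSystem

/-- The units of a subfield, as a subgroup of the units of the field. -/
def Subfield.unitsOf {F : Type*} [Field F] (L : Subfield F) : Subgroup Fˣ where
  carrier := {u | (u : F) ∈ L}
  mul_mem' ha hb := by simpa using L.mul_mem ha hb
  one_mem' := by simp
  inv_mem' ha := by simpa using ha

section Index

variable {F Γ : Type*} {G : Type} [Field F] [CommGroup Γ] [CommGroup G]

lemma relIndex_map_unitsOf_le [Finite G] (lam : Fˣ →* Γ)
    (hlam : ∀ {κ : Type} (s : Finset κ) (_ : s.Nonempty) (z : κ → Fˣ)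
      (_ : Set.InjOn (fun i => lam (z i)) s), ∑ i ∈ s, (z i : F) ≠ 0)
    (ψ : Γ →* G) {L L' : Subfield F} (e : Finset F)
    (he : ∀ z ∈ L', z ∈ Submodule.span L (e : Set F)) :
    (L.unitsOf.map (ψ.comp lam)).relIndex (L'.unitsOf.map (ψ.comp lam)) ≤ e.card := by
  classical
  set μ := ψ.comp lam
  set K := L.unitsOf.map μ
  set H := L'.unitsOf.map μ
  have hrep : ∀ c : H ⧸ K.subgroupOf H, ∃ u : Fˣ, (u : F) ∈ L' ∧
      ∃ hu : μ u ∈ H, (QuotientGroup.mk ⟨μ u, hu⟩ : H ⧸ K.subgroupOf H) = c := fun c => by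
    obtain ⟨⟨h, u, hu, rfl⟩, rfl⟩ := QuotientGroup.mk_surjective c
    exact ⟨u, hu, ⟨u, hu, rfl⟩, rfl⟩
  choose u hu hμ hmk using hrep
  have : Fintype (H ⧸ K.subgroupOf H) := Fintype.ofFinite _
  have hli : LinearIndependent L fun c => (u c : F) := by
    rw [Fintype.linearIndependent_iff]
    intro g hg
    by_contra! hne
    obtain ⟨c0, hc0⟩ := hne
    let s : Finset (H ⧸ K.subgroupOf H) := Finset.univ.filter fun c => g c ≠ 0
    let v : (H ⧸ K.subgroupOf H) → Fˣ := fun c =>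
      if h : g c ≠ 0 then Units.mk0 (g c : F) (by simpa using h) else 1
    have hv : ∀ c ∈ s, (v c : F) = g c ∧ v c ∈ L.unitsOf := fun c hc => by
      have : g c ≠ 0 := by simpa [s] using hc
      have h1 : (v c : F) = g c := by simp [v, this]
      refine ⟨h1, ?_⟩
      change (v c : F) ∈ L
      rw [h1]; exact (g c).2
    refine hlam s ⟨c0, by simpa [s] using hc0⟩ (fun c => v c * u c) ?_ ?_
    · intro c hc d hd hcd
      have h1 : μ (v c * u c) = μ (v d * u d) := congrArg ψ hcd
      rw [← hmk c, ← hmk d, QuotientGroup.eq, Subgroup.mem_subgroupOf]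
      have h2 : (μ (u c))⁻¹ * μ (u d) = μ (v c * (v d)⁻¹) := by
        rw [map_mul, map_mul] at h1
        rw [map_mul, map_inv, inv_mul_eq_iff_eq_mul, ← mul_assoc, eq_mul_inv_iff_mul_eq,
          mul_comm, ← h1, mul_comm]
      change (μ (u c))⁻¹ * μ (u d) ∈ K
      rw [h2]
      exact ⟨_, mul_mem (hv c hc).2 (inv_mem (hv d hd).2), rfl⟩
    · rw [← hg, Finset.sum_filter]
      refine Finset.sum_congr rfl fun c _ => ?_
      by_cases h : g c = 0
      · simp [h]
      · have := (hv c (by simpa [s] using h)).1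
        simp [h, this, Subfield.smul_def]
  have h := linearIndependent_le_span' _ hli (e : Set F) (by
    rintro _ ⟨c, rfl⟩
    exact he _ (hu c))
  rw [Subgroup.relIndex, Subgroup.index, Nat.card_eq_fintype_card]
  simpa using h

lemma card_le_of_chain [Finite G] {p : ℕ} [Fact p.Prime] (hG : IsPGroup p G) (lam : Fˣ →* Γ)
    (hlam : ∀ {κ : Type} (s : Finset κ) (_ : s.Nonempty) (z : κ → Fˣ)
      (_ : Set.InjOn (fun i => lam (z i)) s), ∑ i ∈ s, (z i : F) ≠ 0)
    (ψ : Γ →* G) (hsurj : Function.Surjective (ψ.comp lam)) (L : ℕ → Subfield F)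
    (hmono : Monotone L) (h0 : ∀ u : Fˣ, (u : F) ∈ L 0 → ψ (lam u) = 1) (a : ℕ)
    (hstep : ∀ s < a, ∃ e : Finset F, e.card ≤ p + 1 ∧
      ∀ z ∈ L (s + 1), z ∈ Submodule.span (L s) (e : Set F))
    (e : Finset F) (he : ∀ z, z ∈ Submodule.span (L a) (e : Set F)) :
    Nat.card G ≤ p ^ a * e.card := by
  set μ := ψ.comp lam
  have hp := (Fact.out : p.Prime).two_le
  have hbot : (L 0).unitsOf.map μ = ⊥ := by
    rw [eq_bot_iff]
    rintro _ ⟨u, hu, rfl⟩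
    exact h0 u hu
  have hle : ∀ s t, s ≤ t → (L s).unitsOf.map μ ≤ (L t).unitsOf.map μ := fun s t hst =>
    Subgroup.map_mono fun u hu => hmono hst hu
  have hind : ∀ s ≤ a, Nat.card ((L s).unitsOf.map μ) ≤ p ^ s := by
    intro s
    induction s with
    | zero => intro _; rw [hbot]; simp
    | succ s ih =>
      intro hs
      have h1 := Subgroup.relIndex_mul_relIndex ⊥ _ _ bot_le (hle s (s + 1) (by omega))
      rw [Subgroup.relIndex_bot_left, Subgroup.relIndex_bot_left] at h1
      obtain ⟨e, hec, he⟩ := hstep s (by omega)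
      have h2 := (relIndex_map_unitsOf_le lam hlam ψ e he).trans hec
      set r := ((L s).unitsOf.map μ).relIndex ((L (s + 1)).unitsOf.map μ) with hr
      obtain ⟨t, ht⟩ := IsPGroup.iff_card.1 hG
      have hdvd : r ∣ p ^ t := by
        rw [← ht]
        exact (Dvd.intro_left _ h1).trans (Subgroup.card_subgroup_dvd_card _)
      obtain ⟨i, -, hi⟩ := (Nat.dvd_prime_pow Fact.out).1 hdvd
      have hrp : r ≤ p := by
        rcases Nat.lt_or_ge i 2 with h | h
        · rw [hi]; exact (Nat.pow_le_pow_right (by omega) (by omega : i ≤ 1)).trans (by simp)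
        · have := Nat.pow_le_pow_right (by omega : 0 < p) h
          rw [← hi] at this
          nlinarith
      rw [← h1, pow_succ]
      exact Nat.mul_le_mul (ih (by omega)) hrp
  have htop : (⊤ : Subfield F).unitsOf.map μ = ⊤ := by
    rw [eq_top_iff]
    intro g _
    obtain ⟨u, rfl⟩ := hsurj g
    exact ⟨u, Subfield.mem_top (u : F), rfl⟩
  have h1 := Subgroup.relIndex_mul_relIndex ⊥ _ _ bot_le
    (Subgroup.map_mono (f := μ)
      (show (L a).unitsOf ≤ (⊤ : Subfield F).unitsOf from fun u _ => Subfield.mem_top (u : F)))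
  rw [Subgroup.relIndex_bot_left, htop, Subgroup.relIndex_bot_left, Subgroup.card_top] at h1
  rw [← h1]
  refine Nat.mul_le_mul (hind a le_rfl) ?_
  rw [← htop]
  exact relIndex_map_unitsOf_le lam hlam ψ e fun z _ => he z

end Index

section SubringHelpers

variable {F : Type} [Field F]

lemma Subring.isUnit_mk_iff {R : Subring F} {z : F} (hz : z ∈ R) :
    IsUnit (⟨z, hz⟩ : R) ↔ z ≠ 0 ∧ z⁻¹ ∈ R := by
  constructor
  · intro h
    obtain ⟨w, hw⟩ := isUnit_iff_exists_inv.1 h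
    have h1 : z * w = 1 := congrArg Subtype.val hw
    refine ⟨left_ne_zero_of_mul_eq_one h1, ?_⟩
    rw [← eq_inv_of_mul_eq_one_right h1]
    exact w.2
  · rintro ⟨h0, h1⟩
    exact isUnit_iff_exists_inv.2 ⟨⟨z⁻¹, h1⟩, Subtype.ext (mul_inv_cancel₀ h0)⟩

lemma Subring.isUnit_iff {R : Subring F} (z : R) :
    IsUnit z ↔ (z : F) ≠ 0 ∧ (z : F)⁻¹ ∈ R := Subring.isUnit_mk_iff z.2

lemma dominates_iff {S R : Subring F} :
    Dominates S R ↔ R ≤ S ∧ ∀ z ∈ R, z⁻¹ ∈ S → z⁻¹ ∈ R := by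
  constructor
  · rintro ⟨hle, h⟩
    refine ⟨hle, fun z hz hzS => ?_⟩
    rcases eq_or_ne z 0 with rfl | h0
    · simp
    have := (not_iff_not.1 (h z hz (hle hz))).1 ((Subring.isUnit_mk_iff _).2 ⟨h0, hzS⟩)
    exact ((Subring.isUnit_mk_iff _).1 this).2
  · rintro ⟨hle, h⟩
    refine ⟨hle, fun z hz hzS => not_congr ?_⟩
    rw [Subring.isUnit_mk_iff, Subring.isUnit_mk_iff]
    exact ⟨fun h1 => ⟨h1.1, h z hz h1.2⟩, fun h1 => ⟨h1.1, hle h1.2⟩⟩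

lemma Dominates.trans {R S T : Subring F} (h1 : Dominates T S) (h2 : Dominates S R) :
    Dominates T R := by
  rw [dominates_iff] at *
  exact ⟨h2.1.trans h1.1, fun z hz hzT => h2.2 z hz (h1.2 z (h2.1 hz) hzT)⟩

lemma isLocalRing_subring_iff {R : Subring F} : IsLocalRing R ↔
    ∀ z ∈ R, z ≠ 0 → z⁻¹ ∈ R ∨ (1 - z)⁻¹ ∈ R := by
  constructor
  · intro h z hz h0
    rcases IsLocalRing.isUnit_or_isUnit_one_sub_self (⟨z, hz⟩ : R) with h1 | h1
    · exact Or.inl ((Subring.isUnit_iff _).1 h1).2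
    · exact Or.inr ((Subring.isUnit_iff _).1 h1).2
  · intro h
    refine IsLocalRing.of_isUnit_or_isUnit_one_sub_self fun z => ?_
    rcases eq_or_ne (z : F) 0 with h0 | h0
    · right
      rw [show z = 0 from Subtype.ext h0]
      simp
    rcases eq_or_ne (1 - (z : F)) 0 with h2 | h2
    · left
      rw [show z = 1 from Subtype.ext (sub_eq_zero.1 h2).symm]
      simp
    rcases h z z.2 h0 with h1 | h1
    · exact Or.inl ((Subring.isUnit_iff _).2 ⟨h0, h1⟩)
    · exact Or.inr ((Subring.isUnit_iff _).2 ⟨h2, h1⟩)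

namespace IsRegularSystem

variable {R S ι κ : Type*} [CommRing R] [CommRing S] [Fintype ι] [Fintype κ] {y : ι → R}

lemma reindex (hy : IsRegularSystem y) (e : κ ≃ ι) : IsRegularSystem fun i => y (e i) where
  isNoetherianRing := hy.isNoetherianRing
  isLocalRing := hy.isLocalRing
  ringKrullDim_eq := by rw [hy.ringKrullDim_eq, Fintype.card_congr e]
  mem_span_iff z := by
    rw [← hy.mem_span_iff, show Set.range (fun i => y (e i)) = Set.range y from
      e.surjective.range_comp y]

lemma map_equiv (hy : IsRegularSystem y) (e : R ≃+* S) : IsRegularSystem fun i => e (y i) where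
  isNoetherianRing := have := hy.isNoetherianRing; isNoetherianRing_of_ringEquiv R e
  isLocalRing := have := hy.isLocalRing; e.isLocalRing
  ringKrullDim_eq := by rw [← hy.ringKrullDim_eq, ringKrullDim_eq_of_ringEquiv e]
  mem_span_iff z := by
    obtain ⟨z, rfl⟩ := e.surjective z
    rw [show Set.range (fun i => e (y i)) = e '' Set.range y from Set.range_comp e y,
      ← Ideal.map_span (e : R ≃+* S), MulEquiv.isUnit_map, ← hy.mem_span_iff,
      Ideal.mem_map_of_equiv]
    simp

end IsRegularSystem

lemma isRegularLocalOfDim_iff {A : Subring F} {n : ℕ} :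
    IsRegularLocalOfDim A n ↔ ∃ s : Fin n → A, IsRegularSystem s := by
  constructor
  · rintro ⟨h1, h2, h3, s, h4⟩
    exact ⟨s, h1, h2, by simpa using h3, h4⟩
  · rintro ⟨s, h1, h2, h3, h4⟩
    exact ⟨h1, h2, by simpa using h3, s, h4⟩

lemma IsRegularLocalOfDim.isRegularSystem {A : Subring F} {n : ℕ} (h : IsRegularLocalOfDim A n)
    {s : Fin n → A} (hs : ∀ z : A, z ∈ Ideal.span (Set.range s) ↔ ¬ IsUnit z) :
    IsRegularSystem s := ⟨h.1, h.2.1, by simpa using h.2.2.1, hs⟩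

lemma isMonomialExtension_iff {A B : Subring F} : IsMonomialExtension A B ↔
    ∃ (n : ℕ) (hAB : A ≤ B) (x : Fin n → A) (y : Fin n → B) (δ : Fin n → B)
      (M : Matrix (Fin n) (Fin n) ℕ), IsRegularSystem x ∧ IsRegularSystem y ∧
      (∀ i, IsUnit (δ i)) ∧ (M.map ((↑·) : ℕ → ℚ)).det ≠ 0 ∧
      ∀ i, Subring.inclusion hAB (x i) = δ i * monom y (M i) := by
  constructor
  · rintro ⟨n, hAB, hA, hB, x, y, δ, M, hx, hy, hδ, hM, h⟩
    exact ⟨n, hAB, x, y, δ, M, hA.isRegularSystem hx, hB.isRegularSystem hy, hδ, hM, h⟩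
  · rintro ⟨n, hAB, x, y, δ, M, hx, hy, hδ, hM, h⟩
    exact ⟨n, hAB, isRegularLocalOfDim_iff.2 ⟨x, hx⟩, isRegularLocalOfDim_iff.2 ⟨y, hy⟩,
      x, y, δ, M, hx.mem_span_iff, hy.mem_span_iff, hδ, hM, h⟩

lemma isFractionRing_subring {R : Subring F} (h : ∀ z : F, ∃ a ∈ R, ∃ b ∈ R, b ≠ 0 ∧ z * b = a) :
    IsFractionRing R F := by
  refine IsFractionRing.of_field R F fun z => ?_
  obtain ⟨a, ha, b, hb, h0, h1⟩ := h z
  exact ⟨⟨a, ha⟩, ⟨b, hb⟩, by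
    change z = a / b
    rw [eq_div_iff h0, h1]⟩

end SubringHelpers

section Localization

variable {C E : Type*} [CommRing C] [Field E]

/-- The localization of `C` at the prime ideal `P`, realized inside the field `E`. -/
def locSubring (g : C →+* E) (P : Ideal C) [hP : P.IsPrime] : Subring E where
  carrier := {f | ∃ c d, d ∉ P ∧ f * g d = g c}
  mul_mem' := by
    rintro f f' ⟨c, d, hd, h⟩ ⟨c', d', hd', h'⟩
    exact ⟨c * c', d * d', hP.mul_notMem hd hd', by rw [map_mul, map_mul, ← h, ← h']; ring⟩
  one_mem' := ⟨1, 1, hP.one_notMem, by simp⟩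
  add_mem' := by
    rintro f f' ⟨c, d, hd, h⟩ ⟨c', d', hd', h'⟩
    exact ⟨c * d' + c' * d, d * d', hP.mul_notMem hd hd', by
      simp only [map_mul, map_add, ← h, ← h']; ring⟩
  zero_mem' := ⟨0, 1, hP.one_notMem, by simp⟩
  neg_mem' := by
    rintro f ⟨c, d, hd, h⟩
    exact ⟨-c, d, hd, by rw [map_neg, ← h]; ring⟩

lemma map_ne_zero_of_notMem (g : C →+* E) (P : Ideal C) (hg : Function.Injective g) {d : C}
    (hd : d ∉ P) : g d ≠ 0 := fun h =>
  hd (by rw [hg (h.trans (map_zero g).symm)]; exact P.zero_mem)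

variable (g : C →+* E) (P : Ideal C) [hP : P.IsPrime]

lemma mem_locSubring {f : E} : f ∈ locSubring g P ↔ ∃ c d, d ∉ P ∧ f * g d = g c := Iff.rfl

lemma map_mem_locSubring (c : C) : g c ∈ locSubring g P := ⟨c, 1, hP.one_notMem, by simp⟩

/-- The structure map to the localization. -/
def toLocSubring : C →+* locSubring g P := g.codRestrict _ (map_mem_locSubring g P)

lemma inv_map_mem_locSubring (hg : Function.Injective g) {d : C} (hd : d ∉ P) :
    (g d)⁻¹ ∈ locSubring g P :=
  ⟨1, d, hd, by rw [inv_mul_cancel₀ (map_ne_zero_of_notMem g P hg hd), map_one]⟩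

lemma isLocalization_locSubring (hg : Function.Injective g) :
    letI := (toLocSubring g P).toAlgebra
    IsLocalization.AtPrime (locSubring g P) P := by
  let := (toLocSubring g P).toAlgebra
  refine ⟨fun ⟨d, hd⟩ => ?_, fun ⟨f, c, d, hd, h⟩ => ?_, fun {c d} h => ?_⟩
  · exact isUnit_iff_exists_inv.2 ⟨⟨_, inv_map_mem_locSubring g P hg hd⟩,
      Subtype.ext (mul_inv_cancel₀ (map_ne_zero_of_notMem g P hg hd))⟩
  · exact ⟨(c, ⟨d, hd⟩), Subtype.ext h⟩
  · refine ⟨1, ?_⟩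
    rw [hg (congrArg Subtype.val h : g c = g d)]

lemma isRegularSystem_locSubring (hg : Function.Injective g) [IsNoetherianRing C] {ι : Type*}
    [Fintype ι] {x : ι → C}
    (hx : Ideal.span (Set.range x) = P) (hh : P.height = Fintype.card ι) :
    IsRegularSystem fun i => toLocSubring g P (x i) := by
  let := (toLocSubring g P).toAlgebra
  have := isLocalization_locSubring g P hg
  have hl := IsLocalization.AtPrime.isLocalRing (locSubring g P) P
  refine ⟨IsLocalization.isNoetherianRing P.primeCompl _ inferInstance, hl, ?_, fun z => ?_⟩
  · rw [IsLocalization.AtPrime.ringKrullDim_eq_height P (locSubring g P), hh]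
    simp
  · rw [← mem_nonunits_iff, ← IsLocalRing.mem_maximalIdeal,
      ← IsLocalization.AtPrime.map_eq_maximalIdeal P (locSubring g P)]
    have h := Ideal.map_span (algebraMap C (locSubring g P)) (Set.range x)
    rw [hx, ← Set.range_comp] at h
    rw [h]
    rfl

end Localization

section

open Polynomial

section RationalFunctions

variable {F : Type} [Field F]

instance Polynomial.isPrime_span_X : (Ideal.span {(X : F[X])}).IsPrime :=
  (Ideal.span_singleton_prime X_ne_zero).2 prime_X

lemma Polynomial.mem_span_X_iff {r : F[X]} : r ∈ Ideal.span {(X : F[X])} ↔ r.coeff 0 = 0 := by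
  rw [Ideal.mem_span_singleton, X_dvd_iff]

/-- The local ring of rational functions without pole at the origin. -/
noncomputable def originRing (F : Type) [Field F] : Subring (RatFunc F) :=
  locSubring (algebraMap F[X] (RatFunc F)) (Ideal.span {(X : F[X])})

lemma mem_originRing {f : RatFunc F} : f ∈ originRing F ↔ ∃ c d : F[X], d.coeff 0 ≠ 0 ∧
    f * algebraMap F[X] (RatFunc F) d = algebraMap F[X] (RatFunc F) c := by
  simp_rw [← not_iff_not.2 mem_span_X_iff]
  exact mem_locSubring _ _

lemma algebraMap_mem_originRing (c : F[X]) : algebraMap F[X] (RatFunc F) c ∈ originRing F :=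
  map_mem_locSubring _ _ c

lemma exists_taylor : ∃ θ : originRing F →+* PowerSeries F,
    ∀ c : F[X], θ ⟨_, algebraMap_mem_originRing c⟩ = c := by
  let : Algebra F[X] (originRing F) :=
    (toLocSubring (algebraMap F[X] (RatFunc F)) (Ideal.span {(X : F[X])})).toAlgebra
  have : IsLocalization.AtPrime (originRing F) (Ideal.span {(X : F[X])}) :=
    isLocalization_locSubring (algebraMap F[X] (RatFunc F)) (Ideal.span {(X : F[X])})
    (RatFunc.algebraMap_injective F)
  have h : ∀ r : (Ideal.span {(X : F[X])}).primeCompl,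
      IsUnit ((coeToPowerSeries.ringHom : F[X] →+* PowerSeries F) r) := fun ⟨r, hr⟩ => by
    rw [PowerSeries.isUnit_iff_constantCoeff]
    have : r.coeff 0 ≠ 0 := fun h => hr (mem_span_X_iff.2 h)
    simpa using this
  exact ⟨IsLocalization.lift h, fun c => IsLocalization.lift_eq h c⟩

/-- The Taylor expansion at the origin of a rational function without pole there. -/
noncomputable def taylorSeries (F : Type) [Field F] : originRing F →+* PowerSeries F :=
  (exists_taylor (F := F)).choose

lemma taylor_algebraMap (c : F[X]) (h : algebraMap F[X] (RatFunc F) c ∈ originRing F) :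
    taylorSeries F ⟨_, h⟩ = c := (exists_taylor (F := F)).choose_spec c

lemma taylor_mul_eq (f : originRing F) {c d : F[X]}
    (h : (f : RatFunc F) * algebraMap F[X] (RatFunc F) d = algebraMap F[X] (RatFunc F) c) :
    taylorSeries F f * d = c := by
  rw [← taylor_algebraMap d (algebraMap_mem_originRing d),
    ← taylor_algebraMap c (algebraMap_mem_originRing c), ← map_mul]
  congr 1
  exact Subtype.ext h

/-- Evaluation at the origin. -/
noncomputable def evalOrigin (F : Type) [Field F] : originRing F →+* F :=
  PowerSeries.constantCoeff.comp (taylorSeries F)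

lemma evalOrigin_algebraMap (c : F[X]) (h : algebraMap F[X] (RatFunc F) c ∈ originRing F) :
    evalOrigin F ⟨_, h⟩ = c.coeff 0 := by
  simp [evalOrigin, taylor_algebraMap]

lemma evalOrigin_mul_eq (f : originRing F) {c d : F[X]}
    (h : (f : RatFunc F) * algebraMap F[X] (RatFunc F) d = algebraMap F[X] (RatFunc F) c) :
    evalOrigin F f * d.coeff 0 = c.coeff 0 := by
  have := congrArg PowerSeries.constantCoeff (taylor_mul_eq f h)
  simpa [evalOrigin] using this

lemma inv_mem_originRing (f : originRing F) (hf : evalOrigin F f ≠ 0) :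
    (f : RatFunc F)⁻¹ ∈ originRing F := by
  obtain ⟨c, d, hd, h⟩ := mem_originRing.1 f.2
  have h1 := evalOrigin_mul_eq f h
  have hc : c.coeff 0 ≠ 0 := h1 ▸ mul_ne_zero hf hd
  refine mem_originRing.2 ⟨d, c, hc, ?_⟩
  rw [← h, inv_mul_cancel_left₀]
  rintro h0
  rw [h0, zero_mul] at h
  rw [(RatFunc.algebraMap_injective F) (h.symm.trans (map_zero _).symm)] at hc
  simp at hc

/-- Every nonzero rational function is, up to a power of the variable, a quotient of polynomials
with nonzero constant coefficient. -/
lemma exists_X_pow_mul_eq {f : RatFunc F} (hf : f ≠ 0) : ∃ (a b : ℕ) (c d : F[X]),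
    c.coeff 0 ≠ 0 ∧ d.coeff 0 ≠ 0 ∧
    f * algebraMap F[X] (RatFunc F) (X ^ b * d) = algebraMap F[X] (RatFunc F) (X ^ a * c) := by
  have key : ∀ c : F[X], c ≠ 0 → ∃ (a : ℕ) (c' : F[X]), c'.coeff 0 ≠ 0 ∧ c = X ^ a * c' :=
    fun c hc => by
      obtain ⟨c', h1, h2⟩ := Polynomial.exists_eq_pow_rootMultiplicity_mul_and_not_dvd c hc 0
      rw [map_zero, sub_zero] at h1 h2
      exact ⟨_, c', fun h => h2 (X_dvd_iff.2 h), h1⟩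
  obtain ⟨c, d, hd, h⟩ := IsFractionRing.div_surjective F[X] f
  have hd0 : d ≠ 0 := nonZeroDivisors.ne_zero hd
  have hc0 : c ≠ 0 := by
    rintro rfl
    simp at h
    exact hf h.symm
  obtain ⟨a, c', hc', rfl⟩ := key c hc0
  obtain ⟨b, d', hd', rfl⟩ := key d hd0
  refine ⟨a, b, c', d', hc', hd', ?_⟩
  rw [← h, div_mul_cancel₀]
  exact fun h0 => hd0 ((RatFunc.algebraMap_injective F) (h0.trans (map_zero _).symm))

lemma mem_or_inv_mem_originRing (f : RatFunc F) : f ∈ originRing F ∨ f⁻¹ ∈ originRing F := by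
  rcases eq_or_ne f 0 with rfl | hf
  · exact Or.inl (zero_mem _)
  obtain ⟨a, b, c, d, hc, hd, h⟩ := exists_X_pow_mul_eq hf
  have hX : algebraMap F[X] (RatFunc F) X ≠ 0 := by simp [RatFunc.X_ne_zero]
  rcases le_total b a with hab | hab
  · left
    refine mem_originRing.2 ⟨X ^ (a - b) * c, d, hd, ?_⟩
    apply mul_right_cancel₀ (pow_ne_zero b hX)
    rw [map_mul, map_mul, map_pow, map_pow] at *
    rw [mul_assoc, mul_comm _ (_ ^ b), h]
    nth_rewrite 1 [← Nat.sub_add_cancel hab]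
    rw [pow_add]
    ring
  · right
    refine mem_originRing.2 ⟨X ^ (b - a) * d, c, hc, ?_⟩
    apply mul_right_cancel₀ (pow_ne_zero a hX)
    rw [map_mul, map_mul, map_pow, map_pow] at *
    rw [mul_assoc, mul_comm _ (_ ^ a), ← h, inv_mul_cancel_left₀ hf]
    nth_rewrite 1 [← Nat.sub_add_cancel hab]
    rw [pow_add]
    ring

end RationalFunctions

section ScaledEndomorphism

variable {k F : Type} [Field k] [Field F] [Algebra k F]

/-- Apply `φ` to the coefficients of a polynomial and replace the variable by its `e`-th power. -/
noncomputable def expandMap (φ : F →ₐ[k] F) (e : ℕ) : F[X] →ₐ[k] F[X] :=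
  ((expand F e).restrictScalars k).comp (mapAlgHom φ)

lemma expandMap_apply (φ : F →ₐ[k] F) (e : ℕ) (f : F[X]) :
    expandMap φ e f = expand F e (f.map (φ : F →+* F)) := rfl

lemma expandMap_injective (φ : F →ₐ[k] F) {e : ℕ} (he : 0 < e) :
    Function.Injective (expandMap φ e) :=
  (expand_injective he).comp (map_injective _ (φ : F →+* F).injective)

lemma expandMap_coeff_zero (φ : F →ₐ[k] F) {e : ℕ} (he : 0 < e) (f : F[X]) :
    (expandMap φ e f).coeff 0 = φ (f.coeff 0) := by
  rw [expandMap_apply, coeff_expand he]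
  simp

/-- The endomorphism of the rational function field applying `φ` to the coefficients and sending
the variable to its `e`-th power. -/
noncomputable def expandHom (φ : F →ₐ[k] F) {e : ℕ} (he : 0 < e) : RatFunc F →ₐ[k] RatFunc F :=
  RatFunc.mapAlgHom (expandMap φ e)
    (nonZeroDivisors_le_comap_nonZeroDivisors_of_injective _ (expandMap_injective φ he))

lemma expandHom_algebraMap (φ : F →ₐ[k] F) {e : ℕ} (he : 0 < e) (f : F[X]) :
    expandHom φ he (algebraMap F[X] (RatFunc F) f) =
      algebraMap F[X] (RatFunc F) (expandMap φ e f) := by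
  have := RatFunc.map_apply_div (expandMap φ e)
    (nonZeroDivisors_le_comap_nonZeroDivisors_of_injective _ (expandMap_injective φ he)) f 1
  simp only [map_one, div_one] at this
  exact this

lemma expandHom_mem_originRing {φ : F →ₐ[k] F} {e : ℕ} (he : 0 < e) {f : RatFunc F}
    (hf : f ∈ originRing F) : expandHom φ he f ∈ originRing F := by
  obtain ⟨c, d, hd, h⟩ := mem_originRing.1 hf
  refine mem_originRing.2 ⟨expandMap φ e c, expandMap φ e d, ?_, ?_⟩
  · rw [expandMap_coeff_zero φ he]
    simpa using hd
  · rw [← expandHom_algebraMap φ he, ← expandHom_algebraMap φ he, ← map_mul, h]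

lemma evalOrigin_expandHom {φ : F →ₐ[k] F} {e : ℕ} (he : 0 < e) (f : originRing F)
    (h : expandHom φ he f ∈ originRing F) : evalOrigin F ⟨_, h⟩ = φ (evalOrigin F f) := by
  obtain ⟨c, d, hd, h1⟩ := mem_originRing.1 f.2
  have h2 := evalOrigin_mul_eq f h1
  have h3 := evalOrigin_mul_eq ⟨_, h⟩ (c := expandMap φ e c) (d := expandMap φ e d)
    (by rw [← expandHom_algebraMap φ he, ← expandHom_algebraMap φ he, ← h1, map_mul])
  rw [expandMap_coeff_zero φ he, expandMap_coeff_zero φ he, ← h2, map_mul] at h3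
  exact mul_right_cancel₀ (by simpa using hd) h3

lemma X_pow_dvd_taylor_expandHom {φ : F →ₐ[k] F} {e : ℕ} (he : 0 < e) (f : originRing F)
    (h : expandHom φ he f ∈ originRing F) :
    (PowerSeries.X : PowerSeries F) ^ e ∣
      taylorSeries F ⟨_, h⟩ - PowerSeries.C (evalOrigin F ⟨_, h⟩) := by
  have key : ∀ c : F[X], (PowerSeries.X : PowerSeries F) ^ e ∣
      (expandMap φ e c : PowerSeries F) - PowerSeries.C (φ (c.coeff 0)) := fun c => by
    rw [PowerSeries.X_pow_dvd_iff]
    intro l hl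
    rw [map_sub, Polynomial.coeff_coe, expandMap_apply, coeff_expand he, PowerSeries.coeff_C]
    rcases eq_or_ne l 0 with rfl | h0
    · simp
    · rw [if_neg (fun hd => h0 (Nat.eq_zero_of_dvd_of_lt hd hl)), if_neg h0, sub_zero]
  obtain ⟨c, d, hd, h1⟩ := mem_originRing.1 f.2
  have h2 := evalOrigin_mul_eq f h1
  have h3 := taylor_mul_eq ⟨_, h⟩ (c := expandMap φ e c) (d := expandMap φ e d)
    (by rw [← expandHom_algebraMap φ he, ← expandHom_algebraMap φ he, ← h1, map_mul])
  rw [evalOrigin_expandHom]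
  have h4 : φ (d.coeff 0) ≠ 0 := by simpa using hd
  have hu : IsUnit (PowerSeries.C (φ (d.coeff 0))) := (isUnit_iff_ne_zero.2 h4).map _
  rw [← hu.dvd_mul_right]
  obtain ⟨a, ha⟩ := key c
  obtain ⟨b, hb⟩ := key d
  refine ⟨a - taylorSeries F ⟨_, h⟩ * b, ?_⟩
  rw [← h2, map_mul, map_mul] at ha
  linear_combination ha - taylorSeries F ⟨_, h⟩ * hb + h3

end ScaledEndomorphism

section ScaledEndomorphism

variable {k F : Type} [Field k] [Field F] [Algebra k F]

lemma trdeg_ratFunc : Algebra.trdeg k (RatFunc F) = Algebra.trdeg k F + 1 := by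
  have h1 : Algebra.trdeg F (RatFunc F) = 1 := by
    have : Algebra.IsAlgebraic F[X] (RatFunc F) :=
      IsLocalization.isAlgebraic (RatFunc F) (nonZeroDivisors F[X])
    rw [← trdeg_add_eq F F[X] , Polynomial.trdeg_of_isDomain, trdeg_eq_zero,
      add_zero]
  rw [← trdeg_add_eq k F, h1]

lemma exists_isTranscendenceBasis_fin {n : ℕ} (h : Algebra.trdeg k F = n) :
    ∃ b : Fin n → F, IsTranscendenceBasis k b := by
  obtain ⟨s, hs⟩ := exists_isTranscendenceBasis k F
  have h1 : Cardinal.mk s = n := hs.cardinalMk_eq_trdeg.trans h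
  have : Nonempty (Fin n ≃ s) := by
    rw [← Cardinal.eq, h1]
    simp
  obtain ⟨e⟩ := this
  exact ⟨_, hs.comp_equiv e⟩

/-- A finite subalgebra of the rational function field containing the constants and the variable
is everything. -/
lemma subalgebra_eq_top_of_finite (L : Subfield (RatFunc F)) (A : Subalgebra L (RatFunc F))
    [Module.Finite L A] (hC : ∀ c : F, algebraMap F (RatFunc F) c ∈ A) (hX : RatFunc.X ∈ A)
    (z : RatFunc F) : z ∈ A := by
  have hpoly : ∀ c : F[X], algebraMap F[X] (RatFunc F) c ∈ A := fun c => by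
    induction c using Polynomial.induction_on' with
    | add p q hp hq => rw [map_add]; exact add_mem hp hq
    | monomial n a =>
      rw [← C_mul_X_pow_eq_monomial, map_mul, map_pow, RatFunc.algebraMap_X]
      exact mul_mem (by simpa using hC a) (pow_mem hX n)
  obtain ⟨c, d, hd, rfl⟩ := IsFractionRing.div_surjective F[X] z
  rw [div_eq_mul_inv]
  refine mul_mem (hpoly c) ?_
  have : IsAlgebraic L (algebraMap F[X] (RatFunc F) d) := by
    have h1 : IsAlgebraic L (⟨_, hpoly d⟩ : A) := Algebra.IsAlgebraic.isAlgebraic _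
    exact h1.algHom A.val
  exact A.inv_mem_of_algebraic (x := ⟨_, hpoly d⟩) this

lemma expandHom_C (φ : F →ₐ[k] F) {e : ℕ} (he : 0 < e) (c : F) :
    expandHom φ he (algebraMap F (RatFunc F) c) = algebraMap F (RatFunc F) (φ c) := by
  have := expandHom_algebraMap φ he (C c)
  rw [expandMap_apply] at this
  simpa using this

lemma expandHom_X (φ : F →ₐ[k] F) {e : ℕ} (he : 0 < e) :
    expandHom φ he RatFunc.X = RatFunc.X ^ e := by
  have := expandHom_algebraMap φ he X
  rw [expandMap_apply] at this
  simpa using this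

lemma expandHom_mul (φ : F →ₐ[k] F) {e q : ℕ} (he : 0 < e) (hq : 0 < q) (z : RatFunc F) :
    expandHom φ he (expandHom (AlgHom.id k F) hq z) = expandHom φ (Nat.mul_pos he hq) z := by
  have h : ∀ c : F[X], expandMap φ e (expandMap (AlgHom.id k F) q c) = expandMap φ (e * q) c :=
    fun c => by
      rw [expandMap_apply, expandMap_apply, expandMap_apply, map_expand, expand_expand,
        mul_comm]
      congr 1
      simp
  obtain ⟨c, d, hd, rfl⟩ := IsFractionRing.div_surjective F[X] z
  simp only [map_div₀, expandHom_algebraMap, h]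

/-- The rational functions form a finite module over the functions in the `q`-th power of the
variable. -/
lemma mem_span_X_pow {q : ℕ} (hq : 0 < q) (z : RatFunc F) :
    z ∈ Submodule.span (expandHom (AlgHom.id k F) hq).toRingHom.fieldRange
      ((fun i => (RatFunc.X : RatFunc F) ^ i) '' Set.Iio q) := by
  set L := (expandHom (AlgHom.id k F) hq).toRingHom.fieldRange with hL
  have hc : (RatFunc.X : RatFunc F) ^ q ∈ L := ⟨RatFunc.X, expandHom_X _ hq⟩
  let P : L[X] := X ^ q - C ⟨_, hc⟩
  have hP : P.Monic := monic_X_pow_sub_C _ hq.ne'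
  have hroot : aeval (RatFunc.X : RatFunc F) P = 0 := by
    simp only [P, map_sub, map_pow, aeval_X, aeval_C]
    exact sub_self _
  have hintegral : IsIntegral L (RatFunc.X : RatFunc F) := ⟨P, hP, hroot⟩
  have hfin : Module.Finite L (Algebra.adjoin L {(RatFunc.X : RatFunc F)}) :=
    Algebra.finite_adjoin_simple_of_isIntegral hintegral
  have hz := subalgebra_eq_top_of_finite L (Algebra.adjoin L {(RatFunc.X : RatFunc F)})
    (fun c => by
      have : algebraMap F (RatFunc F) c ∈ L := ⟨algebraMap F _ c, expandHom_C _ hq c⟩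
      exact Subalgebra.algebraMap_mem _ (⟨_, this⟩ : L))
    (Algebra.subset_adjoin rfl) z
  rw [Algebra.adjoin_singleton_eq_range_aeval] at hz
  obtain ⟨r, hr⟩ := hz
  have h2 : aeval (RatFunc.X : RatFunc F) (r %ₘ P) = z := by
    rw [← hr]
    conv_rhs => rw [← modByMonic_add_div r P]
    simp [hroot]
  rw [← h2, aeval_eq_sum_range]
  refine Submodule.sum_mem _ fun i hi => Submodule.smul_mem _ _ (Submodule.subset_span ?_)
  refine ⟨i, ?_, rfl⟩
  have h3 : (r %ₘ P).natDegree < q := by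
    have := natDegree_modByMonic_lt r hP (fun h1 => by
      have := congrArg natDegree h1
      simp only [P, natDegree_X_pow_sub_C, natDegree_one] at this
      omega)
    simpa [P, natDegree_X_pow_sub_C] using this
  simp only [Finset.mem_range, Set.mem_Iio] at hi ⊢
  omega

/-- The coefficient field extension controls the rational function field extension. -/
lemma mem_span_C (φ : F →ₐ[k] F) (s : Finset F)
    (hs : ∀ z, z ∈ Submodule.span φ.fieldRange (s : Set F)) (z : RatFunc F) :
    z ∈ Submodule.span (expandHom φ one_pos).toRingHom.fieldRange
      (algebraMap F (RatFunc F) '' s) := by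
  set L := (expandHom φ one_pos).toRingHom.fieldRange with hL
  set W := Submodule.span L (algebraMap F (RatFunc F) '' s)
  have hC : ∀ c : F, algebraMap F (RatFunc F) c ∈ W := fun c => by
    have := hs c
    induction this using Submodule.span_induction with
    | mem x hx => exact Submodule.subset_span ⟨x, hx, rfl⟩
    | zero => simp
    | add x y _ _ hx hy => rw [map_add]; exact add_mem hx hy
    | smul a x _ hx =>
      obtain ⟨_, b, rfl⟩ := a
      have hb : algebraMap F (RatFunc F) (φ b) ∈ L := ⟨algebraMap F _ b, expandHom_C _ one_pos b⟩
      have := W.smul_mem (⟨_, hb⟩ : L) hx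
      convert this using 1
      exact map_mul _ _ _
  let A := Algebra.adjoin L (Set.range (algebraMap F (RatFunc F)))
  have hA : Subalgebra.toSubmodule A ≤ W := by
    rw [Algebra.adjoin_eq_span, Submodule.span_le]
    have h1 : Submonoid.closure (Set.range (algebraMap F (RatFunc F))) ≤
        MonoidHom.mrange (algebraMap F (RatFunc F) : F →* RatFunc F) :=
      Submonoid.closure_le.2 fun x hx => hx
    rintro x hx
    obtain ⟨c, rfl⟩ := h1 hx
    exact hC c
  have hfin : Module.Finite L A := by
    have : Module.Finite L W := Module.Finite.span_of_finite L (s.finite_toSet.image _)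
    exact Submodule.finiteDimensional_of_le hA
  refine hA (subalgebra_eq_top_of_finite L A (fun c => Algebra.subset_adjoin ⟨c, rfl⟩) ?_ z)
  have : (RatFunc.X : RatFunc F) ∈ L := ⟨RatFunc.X, (expandHom_X _ one_pos).trans (pow_one _)⟩
  exact Subalgebra.algebraMap_mem A (⟨_, this⟩ : L)

end ScaledEndomorphism

section ScaledEndomorphism

variable {k F : Type} [Field k] [Field F] [Algebra k F]

/-- The inclusion of constants, restricted to the ranges of `φ` and its extension. -/
noncomputable def constantsHom (φ : F →ₐ[k] F) {e : ℕ} (he : 0 < e) :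
    φ.fieldRange →+* (expandHom φ he).fieldRange :=
  ((algebraMap F (RatFunc F)).comp (algebraMap φ.fieldRange F)).codRestrict
    (expandHom φ he).fieldRange (by
      rintro ⟨_, b, rfl⟩
      exact ⟨algebraMap F _ b, expandHom_C φ he b⟩)

lemma exists_separable_monic_aeval_eq_zero (φ : F →ₐ[k] F) {e : ℕ} (he : 0 < e) {c : F}
    (hc : IsSeparable φ.fieldRange c) : ∃ P : (expandHom φ he).fieldRange[X],
      P.Separable ∧ P.Monic ∧ aeval (algebraMap F (RatFunc F) c) P = 0 := by
  refine ⟨(minpoly φ.fieldRange c).map (constantsHom φ he), Polynomial.Separable.map hc,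
    (minpoly.monic hc.isIntegral).map _, ?_⟩
  rw [aeval_def, eval₂_map]
  have : (algebraMap (expandHom φ he).fieldRange (RatFunc F)).comp (constantsHom φ he) =
      (algebraMap F (RatFunc F)).comp (algebraMap φ.fieldRange F) := rfl
  rw [this, ← hom_eval₂, ← aeval_def, minpoly.aeval, map_zero]

lemma isSeparable_of_separable_aeval {L E : Type*} [Field L] [Field E] [Algebra L E] {x : E}
    {P : L[X]} (hP : P.Separable) (h : aeval x P = 0) : IsSeparable L x :=
  hP.of_dvd (minpoly.dvd L x h)

lemma adjoin_constants_eq_top (φ : F →ₐ[k] F) {e : ℕ} (he : 0 < e) {s : Set F}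
    (hs : IntermediateField.adjoin φ.fieldRange s = ⊤) :
    IntermediateField.adjoin (expandHom φ he).fieldRange
      (insert RatFunc.X (algebraMap F (RatFunc F) '' s)) = ⊤ := by
  set W := IntermediateField.adjoin (expandHom φ he).fieldRange
      (insert RatFunc.X (algebraMap F (RatFunc F) '' s))
  have hC : ∀ c : F, algebraMap F (RatFunc F) c ∈ W := fun c => by
    have hc : c ∈ IntermediateField.adjoin φ.fieldRange s := hs ▸ IntermediateField.mem_top
    induction hc using IntermediateField.adjoin_induction with
    | mem x hx => exact IntermediateField.subset_adjoin _ _ (Or.inr ⟨x, hx, rfl⟩)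
    | algebraMap x => exact W.algebraMap_mem (constantsHom φ he x)
    | add x y _ _ hx hy => rw [map_add]; exact add_mem hx hy
    | mul x y _ _ hx hy => rw [map_mul]; exact mul_mem hx hy
    | inv x _ hx => rw [map_inv₀]; exact inv_mem hx
  have hX : (RatFunc.X : RatFunc F) ∈ W := IntermediateField.subset_adjoin _ _ (Or.inl rfl)
  have hpoly : ∀ c : F[X], algebraMap F[X] (RatFunc F) c ∈ W := fun c => by
    induction c using Polynomial.induction_on' with
    | add p q hp hq => rw [map_add]; exact add_mem hp hq
    | monomial n a =>
      rw [← C_mul_X_pow_eq_monomial, map_mul, map_pow, RatFunc.algebraMap_X]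
      exact mul_mem (by simpa using hC a) (pow_mem hX n)
  rw [eq_top_iff]
  rintro z -
  obtain ⟨c, d, hd, rfl⟩ := IsFractionRing.div_surjective F[X] z
  exact div_mem (hpoly c) (hpoly d)

lemma finite_and_isSeparable_expandHom (φ : F →ₐ[k] F) {e : ℕ} (he : 0 < e)
    (hek : (e : k) ≠ 0) [FiniteDimensional φ.fieldRange F] [Algebra.IsSeparable φ.fieldRange F] :
    FiniteDimensional (expandHom φ he).fieldRange (RatFunc F) ∧
      Algebra.IsSeparable (expandHom φ he).fieldRange (RatFunc F) := by
  obtain ⟨s, hs0⟩ := Module.Finite.fg_top (R := φ.fieldRange) (M := F)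
  have hs : IntermediateField.adjoin φ.fieldRange (s : Set F) = ⊤ := by
    rw [eq_top_iff]
    intro z _
    have hz : z ∈ Submodule.span φ.fieldRange (s : Set F) := hs0 ▸ Submodule.mem_top
    exact (Submodule.span_le (p := (IntermediateField.adjoin φ.fieldRange
      (s : Set F)).toSubalgebra.toSubmodule)).2 (IntermediateField.subset_adjoin _ _) hz
  set L := (expandHom φ he).fieldRange
  have htop := adjoin_constants_eq_top φ he hs
  have hX : ∃ P : L[X], P.Separable ∧ P.Monic ∧ aeval (RatFunc.X : RatFunc F) P = 0 := by
    have hc : (RatFunc.X : RatFunc F) ^ e ∈ L := ⟨RatFunc.X, expandHom_X _ he⟩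
    have hc0 : (⟨_, hc⟩ : L) ≠ 0 := fun h =>
      pow_ne_zero e RatFunc.X_ne_zero (congrArg Subtype.val h)
    have heL : (e : L) ≠ 0 := by
      rw [← map_natCast (algebraMap k L)]
      exact fun h => hek ((algebraMap k L).injective (h.trans (map_zero _).symm))
    refine ⟨X ^ e - C ⟨_, hc⟩, separable_X_pow_sub_C _ heL hc0, monic_X_pow_sub_C _ he.ne', ?_⟩
    simp only [map_sub, map_pow, aeval_X, aeval_C]
    exact sub_self _
  have hall : ∀ x ∈ insert RatFunc.X (algebraMap F (RatFunc F) '' s),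
      ∃ P : L[X], P.Separable ∧ P.Monic ∧ aeval x P = 0 := by
    rintro x (rfl | ⟨c, -, rfl⟩)
    · exact hX
    · exact exists_separable_monic_aeval_eq_zero φ he (Algebra.IsSeparable.isSeparable _ c)
  have hfin : Finite ↑(insert RatFunc.X (algebraMap F (RatFunc F) '' s)) :=
    Set.Finite.to_subtype ((s.finite_toSet.image _).insert _)
  constructor
  · have := IntermediateField.finiteDimensional_adjoin (K := L)
      (S := insert RatFunc.X (algebraMap F (RatFunc F) '' s)) fun x hx => by
        obtain ⟨P, -, h1, h2⟩ := hall x hx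
        exact ⟨P, h1, h2⟩
    rw [htop] at this
    exact Module.Finite.equiv (IntermediateField.topEquiv (F := L) (E := RatFunc F)).toLinearEquiv
  · have := (IntermediateField.isSeparable_adjoin_iff_isSeparable (F := L) (E := RatFunc F)
      (S := insert RatFunc.X (algebraMap F (RatFunc F) '' s))).2 fun x hx => by
        obtain ⟨P, h1, -, h2⟩ := hall x hx
        exact isSeparable_of_separable_aeval h1 h2
    rw [htop] at this
    exact AlgEquiv.Algebra.isSeparable (IntermediateField.topEquiv (F := L) (E := RatFunc F))

end ScaledEndomorphism

section StepRings

variable {k F : Type} [Field k] [Field F] [Algebra k F]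

/-- The composite of the order valuation of `F(X)` at the origin with the valuation ring `V`. -/
noncomputable def compositeRing (V : Subring F) : Subring (RatFunc F) :=
  (V.comap (evalOrigin F)).map (originRing F).subtype

lemma mem_compositeRing {V : Subring F} {f : RatFunc F} :
    f ∈ compositeRing V ↔ ∃ h : f ∈ originRing F, evalOrigin F ⟨f, h⟩ ∈ V := by
  simp [compositeRing, Subring.mem_map, Subring.mem_comap]

lemma evalOrigin_inv {f : RatFunc F} (hf : f ∈ originRing F) (hf' : f⁻¹ ∈ originRing F)
    (h0 : f ≠ 0) : evalOrigin F ⟨f, hf⟩ ≠ 0 ∧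
      evalOrigin F ⟨f⁻¹, hf'⟩ = (evalOrigin F ⟨f, hf⟩)⁻¹ := by
  have h : evalOrigin F ⟨f, hf⟩ * evalOrigin F ⟨f⁻¹, hf'⟩ = 1 := by
    rw [← map_mul, ← map_one (evalOrigin F)]
    congr 1
    exact Subtype.ext (mul_inv_cancel₀ h0)
  exact ⟨left_ne_zero_of_mul_eq_one h, eq_inv_of_mul_eq_one_right h⟩

lemma X_mem_originRing : (RatFunc.X : RatFunc F) ∈ originRing F := by
  simpa using algebraMap_mem_originRing (X : F[X])

lemma evalOrigin_X : evalOrigin F ⟨RatFunc.X, X_mem_originRing⟩ = 0 := by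
  have := evalOrigin_algebraMap (X : F[X]) (algebraMap_mem_originRing _)
  simpa using this

lemma C_mem_originRing (c : F) : algebraMap F (RatFunc F) c ∈ originRing F := by
  simpa using algebraMap_mem_originRing (C c : F[X])

lemma evalOrigin_C (c : F) : evalOrigin F ⟨_, C_mem_originRing c⟩ = c := by
  have := evalOrigin_algebraMap (C c : F[X]) (algebraMap_mem_originRing _)
  simpa using this

lemma isValuationSubring_compositeRing {V : Subring F} (hV : IsValuationSubring V) :
    IsValuationSubring (compositeRing V) := by
  constructor
  · intro h
    have h1 : (RatFunc.X : RatFunc F)⁻¹ ∈ compositeRing V := h ▸ Subring.mem_top _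
    obtain ⟨h2, -⟩ := mem_compositeRing.1 h1
    exact (evalOrigin_inv X_mem_originRing h2 RatFunc.X_ne_zero).1 evalOrigin_X
  · have key : ∀ z ∈ originRing F, z ≠ 0 → z ∈ compositeRing V ∨ z⁻¹ ∈ compositeRing V := by
      intro z hz h0
      by_cases hev : evalOrigin F ⟨z, hz⟩ = 0
      · exact Or.inl (mem_compositeRing.2 ⟨hz, hev ▸ V.zero_mem⟩)
      have hz' := inv_mem_originRing ⟨z, hz⟩ hev
      rcases hV.2 _ hev with h | h
      · exact Or.inl (mem_compositeRing.2 ⟨hz, h⟩)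
      · exact Or.inr (mem_compositeRing.2 ⟨hz', (evalOrigin_inv hz hz' h0).2 ▸ h⟩)
    intro z h0
    rcases mem_or_inv_mem_originRing z with h | h
    · exact key z h h0
    · have := key _ h (inv_ne_zero h0)
      rw [inv_inv] at this
      exact this.symm

lemma C_mem_compositeRing {V : Subring F} {c : F} (hc : c ∈ V) :
    algebraMap F (RatFunc F) c ∈ compositeRing V :=
  mem_compositeRing.2 ⟨C_mem_originRing c, (evalOrigin_C c).symm ▸ hc⟩

/-- The residue field of `V` is `k`. -/
def HasResidueField (k : Type) {F : Type} [Field k] [Field F] [Algebra k F] (V : Subring F) :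
    Prop :=
  ∀ f ∈ V, ∃ c : k, f - algebraMap k F c = 0 ∨ (f - algebraMap k F c)⁻¹ ∉ V

lemma hasResidueField_compositeRing {V : Subring F} (hV : HasResidueField k V) :
    HasResidueField k (compositeRing V) := by
  intro f hf
  obtain ⟨h1, h2⟩ := mem_compositeRing.1 hf
  obtain ⟨c, hc⟩ := hV _ h2
  refine ⟨c, ?_⟩
  by_contra! hcon
  obtain ⟨h3, h4⟩ := mem_compositeRing.1 hcon.2
  have hm : f - algebraMap k (RatFunc F) c ∈ originRing F := by
    rw [IsScalarTower.algebraMap_apply k F (RatFunc F)]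
    exact sub_mem h1 (C_mem_originRing _)
  have h5 : evalOrigin F ⟨_, hm⟩ = evalOrigin F ⟨f, h1⟩ - algebraMap k F c := by
    rw [← evalOrigin_C (algebraMap k F c), ← map_sub]
    congr 1
  obtain ⟨h6, h7⟩ := evalOrigin_inv hm h3 hcon.1
  rw [h5] at h6 h7
  rcases hc with hc | hc
  · exact h6 hc
  · exact hc (h7 ▸ h4)

variable (B : Subring F) [IsLocalRing B]

/-- Polynomials whose constant coefficient is a nonunit. -/
noncomputable def originIdeal : Ideal B[X] := (IsLocalRing.maximalIdeal B).comap constantCoeff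

instance : (originIdeal B).IsMaximal :=
  Ideal.comap_isMaximal_of_surjective _ fun b => ⟨C b, by simp⟩

lemma mem_originIdeal {d : B[X]} : d ∈ originIdeal B ↔ ¬ IsUnit (d.coeff 0) := by
  simp [originIdeal, Ideal.mem_comap]

/-- The inclusion of polynomials over `B` in the rational functions over `F`. -/
noncomputable def polyHom : B[X] →+* RatFunc F :=
  (algebraMap F[X] (RatFunc F)).comp (mapRingHom B.subtype)

/-- The localization of `B[X]` at the origin. -/
noncomputable def stepRing : Subring (RatFunc F) := locSubring (polyHom B) (originIdeal B)

end StepRings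

section StepRings

variable {k F : Type} [Field k] [Field F] [Algebra k F] {B : Subring F}

lemma polyHom_apply (d : B[X]) : polyHom B d = algebraMap F[X] (RatFunc F) (d.map B.subtype) := rfl

lemma polyHom_injective : Function.Injective (polyHom B) :=
  (RatFunc.algebraMap_injective F).comp (map_injective _ B.subtype_injective)

variable [IsLocalRing B]

lemma mem_stepRing {f : RatFunc F} : f ∈ stepRing B ↔ ∃ c d : B[X], IsUnit (d.coeff 0) ∧
    f * polyHom B d = polyHom B c := by
  rw [stepRing, mem_locSubring]
  simp_rw [mem_originIdeal, not_not]

lemma polyHom_mem_stepRing (d : B[X]) : polyHom B d ∈ stepRing B := map_mem_locSubring _ _ d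

lemma mem_originRing_of_mem_stepRing {f : RatFunc F} (hf : f ∈ stepRing B) :
    ∃ h : f ∈ originRing F, evalOrigin F ⟨f, h⟩ ∈ B := by
  obtain ⟨c, d, hd, h⟩ := mem_stepRing.1 hf
  have hd' := (Subring.isUnit_iff _).1 hd
  have h1 : f ∈ originRing F := mem_originRing.2 ⟨c.map B.subtype, d.map B.subtype, by
    simpa using hd'.1, h⟩
  refine ⟨h1, ?_⟩
  have h2 := evalOrigin_mul_eq ⟨f, h1⟩ (c := c.map B.subtype) (d := d.map B.subtype) h
  simp only [coeff_map, Subring.subtype_apply] at h2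
  rw [(eq_mul_inv_iff_mul_eq₀ hd'.1).2 h2]
  exact mul_mem (c.coeff 0).2 hd'.2

lemma inv_mem_stepRing {f : RatFunc F} (hf : f ∈ stepRing B) {h0 : f ∈ originRing F}
    (h1 : evalOrigin F ⟨f, h0⟩ ≠ 0) (h2 : (evalOrigin F ⟨f, h0⟩)⁻¹ ∈ B) : f⁻¹ ∈ stepRing B := by
  obtain ⟨c, d, hd, h⟩ := mem_stepRing.1 hf
  have hd' := (Subring.isUnit_iff _).1 hd
  have h3 := evalOrigin_mul_eq ⟨f, h0⟩ (c := c.map B.subtype) (d := d.map B.subtype) h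
  simp only [coeff_map, Subring.subtype_apply] at h3
  refine mem_stepRing.2 ⟨d, c, (Subring.isUnit_iff _).2 ⟨?_, ?_⟩, ?_⟩
  · rw [← h3]
    exact mul_ne_zero h1 hd'.1
  · rw [← h3, mul_inv]
    exact mul_mem h2 hd'.2
  · rw [← h, inv_mul_cancel_left₀]
    rintro rfl
    exact h1 (map_zero _)

lemma dominates_compositeRing {V : Subring F} (hVB : Dominates V B) :
    Dominates (compositeRing V) (stepRing B) := by
  rw [dominates_iff] at hVB ⊢
  constructor
  · intro f hf
    obtain ⟨h1, h2⟩ := mem_originRing_of_mem_stepRing hf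
    exact mem_compositeRing.2 ⟨h1, hVB.1 h2⟩
  · intro f hf hf'
    rcases eq_or_ne f 0 with rfl | h0
    · simp
    obtain ⟨h1, h2⟩ := mem_originRing_of_mem_stepRing hf
    obtain ⟨h3, h4⟩ := mem_compositeRing.1 hf'
    obtain ⟨h5, h6⟩ := evalOrigin_inv h1 h3 h0
    exact inv_mem_stepRing hf h5 (hVB.2 _ h2 (h6 ▸ h4))

lemma dominates_map_expandHom {φ : F →ₐ[k] F} (hB : Dominates B (B.map (φ : F →+* F))) {e : ℕ}
    (he : 0 < e) :
    Dominates (stepRing B) ((stepRing B).map (expandHom φ he : RatFunc F →+* RatFunc F)) := by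
  rw [dominates_iff] at hB ⊢
  constructor
  · rintro _ ⟨f, hf, rfl⟩
    obtain ⟨c, d, hd, h⟩ := mem_stepRing.1 hf
    let φB : B →+* B := (φ : F →+* F).restrict B B fun b hb => hB.1 ⟨b, hb, rfl⟩
    have key : ∀ c : B[X], expandHom φ he (polyHom B c) = polyHom B (expand B e (c.map φB)) :=
      fun c => by
        rw [polyHom_apply, polyHom_apply, expandHom_algebraMap, expandMap_apply, map_expand,
          map_map, map_map]
        rfl
    refine mem_stepRing.2 ⟨expand B e (c.map φB), expand B e (d.map φB), ?_, ?_⟩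
    · rw [coeff_expand he]
      simpa using hd.map φB
    · rw [← key, ← key, ← h, map_mul]
      rfl
  · rintro _ ⟨f, hf, rfl⟩ hf'
    rcases eq_or_ne f 0 with rfl | h0
    · simp
    have h1 := hf'
    obtain ⟨h2, h3⟩ := mem_originRing_of_mem_stepRing h1
    obtain ⟨h4, h5⟩ := mem_originRing_of_mem_stepRing hf
    have h6 := expandHom_mem_originRing (φ := φ) he h4
    have h7 := evalOrigin_expandHom he ⟨f, h4⟩ h6
    have h8 : expandHom φ he f ≠ 0 := by simpa using h0
    obtain ⟨h9, h10⟩ := evalOrigin_inv h6 h2 h8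
    have h11 : (φ (evalOrigin F ⟨f, h4⟩))⁻¹ ∈ B := by
      rw [← h7, ← h10]
      exact h3
    obtain ⟨b, hb, hb'⟩ := hB.2 _ ⟨_, h5, rfl⟩ h11
    have h12 : b = (evalOrigin F ⟨f, h4⟩)⁻¹ := by
      apply (φ : F →+* F).injective
      rw [hb', map_inv₀]
    refine ⟨f⁻¹, inv_mem_stepRing hf (h0 := h4) ?_ (h12 ▸ hb), ?_⟩
    · intro h
      rw [h7] at h9
      simp [h] at h9
    · exact map_inv₀ _ _

lemma originIdeal_eq_span {ι : Type*} [Fintype ι] {s : ι → B} (hs : IsRegularSystem s) :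
    Ideal.span (Set.range (fun i : Option ι => i.elim (X : B[X]) fun j => C (s j))) =
      originIdeal B := by
  apply le_antisymm
  · rw [Ideal.span_le]
    rintro _ ⟨i, rfl⟩
    rw [SetLike.mem_coe, mem_originIdeal]
    cases i with
    | none => simp
    | some j => simpa using hs.not_isUnit j
  · intro d hd
    rw [mem_originIdeal, ← hs.mem_span_iff] at hd
    rw [← divX_mul_X_add d]
    refine add_mem (Ideal.mul_mem_left _ _ (Ideal.subset_span ⟨none, rfl⟩)) ?_
    have := Ideal.mem_map_of_mem (C : B →+* B[X]) hd
    rw [Ideal.map_span] at this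
    refine Ideal.span_mono ?_ this
    rintro _ ⟨_, ⟨j, rfl⟩, rfl⟩
    exact ⟨some j, rfl⟩

lemma isRegularLocalOfDim_stepRing {n : ℕ} (hB : IsRegularLocalOfDim B n) :
    IsRegularLocalOfDim (stepRing B) (n + 1) := by
  obtain ⟨s, hs⟩ := isRegularLocalOfDim_iff.1 hB
  have := hs.isNoetherianRing
  have hlie : (originIdeal B).LiesOver (IsLocalRing.maximalIdeal B) := ⟨by
    ext b
    rw [Ideal.mem_comap, algebraMap_eq, mem_originIdeal]
    simp⟩
  have hh : (originIdeal B).height = (Fintype.card (Option (Fin n)) : ℕ) := by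
    rw [Polynomial.height_eq_height_add_one (IsLocalRing.maximalIdeal B) (originIdeal B)]
    have h1 := IsLocalRing.maximalIdeal_height_eq_ringKrullDim (R := B)
    rw [hs.ringKrullDim_eq] at h1
    have h2 : (IsLocalRing.maximalIdeal B).height = n := by
      rw [Fintype.card_fin] at h1
      exact_mod_cast h1
    rw [h2]
    simp
  have h := isRegularSystem_locSubring (polyHom B) (originIdeal B) polyHom_injective
    (originIdeal_eq_span hs) hh
  exact isRegularLocalOfDim_iff.2 ⟨_, h.reindex (finSuccEquivLast (n := n))⟩

end StepRings

section AlgebraicLocalRings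

variable {k F : Type} [Field k] [Field F] [Algebra k F]

lemma IsAlgebraicLocalRingOf.fieldFG {L : IntermediateField k F} {A : Subring F}
    (h : IsAlgebraicLocalRingOf k L A) : L.FG := by
  obtain ⟨hAL, -, hfrac, C, ⟨s, rfl⟩, hCA, hC⟩ := h
  refine ⟨s, le_antisymm ?_ fun z hz => ?_⟩
  · rw [IntermediateField.adjoin_le_iff]
    exact fun x hx => hAL (hCA (Algebra.subset_adjoin hx))
  have hle := IntermediateField.algebra_adjoin_le_adjoin k (s : Set F)
  have hA : ∀ a ∈ A, a ∈ IntermediateField.adjoin k (s : Set F) := fun a ha => by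
    obtain ⟨c, hc, d, hd, ⟨d', -, hd'⟩, h⟩ := hC a ha
    have h0 : d ≠ 0 := left_ne_zero_of_mul_eq_one hd'
    rw [(eq_mul_inv_iff_mul_eq₀ h0).2 h]
    exact mul_mem (hle hc) (inv_mem (hle hd))
  obtain ⟨a, ha, b, hb, h0, h⟩ := hfrac z hz
  rw [(eq_mul_inv_iff_mul_eq₀ h0).2 h]
  exact mul_mem (hA a ha) (inv_mem (hA b hb))

lemma Subring.isRegularSystem_map {A : Subring F} {E : Type} [Field E] (φ : F →+* E)
    {ι : Type*} [Fintype ι] {s : ι → A} (hs : IsRegularSystem s) :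
    IsRegularSystem fun i => (A.equivMapOfInjective φ φ.injective) (s i) :=
  hs.map_equiv _

lemma IsRegularLocalOfDim.map {A : Subring F} {n : ℕ} (h : IsRegularLocalOfDim A n)
    {E : Type} [Field E] (φ : F →+* E) : IsRegularLocalOfDim (A.map φ) n := by
  obtain ⟨s, hs⟩ := isRegularLocalOfDim_iff.1 h
  exact isRegularLocalOfDim_iff.2 ⟨_, Subring.isRegularSystem_map φ hs⟩

lemma IsAlgebraicLocalRingOf.map {B : Subring F} (h : IsAlgebraicLocalRingOf k ⊤ B)
    {E : Type} [Field E] [Algebra k E] (φ : F →ₐ[k] E) :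
    IsAlgebraicLocalRingOf k φ.fieldRange (B.map (φ : F →+* E)) := by
  obtain ⟨-, hloc, hfrac, C, hCfg, hCA, hC⟩ := h
  refine ⟨?_, ?_, ?_, C.map φ, hCfg.map φ, ?_, ?_⟩
  · rintro _ ⟨b, -, rfl⟩
    exact ⟨b, rfl⟩
  · exact (B.equivMapOfInjective (φ : F →+* E) (φ : F →+* E).injective).isLocalRing
  · rintro _ ⟨z, rfl⟩
    obtain ⟨a, ha, b, hb, h0, h1⟩ := hfrac z IntermediateField.mem_top
    refine ⟨φ a, ⟨a, ha, rfl⟩, φ b, ⟨b, hb, rfl⟩, by simpa using h0, ?_⟩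
    rw [← h1, map_mul]
    rfl
  · rintro _ ⟨c, hc, rfl⟩
    exact ⟨c, hCA hc, rfl⟩
  · rintro _ ⟨z, hz, rfl⟩
    obtain ⟨a, ha, b, hb, ⟨b', hb', h0⟩, h1⟩ := hC z hz
    refine ⟨φ a, ⟨a, ha, rfl⟩, φ b, ⟨b, hb, rfl⟩, ⟨φ b', ⟨b', hb', rfl⟩, ?_⟩, ?_⟩
    · rw [← map_mul, h0, map_one]
    · rw [← h1, map_mul]
      rfl

lemma isAlgebraicLocalRingOf_stepRing {B : Subring F} [IsLocalRing B]
    (h : IsAlgebraicLocalRingOf k ⊤ B) (hloc : IsLocalRing (stepRing B)) :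
    IsAlgebraicLocalRingOf k ⊤ (stepRing B) := by
  obtain ⟨-, -, hfrac, D, hDfg, hDB, hD⟩ := h
  have hC : ∀ b (hb : b ∈ B), algebraMap F (RatFunc F) b = polyHom B (C ⟨b, hb⟩) := fun b hb => by
    simp [polyHom_apply]
  have hX : (RatFunc.X : RatFunc F) = polyHom B X := by simp [polyHom_apply]
  refine ⟨fun _ _ => IntermediateField.mem_top, hloc, ?_,
    D.map (IsScalarTower.toAlgHom k F (RatFunc F)) ⊔ Algebra.adjoin k {RatFunc.X},
    (hDfg.map _).sup (Subalgebra.fg_adjoin_finset {RatFunc.X} |> fun h => by simpa using h), ?_, ?_⟩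
  · rintro z -
    have key : ∀ c : F[X], ∃ b ∈ B, b ≠ 0 ∧ ∃ d : B[X],
        algebraMap F[X] (RatFunc F) (C b * c) = polyHom B d := fun c => by
      induction c using Polynomial.induction_on' with
      | add p q hp hq =>
        obtain ⟨b, hb, hb0, d, hd⟩ := hp
        obtain ⟨b', hb', hb0', d', hd'⟩ := hq
        refine ⟨b * b', mul_mem hb hb', mul_ne_zero hb0 hb0', C ⟨b', hb'⟩ * d + C ⟨b, hb⟩ * d', ?_⟩
        simp only [map_mul, map_add] at hd hd' ⊢
        rw [← hd, ← hd', polyHom_apply, polyHom_apply, map_C, map_C, Subring.subtype_apply,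
          Subring.subtype_apply]
        ring
      | monomial n a =>
        obtain ⟨a', ha', b, hb, h0, h1⟩ := hfrac a IntermediateField.mem_top
        refine ⟨b, hb, h0, monomial n ⟨a', ha'⟩, ?_⟩
        rw [polyHom_apply, C_mul_monomial, mul_comm, h1, map_monomial]
        rfl
    obtain ⟨c, d, hd, rfl⟩ := IsFractionRing.div_surjective F[X] z
    obtain ⟨b, hb, hb0, c', hc'⟩ := key c
    obtain ⟨b', hb', hb0', d', hd'⟩ := key d
    have hd0 : algebraMap F[X] (RatFunc F) d ≠ 0 := fun h =>
      nonZeroDivisors.ne_zero hd ((RatFunc.algebraMap_injective F) (h.trans (map_zero _).symm))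
    have hCne : ∀ {b : F}, b ≠ 0 → algebraMap F[X] (RatFunc F) (C b) ≠ 0 := fun hb h => by
      have := (RatFunc.algebraMap_injective F) (h.trans (map_zero _).symm)
      exact hb (by simpa using this)
    refine ⟨_, polyHom_mem_stepRing (C ⟨b', hb'⟩ * c'), _, polyHom_mem_stepRing (C ⟨b, hb⟩ * d'),
      ?_, ?_⟩
    · rw [map_mul, ← hd', map_mul]
      refine mul_ne_zero ?_ (mul_ne_zero (hCne hb0') hd0)
      rw [polyHom_apply, map_C]
      exact hCne hb0
    · rw [map_mul, map_mul, ← hc', ← hd', polyHom_apply, polyHom_apply, map_C, map_C, map_mul,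
        map_mul, Subring.subtype_apply, Subring.subtype_apply]
      field_simp
  · have : D.map (IsScalarTower.toAlgHom k F (RatFunc F)) ⊔ Algebra.adjoin k {RatFunc.X} ≤
        ({ stepRing B with
            algebraMap_mem' := fun c => by
              rw [IsScalarTower.algebraMap_apply k F (RatFunc F),
                hC _ (hDB (D.algebraMap_mem c))]
              exact polyHom_mem_stepRing _ } : Subalgebra k (RatFunc F)) := by
      refine sup_le ?_ (Algebra.adjoin_le ?_)
      · rintro _ ⟨c, hc, rfl⟩
        change algebraMap F (RatFunc F) c ∈ stepRing B
        rw [hC _ (hDB hc)]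
        exact polyHom_mem_stepRing _
      · rintro _ rfl
        change RatFunc.X ∈ stepRing B
        rw [hX]
        exact polyHom_mem_stepRing _
    exact this
  · have hDC : ∀ c ∈ D, algebraMap F (RatFunc F) c ∈
        D.map (IsScalarTower.toAlgHom k F (RatFunc F)) ⊔ Algebra.adjoin k {RatFunc.X} :=
      fun c hc => (le_sup_left : _ ≤ D.map _ ⊔ Algebra.adjoin k _) ⟨c, hc, rfl⟩
    have hDX : RatFunc.X ∈
        D.map (IsScalarTower.toAlgHom k F (RatFunc F)) ⊔ Algebra.adjoin k {RatFunc.X} :=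
      (le_sup_right : _ ≤ D.map _ ⊔ Algebra.adjoin k _) (Algebra.subset_adjoin rfl)
    have key : ∀ c : B[X], ∃ b ∈ D, b ≠ 0 ∧ b⁻¹ ∈ B ∧ algebraMap F (RatFunc F) b * polyHom B c ∈
        D.map (IsScalarTower.toAlgHom k F (RatFunc F)) ⊔ Algebra.adjoin k {RatFunc.X} := fun c => by
      induction c using Polynomial.induction_on' with
      | add p q hp hq =>
        obtain ⟨b, hb, hb0, hbi, h⟩ := hp
        obtain ⟨b', hb', hb0', hbi', h'⟩ := hq
        refine ⟨b * b', mul_mem hb hb', mul_ne_zero hb0 hb0', by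
          rw [mul_inv]; exact mul_mem hbi hbi', ?_⟩
        have := add_mem (mul_mem (hDC b' hb') h) (mul_mem (hDC b hb) h')
        convert this using 1
        simp only [map_mul, map_add]
        ring
      | monomial n a =>
        obtain ⟨a', ha', b, hb, ⟨b', hb', h0⟩, h1⟩ := hD a a.2
        refine ⟨b, hb, left_ne_zero_of_mul_eq_one h0, eq_inv_of_mul_eq_one_right h0 ▸ hb', ?_⟩
        have := mul_mem (hDC a' ha') (pow_mem hDX n)
        convert this using 1
        rw [← h1, ← C_mul_X_pow_eq_monomial, map_mul, map_pow, ← hX, ← hC, map_mul]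
        ring
    intro z hz
    obtain ⟨c, d, hd, h⟩ := mem_stepRing.1 hz
    obtain ⟨b, hb, hb0, hbi, h1⟩ := key c
    obtain ⟨b', hb', hb0', hbi', h1'⟩ := key d
    refine ⟨_, mul_mem (hDC b' hb') h1, _, mul_mem (hDC b hb) h1', ?_, ?_⟩
    · obtain ⟨w, hw⟩ := isUnit_iff_exists_inv.1 hd
      have hdi : (polyHom B d)⁻¹ ∈ stepRing B :=
        inv_map_mem_locSubring _ _ polyHom_injective (by rw [mem_originIdeal, not_not]; exact hd)
      have hd0 : polyHom B d ≠ 0 := fun h => by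
        rw [polyHom_injective (h.trans (map_zero _).symm)] at hd
        simp at hd
      refine ⟨algebraMap F _ b⁻¹ * algebraMap F _ b'⁻¹ * (polyHom B d)⁻¹, ?_, ?_⟩
      · rw [hC _ hbi, hC _ hbi']
        exact mul_mem (mul_mem (polyHom_mem_stepRing _) (polyHom_mem_stepRing _)) hdi
      · rw [map_inv₀, map_inv₀]
        have h2 : algebraMap F (RatFunc F) b ≠ 0 := by simpa using hb0
        have h3 : algebraMap F (RatFunc F) b' ≠ 0 := by simpa using hb0'
        field_simp
    · rw [← h]
      ring

end AlgebraicLocalRings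

/-- A counterexample to monomialization given by an endomorphism of a field, suitable for
induction on the dimension. -/
structure EndoCounterexample (k : Type) [Field k] (n : ℕ) : Type 1 where
  F : Type
  [fieldF : Field F]
  [algF : Algebra k F]
  φ : F →ₐ[k] F
  B : Subring F
  V : Subring F
  trdeg : Algebra.trdeg k F = n
  finite : FiniteDimensional φ.fieldRange F
  separable : Algebra.IsSeparable φ.fieldRange F
  V_val : IsValuationSubring V
  V_k : ∀ c : k, algebraMap k F c ∈ V
  V_res : HasResidueField k V
  B_alg : IsAlgebraicLocalRingOf k ⊤ B
  B_reg : IsRegularLocalOfDim B n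
  V_dom : Dominates V B
  B_dom : Dominates B (B.map (φ : F →+* F))
  noMonomialization : ∀ A' B' : Subring F, IsAlgebraicLocalRingOf k φ.fieldRange A' →
    IsAlgebraicLocalRingOf k ⊤ B' → Dominates V B' → Dominates B' A' →
    Dominates A' (B.map (φ : F →+* F)) → Dominates B' B → ¬ IsMonomialExtension A' B'

attribute [instance] EndoCounterexample.fieldF EndoCounterexample.algF

/-- An endomorphism counterexample yields a counterexample. -/
lemma EndoCounterexample.nonempty {k : Type} [Field k] {n : ℕ} (T : EndoCounterexample k n) :
    Nonempty (MonomializationCounterexample k n) := by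
  have hA := T.B_alg.map T.φ
  have e : T.F ≃ₐ[k] T.φ.fieldRange := AlgEquiv.ofInjectiveField T.φ
  exact ⟨{
    Kstar := T.F
    K := T.φ.fieldRange
    K_fg := hA.fieldFG
    trdegK := exists_isTranscendenceBasis_fin (e.trdeg_eq.symm.trans T.trdeg)
    trdegKstar := exists_isTranscendenceBasis_fin T.trdeg
    finiteExt := T.finite
    sepExt := T.separable
    V := T.V
    V_val := T.V_val
    V_k := T.V_k
    A := T.B.map (T.φ : T.F →+* T.F)
    B := T.B
    A_alg := hA
    B_alg := T.B_alg
    A_reg := T.B_reg.map _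
    B_reg := T.B_reg
    VdomB := T.V_dom
    BdomA := T.B_dom
    noMonomialization := by
      rintro ⟨A', B', h1, h2, -, -, h3, h4, h5, h6, h7⟩
      exact T.noMonomialization A' B' h1 h2 h3 h4 h5 h6 h7 }⟩

lemma Dominates.of_le {F : Type} [Field F] {V S R : Subring F} (hS : Dominates V S)
    (hR : Dominates V R) (h : R ≤ S) : Dominates S R :=
  dominates_iff.2 ⟨h, fun z hz hz' =>
    (dominates_iff.1 hR).2 z hz ((dominates_iff.1 hS).1 hz')⟩

lemma Prime.dvd_of_map_eq_zero {R L : Type*} [CommRing R] [IsDomain R] [Field L] (e : R →+* L)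
    {t y : R} (hy : Prime y) (ht : t ≠ 0)
    (h : ∀ z : R, z ≠ 0 → ∃ (a b : ℕ) (c d : R), e c ≠ 0 ∧ e d ≠ 0 ∧ z * t ^ b * d = t ^ a * c)
    (hey : e y = 0) {q : R} (hq : e q = 0) : y ∣ q := by
  have key : ∀ z : R, z ≠ 0 → e z = 0 → ∃ (s : ℕ) (c d : R), s ≠ 0 ∧ e c ≠ 0 ∧ e d ≠ 0 ∧
      z * d = t ^ s * c := fun z hz hez => by
    obtain ⟨a, b, c, d, hc, hd, h⟩ := h z hz
    rcases le_or_gt a b with hab | hab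
    · obtain ⟨s, rfl⟩ := Nat.exists_eq_add_of_le hab
      have h1 : t ^ a * (z * t ^ s * d) = t ^ a * c := by
        rw [← h]
        ring
      have h2 := mul_left_cancel₀ (pow_ne_zero a ht) h1
      refine absurd ?_ hc
      rw [← h2]
      simp [hez]
    · obtain ⟨s, rfl⟩ := Nat.exists_eq_add_of_lt hab
      refine ⟨s + 1, c, d, by lia, hc, hd, mul_left_cancel₀ (pow_ne_zero b ht) ?_⟩
      rw [← mul_assoc, mul_comm _ z, h]
      ring
  rcases eq_or_ne q 0 with rfl | hq0
  · exact dvd_zero y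
  obtain ⟨s, c, d, hs, hc, hd, h1⟩ := key q hq0 hq
  obtain ⟨s', c', d', hs', hc', hd', h2⟩ := key y hy.ne_zero hey
  have hn : ∀ {z : R}, e z ≠ 0 → ¬ y ∣ z := by
    rintro _ hz ⟨w, rfl⟩
    simp [hey] at hz
  have h3 : y ∣ q ^ s' * (d ^ s' * c' ^ s) := by
    have : q ^ s' * (d ^ s' * c' ^ s) = y ^ s * (d' ^ s * c ^ s') := by
      rw [← mul_assoc, ← mul_pow, h1, ← mul_assoc, ← mul_pow, h2, mul_pow, mul_pow, ← pow_mul,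
        ← pow_mul, mul_comm s s']
      ring
    rw [this]
    exact dvd_mul_of_dvd_left (dvd_pow_self y hs) _
  rcases hy.dvd_or_dvd h3 with h4 | h4
  · exact hy.dvd_of_dvd_pow h4
  · exact absurd h4 (hn (by simp [hd, hc']))

section ResidueRing

variable {F : Type} [Field F]

/-- The image of a subring of the field of rational functions under evaluation at the origin. -/
noncomputable def evalImage (R : Subring (RatFunc F)) : Subring F :=
  (R.comap (originRing F).subtype).map (evalOrigin F)

lemma mem_evalImage {R : Subring (RatFunc F)} {z : F} :
    z ∈ evalImage R ↔ ∃ f ∈ R, ∃ h : f ∈ originRing F, evalOrigin F ⟨f, h⟩ = z :=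
  ⟨fun ⟨f, hf, h⟩ => ⟨f, hf, f.2, h⟩, fun ⟨f, hf, h, h'⟩ => ⟨⟨f, h⟩, hf, h'⟩⟩

lemma evalImage_mono {R S : Subring (RatFunc F)} (h : R ≤ S) : evalImage R ≤ evalImage S :=
  fun _ hz => by
    obtain ⟨f, hf, h1, h2⟩ := mem_evalImage.1 hz
    exact mem_evalImage.2 ⟨f, h hf, h1, h2⟩

lemma compositeRing_le_originRing (V : Subring F) : compositeRing V ≤ originRing F :=
  fun _ hf => (mem_compositeRing.1 hf).1

/-- Evaluation at the origin on a subring. -/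
noncomputable def evalHom {R : Subring (RatFunc F)} (h : R ≤ originRing F) : R →+* evalImage R where
  toFun f := ⟨evalOrigin F ⟨f, h f.2⟩, mem_evalImage.2 ⟨f, f.2, h f.2, rfl⟩⟩
  map_one' := Subtype.ext (map_one (evalOrigin F))
  map_zero' := Subtype.ext (map_zero (evalOrigin F))
  map_mul' a b := Subtype.ext (map_mul (evalOrigin F) ⟨a, h a.2⟩ ⟨b, h b.2⟩)
  map_add' a b := Subtype.ext (map_add (evalOrigin F) ⟨a, h a.2⟩ ⟨b, h b.2⟩)

lemma evalHom_surjective {R : Subring (RatFunc F)} (h : R ≤ originRing F) :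
    Function.Surjective (evalHom h) := by
  rintro ⟨z, hz⟩
  obtain ⟨f, hf, h1, h2⟩ := mem_evalImage.1 hz
  exact ⟨⟨f, hf⟩, Subtype.ext h2⟩

lemma dominates_evalImage {V : Subring F} {R : Subring (RatFunc F)}
    (hR : Dominates (compositeRing V) R) : Dominates V (evalImage R) := by
  rw [dominates_iff] at hR ⊢
  refine ⟨fun z hz => ?_, fun z hz hz' => ?_⟩
  · obtain ⟨f, hf, h1, rfl⟩ := mem_evalImage.1 hz
    exact (mem_compositeRing.1 (hR.1 hf)).2
  · obtain ⟨f, hf, h1, rfl⟩ := mem_evalImage.1 hz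
    rcases eq_or_ne (evalOrigin F ⟨f, h1⟩) 0 with h0 | h0
    · rw [h0, inv_zero]
      exact zero_mem _
    have hinv := inv_mem_originRing ⟨f, h1⟩ h0
    have hf0 : f ≠ 0 := by
      rintro rfl
      exact h0 (map_zero _)
    have h2 := (evalOrigin_inv h1 hinv hf0).2
    have h3 : f⁻¹ ∈ compositeRing V := mem_compositeRing.2 ⟨hinv, by rw [h2]; exact hz'⟩
    exact mem_evalImage.2 ⟨f⁻¹, hR.2 f hf h3, hinv, h2⟩

lemma evalImage_stepRing {B : Subring F} [IsLocalRing B] : B ≤ evalImage (stepRing B) :=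
  fun b hb => mem_evalImage.2 ⟨algebraMap F _ b, by
    have := polyHom_mem_stepRing (C (⟨b, hb⟩ : B))
    rw [polyHom_apply, map_C] at this
    exact this, C_mem_originRing b, evalOrigin_C b⟩

variable {k : Type} [Field k] [Algebra k F]

lemma mem_originRing_of_expandHom {φ : F →ₐ[k] F} {m : ℕ} (hm : 0 < m) {w : RatFunc F}
    (h : expandHom φ hm w ∈ originRing F) : w ∈ originRing F := by
  rcases mem_or_inv_mem_originRing w with h1 | h1
  · exact h1
  by_contra h2
  have hw : w ≠ 0 := by
    rintro rfl
    exact h2 (zero_mem _)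
  have h3 : evalOrigin F ⟨w⁻¹, h1⟩ = 0 := by
    by_contra h3
    have := inv_mem_originRing ⟨w⁻¹, h1⟩ h3
    rw [inv_inv] at this
    exact h2 this
  have h4 := evalOrigin_expandHom (φ := φ) hm ⟨w⁻¹, h1⟩ (expandHom_mem_originRing hm h1)
  rw [h3, map_zero] at h4
  have h5 : (⟨expandHom φ hm w⁻¹, expandHom_mem_originRing hm h1⟩ : originRing F) *
      ⟨expandHom φ hm w, h⟩ = 1 := Subtype.ext (by
    change expandHom φ hm w⁻¹ * expandHom φ hm w = 1
    rw [← map_mul, inv_mul_cancel₀ hw, map_one])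
  have h6 := congrArg (evalOrigin F) h5
  rw [map_mul, h4, zero_mul, map_one] at h6
  exact zero_ne_one h6

lemma evalImage_map_expandHom {φ : F →ₐ[k] F} {m : ℕ} (hm : 0 < m) {B : Subring F}
    [IsLocalRing B] : B.map (φ : F →+* F) ≤
      evalImage ((stepRing B).map (expandHom φ hm : RatFunc F →+* RatFunc F)) := by
  rintro _ ⟨b, hb, rfl⟩
  obtain ⟨f, hf, h1, h2⟩ := mem_evalImage.1 (evalImage_stepRing hb)
  refine mem_evalImage.2 ⟨_, ⟨f, hf, rfl⟩, expandHom_mem_originRing hm h1, ?_⟩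
  exact (evalOrigin_expandHom hm ⟨f, h1⟩ _).trans (by rw [h2]; rfl)

/-- The image under evaluation at the origin of an algebraic local ring. -/
lemma isAlgebraicLocalRingOf_evalImage {L : IntermediateField k (RatFunc F)}
    {L' : IntermediateField k F} {R : Subring (RatFunc F)} (hO : R ≤ originRing F)
    (h : IsAlgebraicLocalRingOf k L R) (hL : (evalImage R : Set F) ⊆ L')
    (hloc : IsLocalRing (evalImage R))
    (hfrac : ∀ z ∈ L', ∃ a ∈ evalImage R, ∃ b ∈ evalImage R, b ≠ 0 ∧ z * b = a) :
    IsAlgebraicLocalRingOf k L' (evalImage R) := by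
  obtain ⟨-, -, -, D, hDfg, hDR, hD⟩ := h
  let g : D →ₐ[k] F :=
    { (evalImage R).subtype.comp ((evalHom hO).comp (Subring.inclusion (S := D.toSubring) hDR)) with
      commutes' := fun c => by
        refine Eq.trans ?_ (evalOrigin_C (algebraMap k F c))
        change evalOrigin F _ = _
        congr 1 }
  have hg : ∀ d (hd : d ∈ D), g ⟨d, hd⟩ = evalOrigin F ⟨d, hO (hDR hd)⟩ := fun _ _ => rfl
  have : Algebra.FiniteType k D := D.fg_iff_finiteType.1 hDfg
  refine ⟨hL, hloc, hfrac, g.range, ?_, ?_, fun z hz => ?_⟩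
  · rw [← Algebra.map_top]
    exact (this.1).map g
  · rintro _ ⟨⟨d, hd⟩, rfl⟩
    exact mem_evalImage.2 ⟨d, hDR hd, hO (hDR hd), rfl⟩
  · obtain ⟨f, hf, h1, rfl⟩ := mem_evalImage.1 hz
    obtain ⟨a, ha, b, hb, ⟨b', hb', h0⟩, hab⟩ := hD f hf
    refine ⟨_, ⟨⟨a, ha⟩, rfl⟩, _, ⟨⟨b, hb⟩, rfl⟩, ⟨evalOrigin F ⟨b', hO hb'⟩,
      mem_evalImage.2 ⟨b', hb', hO hb', rfl⟩, ?_⟩, ?_⟩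
    · change g _ * _ = 1
      rw [hg, ← map_mul, ← map_one (evalOrigin F)]
      exact congrArg _ (Subtype.ext h0)
    · change _ * g _ = g _
      rw [hg, hg, ← map_mul]
      exact congrArg _ (Subtype.ext hab)

/-- Any nonzero rational function is a power of the variable times a quotient of elements of
`stepRing B` not vanishing at the origin. -/
lemma exists_stepRing_eq {B : Subring F} [IsLocalRing B]
    (hfrac : ∀ z : F, ∃ a ∈ B, ∃ b ∈ B, b ≠ 0 ∧ z * b = a) {w : RatFunc F} (hw : w ≠ 0) :
    ∃ (a b : ℕ) (c d : RatFunc F) (_ : c ∈ stepRing B) (_ : d ∈ stepRing B)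
      (hc : c ∈ originRing F) (hd : d ∈ originRing F),
      evalOrigin F ⟨c, hc⟩ ≠ 0 ∧ evalOrigin F ⟨d, hd⟩ ≠ 0 ∧
      w * RatFunc.X ^ b * d = RatFunc.X ^ a * c := by
  obtain ⟨a, b, c, d, hc, hd, h⟩ := exists_X_pow_mul_eq hw
  have key : ∀ c : F[X], ∃ b ∈ B, b ≠ 0 ∧ algebraMap F[X] (RatFunc F) (C b * c) ∈ stepRing B := by
    intro c
    induction c using Polynomial.induction_on' with
    | add p q hp hq =>
      obtain ⟨b, hb, hb0, hd⟩ := hp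
      obtain ⟨b', hb', hb0', hd'⟩ := hq
      refine ⟨b * b', mul_mem hb hb', mul_ne_zero hb0 hb0', ?_⟩
      have h1 : ∀ b (hb : b ∈ B), algebraMap F[X] (RatFunc F) (C b) ∈ stepRing B := fun b hb => by
        have := polyHom_mem_stepRing (C (⟨b, hb⟩ : B))
        rwa [polyHom_apply, map_C] at this
      have := add_mem (mul_mem (h1 b' hb') hd) (mul_mem (h1 b hb) hd')
      convert this using 1
      simp only [map_mul, map_add]
      ring
    | monomial n a =>
      obtain ⟨a', ha', b, hb, h0, h1⟩ := hfrac a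
      refine ⟨b, hb, h0, ?_⟩
      have := polyHom_mem_stepRing (monomial n (⟨a', ha'⟩ : B))
      rw [polyHom_apply, map_monomial] at this
      rw [C_mul_monomial, mul_comm, h1]
      exact this
  obtain ⟨e, he, he0, h1⟩ := key c
  obtain ⟨e', he', he0', h1'⟩ := key d
  have h2 : ∀ b (hb : b ∈ B), algebraMap F[X] (RatFunc F) (C b) ∈ stepRing B := fun b hb => by
    have := polyHom_mem_stepRing (C (⟨b, hb⟩ : B))
    rwa [polyHom_apply, map_C] at this
  refine ⟨a, b, algebraMap _ _ (C e' * (C e * c)), algebraMap _ _ (C e * (C e' * d)), ?_, ?_,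
    algebraMap_mem_originRing _, algebraMap_mem_originRing _, ?_, ?_, ?_⟩
  · rw [map_mul]
    exact mul_mem (h2 _ he') h1
  · rw [map_mul]
    exact mul_mem (h2 _ he) h1'
  · rw [evalOrigin_algebraMap]
    simp [he0, he0', hc]
  · rw [evalOrigin_algebraMap]
    simp [he0, he0', hd]
  · simp only [map_mul, map_pow, RatFunc.algebraMap_X] at h ⊢
    linear_combination (algebraMap F[X] (RatFunc F) (C e) * algebraMap F[X] (RatFunc F) (C e')) * h

end ResidueRing

section ResidueMonomial

variable {F : Type} [Field F]

lemma isRegularSystem_evalImage {N : ℕ} {R : Subring (RatFunc F)} (hO : R ≤ originRing F)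
    {y : Fin (N + 1) → R} (hy : IsRegularSystem y) {j : Fin (N + 1)} (hj : evalHom hO (y j) = 0)
    (hker : ∀ q, evalHom hO q = 0 → y j ∣ q) :
    IsRegularSystem fun i : Fin N => evalHom hO (y (j.succAbove i)) := by
  have hk : Ideal.span {y j} = RingHom.ker (evalHom hO) := by
    ext q
    rw [Ideal.mem_span_singleton, RingHom.mem_ker]
    refine ⟨?_, hker q⟩
    rintro ⟨r, rfl⟩
    rw [map_mul, hj, zero_mul]
  let e : R ⧸ Ideal.span {y j} ≃+* evalImage R := (Ideal.quotEquivOfEq hk).trans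
    (RingHom.quotientKerEquivOfSurjective (evalHom_surjective hO))
  exact ((hy.quotient j).map_equiv e).reindex (finSuccAboveEquiv j)

lemma isMonomialExtension_evalImage {A R : Subring (RatFunc F)} (hA : A ≤ originRing F)
    (hR : R ≤ originRing F) {n : ℕ} (hAR : A ≤ R) {x : Fin n → A} {y δ : Fin n → R}
    {M : Matrix (Fin n) (Fin n) ℕ} (hx : IsRegularSystem x) (hy : IsRegularSystem y)
    (hδ : ∀ i, IsUnit (δ i)) (hdet : (M.map ((↑·) : ℕ → ℚ)).det ≠ 0)
    (hM : ∀ i, Subring.inclusion hAR (x i) = δ i * monom y (M i))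
    (hkA : ∀ i, evalHom hA (x i) = 0 → ∀ q, evalHom hA q = 0 → x i ∣ q)
    (hkR : ∀ i, evalHom hR (y i) = 0 → ∀ q, evalHom hR q = 0 → y i ∣ q)
    {j : Fin n} (hj : evalHom hR (y j) = 0) :
    IsMonomialExtension (evalImage A) (evalImage R) := by
  obtain _ | N := n
  · exact j.elim0
  have hle : evalImage A ≤ evalImage R := evalImage_mono hAR
  have hcomp : ∀ a : A, Subring.inclusion hle (evalHom hA a) =
      evalHom hR (Subring.inclusion hAR a) := fun a => rfl
  have hxM : ∀ l, Subring.inclusion hle (evalHom hA (x l)) =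
      evalHom hR (δ l) * monom (fun c => evalHom hR (y c)) (M l) := fun l => by
    rw [hcomp, hM, map_mul]
    simp [monom]
  have hinj : Function.Injective (Subring.inclusion hle) := Subring.inclusion_injective hle
  have hx0 : ∀ l, M l j ≠ 0 → evalHom hA (x l) = 0 := fun l hl => by
    apply hinj
    rw [hxM, map_zero, monom, Finset.prod_eq_zero (Finset.mem_univ j), mul_zero]
    rw [hj, zero_pow hl]
  obtain ⟨i, hi⟩ : ∃ i, M i j ≠ 0 := by
    by_contra! h
    exact hdet (Matrix.det_eq_zero_of_column_eq_zero j fun i => by simp [h i])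
  have hM0 : ∀ l, l ≠ i → M l j = 0 := fun l hl => by
    by_contra h
    exact hx.not_dvd hl.symm (hkA i (hx0 i hi) _ (hx0 l h))
  refine isMonomialExtension_iff.2 ⟨N, hle, _, _, fun l => evalHom hR (δ (i.succAbove l)),
    M.submatrix i.succAbove j.succAbove,
    isRegularSystem_evalImage hA hx (hx0 i hi) (hkA i (hx0 i hi)),
    isRegularSystem_evalImage hR hy hj (hkR j hj), fun l => (hδ _).map _, ?_, fun l => ?_⟩
  · rw [Matrix.det_succ_column _ j, Finset.sum_eq_single i] at hdet
    · exact right_ne_zero_of_mul hdet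
    · intro l _ hl
      simp [hM0 l hl]
    · simp
  · rw [hxM, monom, Fin.prod_univ_succAbove _ j, hM0 _ (Fin.succAbove_ne i l), pow_zero, one_mul]
    rfl

variable {k : Type} [Field k] [Algebra k F]

/-- A monomial extension in which some parameter vanishes at the origin descends to the
residue field of the origin. -/
lemma exists_residue_monomialExtension {φ : F →ₐ[k] F} {B V : Subring F} [IsLocalRing B]
    (hfrac : ∀ z : F, ∃ a ∈ B, ∃ b ∈ B, b ≠ 0 ∧ z * b = a) (hVB : Dominates V B)
    (hB : Dominates B (B.map (φ : F →+* F)))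
    {m : ℕ} (hm : 0 < m) {A R : Subring (RatFunc F)}
    (hAalg : IsAlgebraicLocalRingOf k (expandHom φ hm).fieldRange A)
    (hRalg : IsAlgebraicLocalRingOf k ⊤ R) (hVR : Dominates (compositeRing V) R)
    (hRA : Dominates R A)
    (hAB : Dominates A ((stepRing B).map (expandHom φ hm : RatFunc F →+* RatFunc F)))
    (hRB : Dominates R (stepRing B)) {n : ℕ} (hAR : A ≤ R) {x : Fin n → A} {y δ : Fin n → R}
    {M : Matrix (Fin n) (Fin n) ℕ} (hx : IsRegularSystem x) (hy : IsRegularSystem y)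
    (hδ : ∀ i, IsUnit (δ i)) (hdet : (M.map ((↑·) : ℕ → ℚ)).det ≠ 0)
    (hM : ∀ i, Subring.inclusion hAR (x i) = δ i * monom y (M i))
    (hR : R ≤ originRing F) {j : Fin n} (hj : evalHom hR (y j) = 0) :
    IsAlgebraicLocalRingOf k φ.fieldRange (evalImage A) ∧
    IsAlgebraicLocalRingOf k ⊤ (evalImage R) ∧ Dominates V (evalImage R) ∧
    Dominates (evalImage R) (evalImage A) ∧ Dominates (evalImage A) (B.map (φ : F →+* F)) ∧
    Dominates (evalImage R) B ∧ IsMonomialExtension (evalImage A) (evalImage R) := by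
  have hA : A ≤ originRing F := hAR.trans hR
  have hBR := (dominates_iff.1 hRB).1
  have hBA := (dominates_iff.1 hAB).1
  have hVA := hVR.trans hRA
  have h1 := dominates_evalImage hVR
  have h2 := dominates_evalImage hVA
  have hBle : B ≤ evalImage R := evalImage_stepRing.trans (evalImage_mono hBR)
  have hBle' : B.map (φ : F →+* F) ≤ evalImage A :=
    (evalImage_map_expandHom hm).trans (evalImage_mono hBA)
  have hX : (RatFunc.X : RatFunc F) ∈ stepRing B := by
    have := polyHom_mem_stepRing (X : B[X])
    rwa [polyHom_apply, map_X, RatFunc.algebraMap_X] at this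
  have hX0 : (RatFunc.X : RatFunc F) ≠ 0 := RatFunc.X_ne_zero
  have hkR : ∀ i, evalHom hR (y i) = 0 → ∀ q, evalHom hR q = 0 → y i ∣ q := fun i hi q hq => by
    refine (hy.prime i).dvd_of_map_eq_zero ((evalImage R).subtype.comp (evalHom hR))
      (t := ⟨RatFunc.X, hBR hX⟩) (fun h => hX0 (congrArg Subtype.val h)) (fun z hz => ?_) ?_ ?_
    · obtain ⟨a, b, c, d, hc, hd, hc', hd', h1, h2, h⟩ := exists_stepRing_eq hfrac
        (w := z) (fun h => hz (Subtype.ext h))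
      exact ⟨a, b, ⟨c, hBR hc⟩, ⟨d, hBR hd⟩, h1, h2, Subtype.ext h⟩
    · simp [hi]
    · simp [hq]
  have hkA : ∀ i, evalHom hA (x i) = 0 → ∀ q, evalHom hA q = 0 → x i ∣ q := fun i hi q hq => by
    refine (hx.prime i).dvd_of_map_eq_zero ((evalImage A).subtype.comp (evalHom hA))
      (t := ⟨expandHom φ hm RatFunc.X, hBA ⟨_, hX, rfl⟩⟩) (fun h => hX0 ?_) (fun z hz => ?_) ?_ ?_
    · have := congrArg Subtype.val h
      exact (expandHom φ hm).injective (this.trans (map_zero _).symm)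
    · obtain ⟨w, hw⟩ := hAalg.1 z.2
      obtain ⟨a, b, c, d, hc, hd, hc', hd', h1, h2, h⟩ := exists_stepRing_eq hfrac (w := w) (by
        rintro rfl
        exact hz (Subtype.ext (hw.symm.trans (map_zero _))))
      refine ⟨a, b, ⟨_, hBA ⟨c, hc, rfl⟩⟩, ⟨_, hBA ⟨d, hd, rfl⟩⟩, ?_, ?_, Subtype.ext ?_⟩
      · have := evalOrigin_expandHom (φ := φ) hm ⟨c, hc'⟩ (expandHom_mem_originRing hm hc')
        exact fun h => h1 (φ.injective ((this.symm.trans h).trans (map_zero _).symm))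
      · have := evalOrigin_expandHom (φ := φ) hm ⟨d, hd'⟩ (expandHom_mem_originRing hm hd')
        exact fun h => h2 (φ.injective ((this.symm.trans h).trans (map_zero _).symm))
      · change (z : RatFunc F) * expandHom φ hm RatFunc.X ^ b * expandHom φ hm d =
          expandHom φ hm RatFunc.X ^ a * expandHom φ hm c
        have := congrArg (expandHom φ hm) h
        simp only [map_mul, map_pow] at this
        rw [← this, ← hw]
        rfl
    · simp [hi]
    · simp [hq]
  have hmono := isMonomialExtension_evalImage hA hR hAR hx hy hδ hdet hM hkA hkR hj
  obtain ⟨_, _, hrA, hrR, -⟩ := id hmono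
  refine ⟨isAlgebraicLocalRingOf_evalImage hA hAalg ?_ hrA.2.1 ?_,
    isAlgebraicLocalRingOf_evalImage hR hRalg (fun _ _ => IntermediateField.mem_top) hrR.2.1 ?_,
    h1, h1.of_le h2 (evalImage_mono hAR), h2.of_le (hVB.trans hB) hBle', h1.of_le hVB hBle, hmono⟩
  · intro z hz
    obtain ⟨f, hf, hf', rfl⟩ := mem_evalImage.1 hz
    obtain ⟨w, rfl⟩ := hAalg.1 hf
    have hw := mem_originRing_of_expandHom hm hf'
    exact ⟨evalOrigin F ⟨w, hw⟩, (evalOrigin_expandHom hm ⟨w, hw⟩ hf').symm⟩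
  · rintro _ ⟨z, rfl⟩
    obtain ⟨a, ha, b, hb, h0, h⟩ := hfrac z
    refine ⟨φ a, hBle' ⟨a, ha, rfl⟩, φ b, hBle' ⟨b, hb, rfl⟩, by simpa using h0, ?_⟩
    rw [← h, map_mul]
    rfl
  · intro z _
    obtain ⟨a, ha, b, hb, h0, h⟩ := hfrac z
    exact ⟨a, hBle ha, b, hBle hb, h0, h⟩

end ResidueMonomial

/-- A finite algebra over a local ring which modulo the maximal ideal is generated by
elements `T j` of `p`-power order is spanned by lifts of a finite abelian `p`-group. -/
lemma exists_spanning_group {V N ι : Type} [CommRing V] [IsLocalRing V] [CommRing N] [Algebra V N]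
    [Module.Finite V N] [Fintype ι] {p e : ℕ} (T : ι → N) (hT : ∀ j, T j ^ p ^ e = 1)
    (hp : p ≠ 0) {s : Set N}
    (hs : Algebra.adjoin V (s ∪ Set.range T) = ⊤)
    (hsv : ∀ z ∈ s, ∃ v : V, z - algebraMap V N v ∈
      (IsLocalRing.maximalIdeal V).map (algebraMap V N)) :
    ∃ (G : Type) (_ : CommGroup G) (ψ : Multiplicative (ι → ℤ) →* G),
      Finite G ∧ Function.Surjective ψ ∧ IsPGroup p G ∧
      (∃ ℓ : G → N, Submodule.span V (Set.range ℓ) = ⊤) ∧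
      ∀ a : ι → ℕ, monom T a - 1 ∈ (IsLocalRing.maximalIdeal V).map (algebraMap V N) →
        ψ (Multiplicative.ofAdd fun j => (a j : ℤ)) = 1 := by
  classical
  set I := (IsLocalRing.maximalIdeal V).map (algebraMap V N) with hI
  let S := N ⧸ I
  let π : N →ₐ[V] S := Ideal.Quotient.mkₐ V I
  have hpe : p ^ e ≠ 0 := pow_ne_zero _ hp
  let u : ι → Sˣ := fun j => Units.ofPowEqOne (π (T j)) (p ^ e) (by rw [← map_pow, hT, map_one]) hpe
  have hu : ∀ j, (u j : S) = π (T j) := fun j => rfl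
  have hupow : ∀ j, u j ^ p ^ e = 1 := fun j => Units.pow_ofPowEqOne _ _
  let ψ₀ : Multiplicative (ι → ℤ) →* Sˣ :=
    { toFun := fun a => ∏ j, u j ^ (a.toAdd j)
      map_one' := by simp
      map_mul' := fun a b => by
        simp [zpow_add, Finset.prod_mul_distrib] }
  have hψ₀ : ∀ a : ι → ℕ, ψ₀ (Multiplicative.ofAdd fun j => (a j : ℤ)) = π (monom T a) := by
    intro a
    change ((∏ j, u j ^ ((a j : ℕ) : ℤ) : Sˣ) : S) = _
    simp [monom, hu]
  have hpow : ∀ g : ψ₀.range, g ^ p ^ e = 1 := by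
    rintro ⟨_, a, rfl⟩
    apply Subtype.ext
    change (∏ j, u j ^ (a.toAdd j)) ^ p ^ e = 1
    rw [← Finset.prod_pow]
    refine Finset.prod_eq_one fun j _ => ?_
    rw [← zpow_natCast, ← zpow_mul, mul_comm, zpow_mul, zpow_natCast, hupow, one_zpow]
  have hfg : Group.FG ψ₀.range := by
    have : Group.FG (Multiplicative (ι → ℤ)) := inferInstance
    exact Group.fg_of_surjective ψ₀.rangeRestrict_surjective
  have hfin : Finite ψ₀.range := CommGroup.finite_of_fg_isMulTorsion _ fun g =>
    isOfFinOrder_iff_pow_eq_one.2 ⟨p ^ e, Nat.pos_of_ne_zero hpe, hpow g⟩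
  refine ⟨ψ₀.range, inferInstance, ψ₀.rangeRestrict, hfin, ψ₀.rangeRestrict_surjective,
    fun g => ⟨e, hpow g⟩, ?_, fun a ha => Subtype.ext (Units.ext ?_)⟩
  · have hlift : ∀ g : ψ₀.range, ∃ z : N, π z = ((g : Sˣ) : S) := fun g =>
      Ideal.Quotient.mk_surjective _
    choose ℓ hℓ using hlift
    refine ⟨ℓ, top_unique ?_⟩
    have hJ : IsLocalRing.maximalIdeal V ≤ Ideal.jacobson ⊥ :=
      (IsLocalRing.jacobson_eq_maximalIdeal ⊥ bot_ne_top).ge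
    refine Submodule.le_of_le_smul_of_le_jacobson_bot Module.Finite.fg_top hJ fun z _ => ?_
    let P : Submonoid S := (ψ₀.range.toSubmonoid).map (Units.coeHom S)
    have hP : ∀ z : N, π z ∈ Algebra.adjoin V (P : Set S) := fun z => by
      have hz : z ∈ Algebra.adjoin V (s ∪ Set.range T) := by
        rw [hs]
        trivial
      induction hz using Algebra.adjoin_induction with
      | mem z hz =>
        rcases hz with hz | ⟨j, rfl⟩
        · obtain ⟨v, hv⟩ := hsv z hz
          have : π z = algebraMap V S v := by
            rw [← π.commutes v]
            exact Ideal.Quotient.eq.2 hv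
          rw [this]
          exact Subalgebra.algebraMap_mem _ v
        · refine Algebra.subset_adjoin ⟨u j, ⟨Multiplicative.ofAdd (Pi.single j 1), ?_⟩, rfl⟩
          change ∏ i, u i ^ ((Pi.single j 1 : ι → ℤ) i) = u j
          rw [Finset.prod_eq_single j]
          · simp
          · intro i _ hij
            simp [hij]
          · simp
      | algebraMap v =>
        rw [π.commutes]
        exact Subalgebra.algebraMap_mem _ v
      | add x y _ _ hx hy =>
        rw [map_add]
        exact add_mem hx hy
      | mul x y _ _ hx hy =>
        rw [map_mul]
        exact mul_mem hx hy
    have h1 : π z ∈ Submodule.span V (P : Set S) := by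
      have := hP z
      rwa [← Subalgebra.mem_toSubmodule, Algebra.adjoin_eq_span, Submonoid.closure_eq] at this
    have h2 : (P : Set S) ⊆ π.toLinearMap '' Set.range ℓ := by
      rintro _ ⟨g, hg, rfl⟩
      exact ⟨_, ⟨⟨g, hg⟩, rfl⟩, hℓ _⟩
    have h3 := Submodule.span_mono (R := V) h2 h1
    rw [Submodule.span_image] at h3
    obtain ⟨w, hw, hwz⟩ := h3
    have h4 : z - w ∈ I := Ideal.Quotient.eq.1 hwz.symm
    rw [← add_sub_cancel w z]
    refine Submodule.add_mem_sup hw ?_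
    have h5 := Ideal.smul_top_eq_map (R := V) (S := N) (IsLocalRing.maximalIdeal V)
    rw [h5]
    exact h4
  · change ((ψ₀ _ : Sˣ) : S) = 1
    rw [hψ₀, ← map_one π]
    exact Ideal.Quotient.eq.2 ha

lemma IsValuationSubring.isLocalRing {F : Type} [Field F] {V : Subring F}
    (hV : IsValuationSubring V) : IsLocalRing V := by
  rw [isLocalRing_subring_iff]
  intro z hz h0
  by_contra! h
  rcases eq_or_ne (1 - z) 0 with h1 | h1
  · exact h.2 (by rw [h1, inv_zero]; exact zero_mem _)
  rcases hV.2 (z⁻¹ * (1 - z)) (mul_ne_zero (inv_ne_zero h0) h1) with h2 | h2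
  · refine h.1 ?_
    have := add_mem h2 (one_mem V)
    have h3 : z⁻¹ * (1 - z) + 1 = z⁻¹ := by field_simp; ring
    rwa [h3] at this
  · refine h.2 ?_
    have := add_mem h2 (one_mem V)
    have h3 : (z⁻¹ * (1 - z))⁻¹ + 1 = (1 - z)⁻¹ := by field_simp; ring
    rwa [h3] at this

section Truncation

variable (F : Type) [Field F] (m : ℕ)

/-- Power series modulo `X ^ m`. -/
abbrev TruncRing : Type := PowerSeries F ⧸ Ideal.span {(PowerSeries.X : PowerSeries F) ^ m}

/-- The truncated Taylor expansion at the origin. -/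
noncomputable def truncTaylor : originRing F →+* TruncRing F m :=
  (Ideal.Quotient.mk _).comp (taylorSeries F)

variable {F m}

lemma truncTaylor_pow {p : ℕ} [Fact p.Prime] [CharP F p] {e : ℕ} (he : m ≤ p ^ e)
    (f : originRing F) :
    truncTaylor F m f ^ p ^ e = algebraMap F (TruncRing F m) (evalOrigin F f) ^ p ^ e := by
  have : CharP (PowerSeries F) p := charP_of_injective_algebraMap (algebraMap F _).injective p
  have h : (PowerSeries.X : PowerSeries F) ∣ taylorSeries F f - PowerSeries.C (evalOrigin F f) := by
    rw [PowerSeries.X_dvd_iff, map_sub, PowerSeries.constantCoeff_C]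
    exact sub_self _
  change Ideal.Quotient.mk _ (taylorSeries F f) ^ p ^ e =
    Ideal.Quotient.mk _ (PowerSeries.C (evalOrigin F f)) ^ p ^ e
  rw [← map_pow (Ideal.Quotient.mk _), ← map_pow (Ideal.Quotient.mk _), Ideal.Quotient.eq,
    Ideal.mem_span_singleton, ← sub_pow_char_pow]
  exact (pow_dvd_pow _ he).trans (pow_dvd_pow_of_dvd h _)

lemma truncTaylor_eq {f : originRing F}
    (h : (PowerSeries.X : PowerSeries F) ^ m ∣ taylorSeries F f - PowerSeries.C (evalOrigin F f)) :
    truncTaylor F m f = algebraMap F (TruncRing F m) (evalOrigin F f) :=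
  Ideal.Quotient.eq.2 (Ideal.mem_span_singleton.2 h)

lemma linearIndependent_truncTaylor_X :
    LinearIndependent F
      fun i : Fin m => truncTaylor F m ⟨RatFunc.X, X_mem_originRing⟩ ^ (i : ℕ) := by
  have hX : taylorSeries F ⟨RatFunc.X, X_mem_originRing⟩ = PowerSeries.X := by
    have := taylor_algebraMap (X : F[X]) (algebraMap_mem_originRing _)
    rw [Polynomial.coe_X] at this
    rw [← this]
    congr 2
  rw [Fintype.linearIndependent_iff]
  intro g hg i
  have h1 : (∑ i : Fin m, g i • truncTaylor F m ⟨RatFunc.X, X_mem_originRing⟩ ^ (i : ℕ)) =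
      Ideal.Quotient.mk _ (∑ i : Fin m, g i • (PowerSeries.X : PowerSeries F) ^ (i : ℕ)) := by
    rw [map_sum]
    refine Finset.sum_congr rfl fun i _ => ?_
    rw [truncTaylor, RingHom.comp_apply, hX, ← map_pow]
    rfl
  rw [h1, Ideal.Quotient.eq_zero_iff_mem, Ideal.mem_span_singleton, PowerSeries.X_pow_dvd_iff] at hg
  have := hg i i.2
  rw [map_sum, Finset.sum_eq_single i] at this
  · simpa using this
  · intro j _ hj
    rw [map_smul, PowerSeries.coeff_X_pow, if_neg (fun h => hj (Fin.ext h.symm)), smul_zero]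
  · simp

end Truncation

section LowerBound

variable {k F : Type} [Field k] [Field F] [Algebra k F]

/-- If no parameter of `R` vanishes at the origin, then the exponent lattice has a large
`p`-group quotient killing the monomials with constant truncated Taylor expansion. -/
lemma exists_large_group {p : ℕ} [Fact p.Prime] [CharP F p] {V : Subring F}
    (hV : IsValuationSubring V) (hres : HasResidueField k V) {R : Subring (RatFunc F)}
    (hRalg : IsAlgebraicLocalRingOf k ⊤ R) (hVR : Dominates (compositeRing V) R)
    (hX : RatFunc.X ∈ R) {n : ℕ} {y : Fin n → R} (hy : IsRegularSystem y)
    (hR : R ≤ originRing F) (hne : ∀ j, evalHom hR (y j) ≠ 0) (m : ℕ) :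
    ∃ (G : Type) (_ : CommGroup G) (ψ : Multiplicative (Fin n → ℤ) →* G),
      Finite G ∧ Function.Surjective ψ ∧ IsPGroup p G ∧ m ≤ Nat.card G ∧
      ∀ (δ : R) (a : Fin n → ℕ), IsUnit δ →
        (PowerSeries.X : PowerSeries F) ^ m ∣
          taylorSeries F (Subring.inclusion hR (δ * monom y a)) -
            PowerSeries.C (evalOrigin F (Subring.inclusion hR (δ * monom y a))) →
        ψ (Multiplicative.ofAdd fun j => (a j : ℤ)) = 1 := by
  classical
  have hp := (Fact.out : p.Prime)
  have := hV.isLocalRing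
  obtain ⟨-, hRloc, -, D, ⟨s, rfl⟩, hDR, hD⟩ := hRalg
  obtain ⟨e, he⟩ : ∃ e, m ≤ p ^ e := ⟨m, (Nat.lt_pow_self hp.one_lt).le⟩
  have hpe : p ^ e ≠ 0 := pow_ne_zero _ hp.ne_zero
  let Θ : R →+* TruncRing F m := (truncTaylor F m).comp (Subring.inclusion hR)
  let ev : R →+* F := (evalOrigin F).comp (Subring.inclusion hR)
  have hΘpow : ∀ r, Θ r ^ p ^ e = algebraMap F (TruncRing F m) (ev r) ^ p ^ e := fun r =>
    truncTaylor_pow he _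
  have hevV : ∀ r, ev r ∈ V := fun r => by
    obtain ⟨h1, h2⟩ := mem_compositeRing.1 ((dominates_iff.1 hVR).1 r.2)
    exact h2
  have hevy : ∀ j, ev (y j) ≠ 0 := fun j h => hne j (Subtype.ext h)
  have hevm : ∀ j, (⟨ev (y j), hevV _⟩ : V) ∈ IsLocalRing.maximalIdeal V := fun j => by
    rw [IsLocalRing.mem_maximalIdeal, mem_nonunits_iff, Subring.isUnit_mk_iff]
    rintro ⟨-, h2⟩
    have hinv : (y j : RatFunc F)⁻¹ ∈ originRing F := inv_mem_originRing _ (hevy j)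
    have h0 : (y j : RatFunc F) ≠ 0 := fun h => hy.ne_zero j (Subtype.ext h)
    have h3 := (evalOrigin_inv (hR (y j).2) hinv h0).2
    have h4 : (y j : RatFunc F)⁻¹ ∈ compositeRing V :=
      mem_compositeRing.2 ⟨hinv, by rw [h3]; exact h2⟩
    exact hy.not_isUnit j ((Subring.isUnit_iff _).2
      ⟨h0, (dominates_iff.1 hVR).2 _ (y j).2 h4⟩)
  have hevu : ∀ r : R, IsUnit r → IsUnit (⟨ev r, hevV r⟩ : V) := fun r hr => by
    let f : R →+* V := ev.codRestrict V hevV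
    exact hr.map f
  let T : Fin n → TruncRing F m := fun j => algebraMap F _ (ev (y j))⁻¹ * Θ (y j)
  have hTy : ∀ j, Θ (y j) = algebraMap F _ (ev (y j)) * T j := fun j => by
    simp only [T]
    rw [← mul_assoc, ← map_mul, mul_inv_cancel₀ (hevy j), map_one, one_mul]
  have hT : ∀ j, T j ^ p ^ e = 1 := fun j => by
    simp only [T]
    rw [mul_pow, hΘpow, ← mul_pow, ← map_mul, inv_mul_cancel₀ (hevy j), map_one, one_pow]
  have hsR : ∀ c ∈ s, c ∈ R := fun c hc => hDR (Algebra.subset_adjoin hc)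
  let s' : Finset (TruncRing F m) := Finset.univ.image fun c : {c // c ∈ s} => Θ ⟨c.1, hsR c.1 c.2⟩
  let N : Subalgebra V (TruncRing F m) := Algebra.adjoin V (s' ∪ Set.range T)
  have hVF : ∀ v : V, algebraMap V (TruncRing F m) v = algebraMap F (TruncRing F m) v :=
    fun v => IsScalarTower.algebraMap_apply V F (TruncRing F m) v
  have hintegral : ∀ r, IsIntegral V (Θ r) := fun r => by
    refine IsIntegral.of_pow (Nat.pos_of_ne_zero hpe) ?_
    rw [hΘpow, ← map_pow]
    change IsIntegral V (algebraMap F (TruncRing F m) (⟨ev r ^ p ^ e, pow_mem (hevV r) _⟩ : V))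
    rw [← hVF]
    exact isIntegral_algebraMap (x := (⟨ev r ^ p ^ e, pow_mem (hevV r) _⟩ : V))
  have hfin : Module.Finite V N := by
    refine Module.Finite.iff_fg.2
      (fg_adjoin_of_finite (s'.finite_toSet.union (Set.finite_range T)) ?_)
    rintro z (hz | ⟨j, rfl⟩)
    · obtain ⟨c, -, rfl⟩ := Finset.mem_image.1 hz
      exact hintegral _
    · refine IsIntegral.of_pow (Nat.pos_of_ne_zero hpe) ?_
      rw [hT]
      exact isIntegral_one
  have hTN : ∀ j, T j ∈ N := fun j => Algebra.subset_adjoin (Or.inr ⟨j, rfl⟩)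
  have hkR : ∀ c : k, algebraMap k (RatFunc F) c ∈ R := fun c => hDR (Subalgebra.algebraMap_mem _ c)
  have hevk : ∀ c : k, ev ⟨_, hkR c⟩ = algebraMap k F c := fun c => by
    refine Eq.trans ?_ (evalOrigin_C (algebraMap k F c))
    change evalOrigin F _ = _
    congr 1
  have hΘk : ∀ c : k, Θ ⟨_, hkR c⟩ = algebraMap F _ (algebraMap k F c) := fun c => by
    rw [← hevk]
    refine truncTaylor_eq ?_
    convert dvd_zero _
    have h1 := taylor_algebraMap (C (algebraMap k F c) : F[X]) (algebraMap_mem_originRing _)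
    rw [Polynomial.coe_C] at h1
    have h2 := hevk c
    change evalOrigin F _ = _ at h2
    rw [h2, ← h1, sub_eq_zero]
    congr 1
  have hVN : ∀ v : V, algebraMap F (TruncRing F m) v ∈ N := fun v => hVF v ▸ N.algebraMap_mem v
  have hDN : ∀ d (hd : d ∈ Algebra.adjoin k (s : Set (RatFunc F))), Θ ⟨d, hDR hd⟩ ∈ N := by
    intro d hd
    induction hd using Algebra.adjoin_induction with
    | mem c hc =>
      exact Algebra.subset_adjoin (Or.inl (Finset.mem_image.2 ⟨⟨c, hc⟩, Finset.mem_univ _, rfl⟩))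
    | algebraMap c =>
      rw [hΘk, ← hevk]
      exact hVN ⟨_, hevV _⟩
    | add a b ha hb iha ihb =>
      have := add_mem iha ihb
      rwa [← map_add] at this
    | mul a b ha hb iha ihb =>
      have := mul_mem iha ihb
      rwa [← map_mul] at this
  have hΘN : ∀ r, Θ r ∈ N := fun r => by
    obtain ⟨a, ha, b, hb, ⟨b', hb', hbb⟩, hab⟩ := hD r r.2
    have hbu : (⟨b, hDR hb⟩ : R) * ⟨b', hb'⟩ = 1 := Subtype.ext hbb
    have h1 : r = ⟨a, hDR ha⟩ * ⟨b', hb'⟩ := by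
      have : r * ⟨b, hDR hb⟩ = ⟨a, hDR ha⟩ := Subtype.ext hab
      rw [← this, mul_assoc, hbu, mul_one]
    have h2 : Θ ⟨b', hb'⟩ = Θ ⟨b, hDR hb⟩ ^ (p ^ e - 1) *
        algebraMap F _ (ev ⟨b', hb'⟩ ^ p ^ e) := by
      rw [map_pow, ← hΘpow, ← Nat.sub_one_add_one hpe, pow_succ, Nat.add_sub_cancel, ← mul_assoc,
        ← mul_pow, ← map_mul, hbu, map_one, one_pow, one_mul]
    rw [h1, map_mul, h2]
    exact mul_mem (hDN a ha) (mul_mem (pow_mem (hDN b hb) _) (hVN ⟨_, pow_mem (hevV _) _⟩))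
  let Θ' : R →+* N := Θ.codRestrict N hΘN
  let T' : Fin n → N := fun j => ⟨T j, hTN j⟩
  let I := (IsLocalRing.maximalIdeal V).map (algebraMap V N)
  let ev' : R →+* V := ev.codRestrict V hevV
  have hVF' : ∀ v : V, ((algebraMap V N v : N) : TruncRing F m) = algebraMap F (TruncRing F m) v :=
    fun v => hVF v
  have hΘ'y : ∀ j, Θ' (y j) = algebraMap V N (ev' (y j)) * T' j :=
    fun j => Subtype.ext ((hTy j).trans
    (congrArg (· * T j) (hVF' (ev' (y j))).symm))
  have hres' : ∀ r, Θ' r - algebraMap V N (ev' r) ∈ I := fun r => by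
    obtain ⟨c, hc⟩ := hasResidueField_compositeRing hres r ((dominates_iff.1 hVR).1 r.2)
    have hmem : r - ⟨_, hkR c⟩ ∈ Ideal.span (Set.range y) := by
      rw [hy.mem_span_iff, Subring.isUnit_iff]
      rintro ⟨h1, h2⟩
      rcases hc with hc | hc
      · exact h1 hc
      · exact hc ((dominates_iff.1 hVR).1 h2)
    have key : ∀ r ∈ Ideal.span (Set.range y), Θ' r - algebraMap V N (ev' r) ∈ I := fun r hr => by
      induction hr using Submodule.span_induction with
      | mem x hx =>
        obtain ⟨j, rfl⟩ := hx
        have hj : algebraMap V N (ev' (y j)) ∈ I := Ideal.mem_map_of_mem _ (hevm j)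
        rw [hΘ'y]
        exact sub_mem (Ideal.mul_mem_right _ _ hj) hj
      | zero => simp
      | add a b _ _ ha hb =>
        rw [map_add, map_add, map_add, add_sub_add_comm]
        exact add_mem ha hb
      | smul a b _ hb =>
        have hI : algebraMap V N (ev' b) ∈ I := by
          refine Ideal.mem_map_of_mem _ ?_
          have : Ideal.span (Set.range y) ≤ (IsLocalRing.maximalIdeal V).comap ev' := by
            rw [Ideal.span_le]
            rintro _ ⟨j, rfl⟩
            exact hevm j
          exact this (by assumption)
        rw [smul_eq_mul, map_mul, map_mul, map_mul]
        have h1 : Θ' a * Θ' b - algebraMap V N (ev' a) * algebraMap V N (ev' b) =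
          Θ' a * (Θ' b - algebraMap V N (ev' b)) +
            (Θ' a - algebraMap V N (ev' a)) * algebraMap V N (ev' b) := by ring
        rw [h1]
        exact add_mem (Ideal.mul_mem_left _ _ hb) (Ideal.mul_mem_left _ _ hI)
    have h1 := key _ hmem
    have h2 : Θ' ⟨_, hkR c⟩ = algebraMap V N (ev' ⟨_, hkR c⟩) := Subtype.ext (by
      rw [hVF']
      change Θ _ = algebraMap F _ (ev _)
      rw [hΘk, hevk])
    rwa [map_sub, map_sub, map_sub, h2, sub_sub_sub_cancel_right] at h1
  obtain ⟨G, hG, ψ, hfinG, hsurj, hpG, ⟨ℓ, hℓ⟩, hker⟩ := exists_spanning_group (V := V) (N := N)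
    (p := p) (e := e) T' (fun j => Subtype.ext (hT j)) hp.ne_zero
    (s := (Subtype.val : N → TruncRing F m) ⁻¹' s') (by
      have : ((Subtype.val : N → TruncRing F m) ⁻¹' s' ∪ Set.range T') =
          (Subtype.val : N → TruncRing F m) ⁻¹' (s' ∪ Set.range T) := by
        ext z
        simp only [Set.mem_union, Set.mem_preimage, Set.mem_range]
        refine or_congr Iff.rfl ⟨?_, ?_⟩
        · rintro ⟨j, rfl⟩
          exact ⟨j, rfl⟩
        · rintro ⟨j, hj⟩
          exact ⟨j, Subtype.ext hj⟩
      rw [this]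
      exact Algebra.adjoin_adjoin_coe_preimage) (by
      intro z hz
      obtain ⟨c, -, hc⟩ := Finset.mem_image.1 hz
      have : z = Θ' ⟨c.1, hsR c.1 c.2⟩ := Subtype.ext hc.symm
      exact ⟨_, this ▸ hres' _⟩)
  refine ⟨G, hG, ψ, hfinG, hsurj, hpG, ?_, fun δ a hδ hdvd => hker a ?_⟩
  · have := Fintype.ofFinite G
    have hspan : ∀ z ∈ N, z ∈ Submodule.span F (Set.range fun g => (ℓ g : TruncRing F m)) := by
      intro z hz
      have h1 : (⟨z, hz⟩ : N) ∈ Submodule.span V (Set.range ℓ) := by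
        rw [hℓ]
        trivial
      have h2 : ∀ w ∈ Submodule.span V (Set.range ℓ),
          (w : TruncRing F m) ∈ Submodule.span F (Set.range fun g => (ℓ g : TruncRing F m)) := by
        intro w hw
        induction hw using Submodule.span_induction with
        | mem x hx =>
          obtain ⟨g, rfl⟩ := hx
          exact Submodule.subset_span ⟨g, rfl⟩
        | zero => exact zero_mem _
        | add a b _ _ ha hb => exact add_mem ha hb
        | smul v b _ hb => exact Submodule.smul_mem _ (v : F) hb
      exact h2 _ h1
    have h3 := linearIndependent_le_span' _ (linearIndependent_truncTaylor_X (F := F) (m := m))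
      (Set.range fun g => (ℓ g : TruncRing F m)) (by
        rintro _ ⟨i, rfl⟩
        exact hspan _ (pow_mem (hΘN ⟨_, hX⟩) _))
    rw [Nat.card_eq_fintype_card]
    simp only [Cardinal.mk_fintype, Fintype.card_fin, Nat.cast_le] at h3
    exact h3.trans (Fintype.card_range_le _)
  · have h1 : Θ (δ * monom y a) = algebraMap F _ (ev (δ * monom y a)) := truncTaylor_eq hdvd
    have h2 : Θ (monom y a) = algebraMap F _ (ev (monom y a)) * monom T a := by
      simp only [monom, map_prod, map_pow, hTy, mul_pow, Finset.prod_mul_distrib]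
    have h3 : ev (monom y a) ≠ 0 := by
      simp only [monom, map_prod, map_pow]
      exact Finset.prod_ne_zero_iff.2 fun j _ => pow_ne_zero _ (hevy j)
    have h4 : Θ δ * monom T a = algebraMap F _ (ev δ) := by
      rw [map_mul, h2, map_mul, map_mul] at h1
      have h5 : (algebraMap F (TruncRing F m) (ev (monom y a))⁻¹) *
          algebraMap F (TruncRing F m) (ev (monom y a)) = 1 := by
        rw [← map_mul, inv_mul_cancel₀ h3, map_one]
      linear_combination algebraMap F (TruncRing F m) (ev (monom y a))⁻¹ * h1 +
        (algebraMap F _ (ev δ) - Θ δ * monom T a) * h5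
    have h5 : Θ' δ * monom T' a = algebraMap V N (ev' δ) := Subtype.ext (by
      rw [hVF']
      refine Eq.trans ?_ h4
      change Θ δ * (monom T' a : N) = _
      congr 1
      simp [monom, T'])
    obtain ⟨w, hw⟩ := (hevu δ hδ).exists_left_inv
    have hw' : algebraMap V N w * algebraMap V N (ev' δ) = 1 := by
      rw [← map_mul]
      exact (congrArg _ hw).trans (map_one _)
    have h6 : monom T' a - 1 = - (algebraMap V N w * monom T' a) *
        (Θ' δ - algebraMap V N (ev' δ)) := by
      linear_combination (1 - monom T' a) * hw' + algebraMap V N w * h5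
    rw [h6]
    exact Ideal.mul_mem_left _ _ (hres' δ)

end LowerBound

section UpperBound

variable {k F : Type} [Field k] [Field F] [Algebra k F]

lemma mem_span_expandHom (φ : F →ₐ[k] F) {e q : ℕ} (he : 0 < e) (hq : 0 < q) {z : RatFunc F}
    (hz : z ∈ (expandHom φ he).toRingHom.fieldRange) :
    z ∈ Submodule.span (expandHom φ (Nat.mul_pos he hq)).toRingHom.fieldRange
      ((fun i => (RatFunc.X : RatFunc F) ^ (e * i)) '' Set.Iio q) := by
  obtain ⟨w, rfl⟩ := hz
  have hw := mem_span_X_pow (k := k) hq w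
  induction hw using Submodule.span_induction with
  | mem x hx =>
    obtain ⟨i, hi, rfl⟩ := hx
    refine Submodule.subset_span ⟨i, hi, ?_⟩
    change _ = expandHom φ he (RatFunc.X ^ i)
    rw [map_pow, expandHom_X]
    exact pow_mul _ _ _
  | zero =>
    rw [map_zero]
    exact zero_mem _
  | add a b _ _ ha hb =>
    rw [map_add]
    exact add_mem ha hb
  | smul a b _ hb =>
    obtain ⟨_, w, rfl⟩ := a
    have h1 : expandHom φ (Nat.mul_pos he hq) w ∈
        (expandHom φ (Nat.mul_pos he hq)).toRingHom.fieldRange := ⟨w, rfl⟩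
    have h2 := Submodule.smul_mem _ ⟨_, h1⟩ hb
    convert h2 using 1
    change expandHom φ he (expandHom (AlgHom.id k F) hq w * b) =
      expandHom φ (Nat.mul_pos he hq) w * expandHom φ he b
    rw [map_mul, expandHom_mul]

/-- A `p`-group quotient of the exponent lattice killing the rows of the matrix of a monomial
extension is small. -/
lemma card_le_of_monomial {p : ℕ} [Fact p.Prime] {φ : F →ₐ[k] F} {a : ℕ}
    (ha : 0 < (p + 1) ^ a) {A R : Subring (RatFunc F)}
    (hAalg : IsAlgebraicLocalRingOf k (expandHom φ ha).fieldRange A)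
    (hRalg : IsAlgebraicLocalRingOf k ⊤ R) {n : ℕ} (hAR : A ≤ R) {x : Fin n → A} {y δ : Fin n → R}
    {M : Matrix (Fin n) (Fin n) ℕ} (hx : IsRegularSystem x) (hy : IsRegularSystem y)
    (hδ : ∀ i, IsUnit (δ i)) (hdet : (M.map ((↑·) : ℕ → ℚ)).det ≠ 0)
    (hM : ∀ i, Subring.inclusion hAR (x i) = δ i * monom y (M i))
    {G : Type} [CommGroup G] [Finite G] (hG : IsPGroup p G)
    (ψ : Multiplicative (Fin n → ℤ) →* G) (hψ : Function.Surjective ψ)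
    (hker : ∀ i, ψ (Multiplicative.ofAdd fun j => (M i j : ℤ)) = 1) (s : Finset F)
    (hs : ∀ z, z ∈ Submodule.span φ.fieldRange (s : Set F)) :
    Nat.card G ≤ p ^ a * s.card := by
  classical
  obtain ⟨q, hq⟩ := IsRegularSystem.exists_isWeight (Fin n)
  have := isFractionRing_subring fun z => hRalg.2.2.1 z IntermediateField.mem_top
  obtain ⟨lam, hlam⟩ := IsRegularSystem.exists_exponentHom (F := RatFunc F) hy hq
  have hq' := hq.of_matrix hdet
  let f : ℕ → ℕ := fun s => (p + 1) ^ (a - s)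
  have hf : ∀ s, 0 < f s := fun s => pow_pos p.succ_pos _
  have hf0 : ∀ s, s < a → f s = f (s + 1) * (p + 1) := fun s hs => by
    simp only [f]
    rw [← pow_succ]
    congr 1
    lia
  let L : ℕ → Subfield (RatFunc F) := fun s => (expandHom φ (hf s)).toRingHom.fieldRange
  have hLeq : ∀ {i j : ℕ} (hi : 0 < i) (hj : 0 < j), i = j →
      (expandHom φ hi).toRingHom.fieldRange = (expandHom φ hj).toRingHom.fieldRange := by
    rintro i _ hi hj rfl
    rfl
  have hLs : ∀ s, s < a →
      L s = (expandHom φ (Nat.mul_pos (hf (s + 1)) p.succ_pos)).toRingHom.fieldRange :=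
    fun s hs => hLeq _ _ (hf0 s hs)
  have hmono : Monotone L := monotone_nat_of_le_succ fun s => by
    rcases lt_or_ge s a with h | h
    · rw [hLs s h]
      rintro _ ⟨w, rfl⟩
      refine ⟨expandHom (AlgHom.id k F) p.succ_pos w, ?_⟩
      exact expandHom_mul φ (hf (s + 1)) p.succ_pos w
    · refine (hLeq _ _ ?_).le
      simp only [f]
      congr 1
      lia
  have hA0 : ∀ (u : (RatFunc F)ˣ), (u : RatFunc F) ∈ A → ψ (lam u) = 1 := fun u hu => by
    have hne : (⟨u, hu⟩ : A) ≠ 0 := fun h => u.ne_zero (congrArg Subtype.val h)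
    obtain ⟨α, hα⟩ := IsRegularSystem.exists_lead hx hq' hne
    have h1 := IsRegularSystem.Lead.map (Subring.inclusion hAR) hδ hM hα
    rw [hlam u _ _ h1 rfl]
    have h2 : (Multiplicative.ofAdd fun j => ((Matrix.vecMul α M j : ℕ) : ℤ)) =
        ∏ i, (Multiplicative.ofAdd fun j => (M i j : ℤ)) ^ α i := by
      apply Multiplicative.toAdd.injective
      rw [toAdd_prod]
      ext j
      simp [Matrix.vecMul, dotProduct]
    rw [h2, map_prod]
    refine Finset.prod_eq_one fun i _ => ?_
    rw [map_pow, hker, one_pow]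
  refine (card_le_of_chain hG lam
    (fun s hs z hz => IsRegularSystem.sum_ne_zero hy hq hlam s hs z hz) ψ ?_ L hmono ?_ a ?_
    (s.image (algebraMap F (RatFunc F))) ?_).trans
    (Nat.mul_le_mul_left _ Finset.card_image_le)
  · refine hψ.comp fun c => ?_
    have h1 : ∀ j, ∃ u : (RatFunc F)ˣ, lam u = Multiplicative.ofAdd (Pi.single j 1) := fun j => by
      have hne : (y j : RatFunc F) ≠ 0 := fun h => hy.ne_zero j (Subtype.ext h)
      refine ⟨Units.mk0 _ hne, ?_⟩
      rw [hlam _ _ _ (IsRegularSystem.lead_monom y q (Pi.single j 1)) (by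
        rw [monom_single]; rfl)]
      congr 1
      ext i
      by_cases h : i = j
      · subst h
        simp
      · simp [h]
    choose u hu using h1
    refine ⟨∏ j, u j ^ (c.toAdd j), ?_⟩
    rw [map_prod]
    apply Multiplicative.toAdd.injective
    rw [toAdd_prod]
    ext i
    simp [hu, Finset.sum_apply, Pi.single_apply]
  · intro u hu
    obtain ⟨b, hb, d, hd, hd0, h⟩ := hAalg.2.2.1 u hu
    have hb0 : b ≠ 0 := h ▸ mul_ne_zero u.ne_zero hd0
    have h1 : u * Units.mk0 d hd0 = Units.mk0 b hb0 := Units.ext h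
    have h2 := congrArg (fun v => ψ (lam v)) h1
    simp only [map_mul] at h2
    rwa [hA0 (Units.mk0 d hd0) hd, hA0 (Units.mk0 b hb0) hb, mul_one] at h2
  · intro s hs
    refine ⟨(Finset.range (p + 1)).image fun i => (RatFunc.X : RatFunc F) ^ (f (s + 1) * i),
      Finset.card_image_le.trans (by simp), fun z hz => ?_⟩
    rw [hLs s hs]
    have := mem_span_expandHom φ (hf (s + 1)) p.succ_pos hz
    convert this using 2
    ext
    simp
  · intro z
    have h1 : L a = (expandHom φ one_pos).toRingHom.fieldRange := hLeq _ _ (by simp [f])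
    rw [h1, Finset.coe_image]
    exact mem_span_C φ s hs z

end UpperBound

/-- The inductive step: adjoining a variable to a counterexample. -/
lemma EndoCounterexample.step {k : Type} [Field k] {p : ℕ} [Fact p.Prime] [CharP k p] {n : ℕ}
    (T : EndoCounterexample k n) : Nonempty (EndoCounterexample k (n + 1)) := by
  classical
  have := T.finite
  have := T.separable
  have hloc : IsLocalRing T.B := T.B_alg.2.1
  have hp := (Fact.out : p.Prime)
  have : CharP T.F p := charP_of_injective_algebraMap (algebraMap k T.F).injective p
  obtain ⟨s, hs⟩ := Module.Finite.fg_top (R := T.φ.fieldRange) (M := T.F)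
  have hs' : ∀ z, z ∈ Submodule.span T.φ.fieldRange (s : Set T.F) := fun z => hs ▸ Submodule.mem_top
  obtain ⟨a, ha⟩ : ∃ a, p ^ a * s.card < (p + 1) ^ a := by
    have h1 : (1 : ℝ) < ((p : ℝ) + 1) / p := by
      rw [lt_div_iff₀ (by exact_mod_cast hp.pos)]
      linarith
    obtain ⟨a, ha⟩ := pow_unbounded_of_one_lt (s.card : ℝ) h1
    refine ⟨a, ?_⟩
    rw [div_pow, lt_div_iff₀ (pow_pos (by exact_mod_cast hp.pos) _)] at ha
    rw [mul_comm]
    exact_mod_cast ha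
  have hm : 0 < (p + 1) ^ a := pow_pos p.succ_pos _
  have hmk : (((p + 1) ^ a : ℕ) : k) ≠ 0 := by simp
  have hreg := isRegularLocalOfDim_stepRing T.B_reg
  have hfs := finite_and_isSeparable_expandHom T.φ hm hmk
  have hfrac : ∀ z : T.F, ∃ a ∈ T.B, ∃ b ∈ T.B, b ≠ 0 ∧ z * b = a := fun z =>
    T.B_alg.2.2.1 z IntermediateField.mem_top
  refine ⟨{
    F := RatFunc T.F
    φ := expandHom T.φ hm
    B := stepRing T.B
    V := compositeRing T.V
    trdeg := by rw [trdeg_ratFunc, T.trdeg]; simp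
    finite := hfs.1
    separable := hfs.2
    V_val := isValuationSubring_compositeRing T.V_val
    V_k := fun c => C_mem_compositeRing (T.V_k c)
    V_res := hasResidueField_compositeRing T.V_res
    B_alg := isAlgebraicLocalRingOf_stepRing T.B_alg hreg.2.1
    B_reg := hreg
    V_dom := dominates_compositeRing T.V_dom
    B_dom := dominates_map_expandHom T.B_dom hm
    noMonomialization := ?_ }⟩
  intro A R hAalg hRalg hVR hRA hAB hRB hmono
  obtain ⟨N, hAR, x, y, δ, M, hx, hy, hδ, hdet, hM⟩ := isMonomialExtension_iff.1 hmono
  have hR : R ≤ originRing T.F := (dominates_iff.1 hVR).1.trans (compositeRing_le_originRing _)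
  by_cases hj : ∃ j, evalHom hR (y j) = 0
  · obtain ⟨j, hj⟩ := hj
    obtain ⟨h1, h2, h3, h4, h5, h6, h7⟩ := exists_residue_monomialExtension hfrac T.V_dom T.B_dom hm
      hAalg hRalg hVR hRA hAB hRB hAR hx hy hδ hdet hM hR hj
    exact T.noMonomialization _ _ h1 h2 h3 h4 h5 h6 h7
  push Not at hj
  have hX : (RatFunc.X : RatFunc T.F) ∈ R := by
    have := polyHom_mem_stepRing (X : T.B[X])
    rw [polyHom_apply, map_X, RatFunc.algebraMap_X] at this
    exact (dominates_iff.1 hRB).1 this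
  obtain ⟨G, _, ψ, _, hsurj, hG, hcard, hker⟩ := exists_large_group (p := p) T.V_val T.V_res hRalg
    hVR hX hy hR hj ((p + 1) ^ a)
  refine absurd (hcard.trans (card_le_of_monomial hm hAalg hRalg hAR hx hy hδ hdet hM hG ψ hsurj
    (fun i => hker (δ i) (M i) (hδ i) ?_) s hs')) (not_le.2 ha)
  rw [← hM]
  obtain ⟨w, hw⟩ := hAalg.1 (x i).2
  have hxO : expandHom T.φ hm w ∈ originRing T.F := by
    have := hR (hAR (x i).2)
    rw [← hw] at this
    exact this
  have h1 : Subring.inclusion hR (Subring.inclusion hAR (x i)) = ⟨expandHom T.φ hm w, hxO⟩ :=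
    Subtype.ext hw.symm
  rw [h1]
  exact X_pow_dvd_taylor_expandHom hm ⟨w, mem_originRing_of_expandHom hm hxO⟩ hxO

section TwoDimensional

namespace IsRegularSystem

lemma isDomain' {R ι : Type*} [CommRing R] [Fintype ι] {y : ι → R} (hy : IsRegularSystem y) :
    IsDomain R :=
  hy.isDomain (exists_isWeight ι).choose_spec

lemma isPrincipalIdealRing {R ι : Type*} [CommRing R] [Fintype ι] [Unique ι] {y : ι → R}
    (hy : IsRegularSystem y) : IsPrincipalIdealRing R := by
  have := hy.isDomain'
  have := hy.isNoetherianRing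
  have := hy.isLocalRing
  have h : (IsLocalRing.maximalIdeal R).IsPrincipal → IsPrincipalIdealRing R :=
    ((tfae_of_isNoetherianRing_of_isLocalRing_of_isDomain R).out 4 0).1
  refine h ⟨y default, ?_⟩
  ext z
  rw [IsLocalRing.mem_maximalIdeal, mem_nonunits_iff, ← hy.mem_span_iff, Set.range_unique]

variable {R : Type*} [CommRing R] {a b : R}

lemma uniqueFactorizationMonoid {y : Fin 2 → R} (hy : IsRegularSystem y) [IsDomain R] :
    UniqueFactorizationMonoid R := by
  have := hy.isNoetherianRing
  have := hy.isLocalRing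
  rw [UniqueFactorizationMonoid.iff_exists_prime_mem_of_isPrime]
  intro q hq hqp
  by_cases h1 : y 1 ∈ q
  · exact ⟨_, h1, hy.prime 1⟩
  let : Unique {i : Fin 2 // i ≠ 1} := ⟨⟨⟨0, by decide⟩⟩, fun ⟨i, hi⟩ => Subtype.ext (by
    change i = 0
    lia)⟩
  have := (hy.quotient 1).isPrincipalIdealRing
  obtain ⟨⟨w, hw⟩⟩ := this.principal (q.map (Ideal.Quotient.mk (Ideal.span {y 1})))
  have hsurj := Ideal.Quotient.mk_surjective (I := Ideal.span {y 1})
  have hw' : w ∈ q.map (Ideal.Quotient.mk (Ideal.span {y 1})) :=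
    hw ▸ Submodule.mem_span_singleton_self w
  obtain ⟨h, hh, rfl⟩ := (Ideal.mem_map_iff_of_surjective _ hsurj).1 hw'
  have hle : q ≤ Ideal.span {h} := by
    refine Submodule.le_of_le_smul_of_le_jacobson_bot (I := Ideal.span {y 1})
      (IsNoetherian.noetherian q) ?_ fun z hz => ?_
    · rw [IsLocalRing.jacobson_eq_maximalIdeal _ bot_ne_top, Ideal.span_singleton_le_iff_mem]
      exact hy.not_isUnit 1
    have hz' := Ideal.mem_map_of_mem (Ideal.Quotient.mk (Ideal.span {y 1})) hz
    rw [hw] at hz'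
    obtain ⟨c, hc⟩ := Submodule.mem_span_singleton.1 hz'
    obtain ⟨c, rfl⟩ := hsurj c
    rw [smul_eq_mul, ← map_mul, Ideal.Quotient.eq, Ideal.mem_span_singleton] at hc
    obtain ⟨d, hd⟩ := hc
    have hdq : d ∈ q := by
      refine (hqp.mem_or_mem (?_ : y 1 * d ∈ q)).resolve_left h1
      rw [← hd]
      exact sub_mem (q.mul_mem_left _ hh) hz
    have : z = c * h + y 1 * (-d) := by linear_combination -hd
    rw [this]
    exact Submodule.add_mem_sup (Ideal.mul_mem_left _ _ (Ideal.mem_span_singleton_self h))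
      (Submodule.smul_mem_smul (Ideal.mem_span_singleton_self _) (neg_mem hdq))
  have heq : q = Ideal.span {h} := le_antisymm hle ((Ideal.span_singleton_le_iff_mem _).2 hh)
  refine ⟨h, hh, (Ideal.span_singleton_prime ?_).1 (heq ▸ hqp)⟩
  rintro rfl
  exact hq (by rw [heq]; simp)

lemma exists_of_not_isUnit (hy : IsRegularSystem ![a, b]) {z : R} (hz : ¬ IsUnit z) :
    ∃ c d, z = c * a + d * b := by
  rw [← hy.mem_span_iff, Matrix.range_cons, Matrix.range_cons, Matrix.range_empty,
    Set.union_empty, Set.singleton_union, Ideal.mem_span_pair] at hz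
  obtain ⟨c, d, h⟩ := hz
  exact ⟨c, d, h.symm⟩

lemma of_pair {a' b' : R} (hy : IsRegularSystem ![a, b]) (ha' : ¬ IsUnit a') (hb' : ¬ IsUnit b')
    (ha : ∃ c d, a = c * a' + d * b') (hb : ∃ c d, b = c * a' + d * b') :
    IsRegularSystem ![a', b'] := by
  have := hy.isLocalRing
  refine ⟨hy.isNoetherianRing, hy.isLocalRing, hy.ringKrullDim_eq, fun z => ?_⟩
  have hr : Set.range ![a', b'] = {a', b'} := by
    rw [Matrix.range_cons, Matrix.range_cons, Matrix.range_empty, Set.union_empty,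
      Set.singleton_union]
  rw [hr]
  constructor
  · intro h
    rw [Ideal.mem_span_pair] at h
    obtain ⟨c, d, rfl⟩ := h
    exact (IsLocalRing.mem_maximalIdeal _).1
      (add_mem (Ideal.mul_mem_left _ c ((IsLocalRing.mem_maximalIdeal a').2 ha'))
        (Ideal.mul_mem_left _ d ((IsLocalRing.mem_maximalIdeal b').2 hb')))
  · intro h
    obtain ⟨c, d, rfl⟩ := hy.exists_of_not_isUnit h
    have ha2 : a ∈ Ideal.span {a', b'} := by
      obtain ⟨c, d, rfl⟩ := ha
      exact Ideal.mem_span_pair.2 ⟨c, d, rfl⟩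
    have hb2 : b ∈ Ideal.span {a', b'} := by
      obtain ⟨c, d, rfl⟩ := hb
      exact Ideal.mem_span_pair.2 ⟨c, d, rfl⟩
    exact add_mem (Ideal.mul_mem_left _ c ha2) (Ideal.mul_mem_left _ d hb2)

lemma pair_swap (hy : IsRegularSystem ![a, b]) : IsRegularSystem ![b, a] :=
  hy.of_pair (hy.not_isUnit 1) (hy.not_isUnit 0) ⟨0, 1, by ring⟩ ⟨1, 0, by ring⟩

lemma pair_ext {y : Fin 2 → R} (hy : IsRegularSystem y) : IsRegularSystem ![y 0, y 1] := by
  convert hy using 1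
  ext i
  fin_cases i <;> rfl

/-- In a two-dimensional regular ring a prime containing two non-associated primes is maximal. -/
lemma eq_maximalIdeal_of_coprime {y : Fin 2 → R} (hy : IsRegularSystem y) {P : Ideal R}
    [hP : P.IsPrime] {f g : R} (hf : f ∈ P) (hf0 : f ≠ 0) (hg : g ∈ P) (hfg : IsRelPrime f g)
    (i : Fin 2) : y i ∈ P := by
  have := hy.isDomain'
  have := hy.uniqueFactorizationMonoid
  have := hy.isLocalRing
  by_contra hi
  obtain ⟨π, hπP, hπ, hπf⟩ : ∃ π ∈ P, Prime π ∧ π ∣ f := by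
    have := UniqueFactorizationMonoid.induction_on_prime (P := fun f => f ≠ 0 → f ∈ P →
      ∃ π ∈ P, Prime π ∧ π ∣ f) f (fun h => absurd rfl h)
      (fun x hx _ h => absurd (Ideal.eq_top_of_isUnit_mem _ h hx) hP.ne_top)
      (fun c π hc hπ ih _ h => by
        rcases hP.mem_or_mem h with h | h
        · exact ⟨π, h, hπ, dvd_mul_right _ _⟩
        · obtain ⟨ρ, h1, h2, h3⟩ := ih hc h
          exact ⟨ρ, h1, h2, h3.mul_left _⟩)
    exact this hf0 hf
  have hgπ : ¬ π ∣ g := fun h => hπ.not_isUnit (hfg hπf h)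
  have hpi : (Ideal.span {π}).IsPrime := (Ideal.span_singleton_prime hπ.ne_zero).2 hπ
  let s : LTSeries (PrimeSpectrum R) :=
    ⟨3, ![⟨⊥, Ideal.isPrime_bot⟩, ⟨_, hpi⟩, ⟨P, hP⟩,
      ⟨IsLocalRing.maximalIdeal R, inferInstance⟩], by
      intro j
      fin_cases j
      · change (⟨⊥, Ideal.isPrime_bot⟩ : PrimeSpectrum R) < ⟨_, hpi⟩
        rw [← PrimeSpectrum.asIdeal_lt_asIdeal, bot_lt_iff_ne_bot, Ne,
          Ideal.span_singleton_eq_bot]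
        exact hπ.ne_zero
      · change (⟨_, hpi⟩ : PrimeSpectrum R) < ⟨P, hP⟩
        rw [← PrimeSpectrum.asIdeal_lt_asIdeal, SetLike.lt_iff_le_and_exists]
        exact ⟨(Ideal.span_singleton_le_iff_mem _).2 hπP, g, hg,
          fun h => hgπ (Ideal.mem_span_singleton.1 h)⟩
      · change (⟨P, hP⟩ : PrimeSpectrum R) < ⟨IsLocalRing.maximalIdeal R, inferInstance⟩
        rw [← PrimeSpectrum.asIdeal_lt_asIdeal, SetLike.lt_iff_le_and_exists]
        exact ⟨IsLocalRing.le_maximalIdeal hP.ne_top, y i, hy.not_isUnit i, hi⟩⟩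
  have h1 : (s.length : WithBot ℕ∞) ≤ ringKrullDim R := Order.LTSeries.length_le_krullDim s
  rw [hy.ringKrullDim_eq] at h1
  have h2 : ((3 : ℕ) : WithBot ℕ∞) ≤ ((2 : ℕ) : WithBot ℕ∞) := by simpa [s] using h1
  have h3 : (3 : ℕ) ≤ 2 := by exact_mod_cast h2
  lia

end IsRegularSystem

end TwoDimensional

section Forms

variable {S : Type*} [CommRing S]

/-- `z` is the value at `(x, y)` of a binary form of degree `d` with coefficients in `J`. -/
def IsFormValue (x y : S) (J : Ideal S) (d : ℕ) (z : S) : Prop :=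
  ∃ c : ℕ → S, (∀ i, c i ∈ J) ∧ z = ∑ i ∈ Finset.range (d + 1), c i * x ^ i * y ^ (d - i)

variable {x y z : S} {J m : Ideal S} {d e : ℕ}

lemma IsFormValue.lower (hx : x ∈ m) (hy : y ∈ m) (h : IsFormValue x y J (d + 1) z) :
    IsFormValue x y m d z := by
  obtain ⟨c, -, rfl⟩ := h
  refine ⟨fun i => c i * y + if i = d then c (d + 1) * x else 0, fun i => ?_, ?_⟩
  · refine add_mem (m.mul_mem_left _ hy) ?_
    split_ifs
    · exact m.mul_mem_left _ hx
    · exact m.zero_mem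
  · rw [Finset.sum_range_succ]
    simp only [add_mul, Finset.sum_add_distrib, ite_mul, zero_mul, Finset.sum_ite_eq',
      Finset.mem_range, Nat.lt_succ_self, if_true, Nat.sub_self, pow_zero, mul_one]
    congr 1
    · refine Finset.sum_congr rfl fun i hi => ?_
      have : d + 1 - i = d - i + 1 := by
        have := Finset.mem_range.1 hi
        lia
      rw [this]
      ring
    · ring

lemma IsFormValue.of_lt (hx : x ∈ m) (hy : y ∈ m) (h : IsFormValue x y J e z) (hde : d < e) :
    IsFormValue x y m d z := by
  induction e, hde using Nat.le_induction generalizing J with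
  | base => exact h.lower hx hy
  | succ e _ ih => exact ih (h.lower hx hy)

lemma IsFormValue.mul_left (h : IsFormValue x y J d z) (w : S) : IsFormValue x y J d (w * z) := by
  obtain ⟨c, hc, rfl⟩ := h
  exact ⟨fun i => w * c i, fun i => J.mul_mem_left _ (hc i), by
    rw [Finset.mul_sum]
    exact Finset.sum_congr rfl fun i _ => by ring⟩

lemma IsFormValue.mul_mem {w : S} (h : IsFormValue x y J d z) (hw : w ∈ m) :
    IsFormValue x y m d (w * z) := by
  obtain ⟨c, hc, rfl⟩ := h
  exact ⟨fun i => w * c i, fun i => m.mul_mem_right _ hw, by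
    rw [Finset.mul_sum]
    exact Finset.sum_congr rfl fun i _ => by ring⟩

lemma coeff_mem_of_form_eq_zero [IsDomain S] [UniqueFactorizationMonoid S] (hx : x ∈ m)
    (hy : y ∈ m) (hy0 : y ≠ 0) (hxy : IsRelPrime x y) (c : ℕ → S)
    (h : ∑ i ∈ Finset.range (d + 1), c i * x ^ i * y ^ (d - i) = 0) : ∀ i ≤ d, c i ∈ m := by
  have hdvd : ∀ n w, y ∣ w * x ^ n → y ∣ w := fun n w hw =>
    (hxy.symm.pow_right (n := n)).dvd_of_dvd_mul_right hw
  induction d generalizing c with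
  | zero =>
    intro i hi
    have h1 : c 0 = 0 := by simpa using h
    rw [Nat.le_zero.1 hi, h1]
    exact m.zero_mem
  | succ d ih =>
    have hsum : ∑ i ∈ Finset.range (d + 1), c i * x ^ i * y ^ (d + 1 - i) =
        y * ∑ i ∈ Finset.range (d + 1), c i * x ^ i * y ^ (d - i) := by
      rw [Finset.mul_sum]
      refine Finset.sum_congr rfl fun i hi => ?_
      have : d + 1 - i = d - i + 1 := by
        have := Finset.mem_range.1 hi
        lia
      rw [this]
      ring
    rw [Finset.sum_range_succ, hsum, Nat.sub_self, pow_zero, mul_one] at h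
    have h1 : y ∣ c (d + 1) * x ^ (d + 1) := by
      rw [← (eq_neg_of_add_eq_zero_right h).symm, dvd_neg]
      exact dvd_mul_right _ _
    obtain ⟨e, he⟩ := hdvd _ _ h1
    have h2 : ∑ i ∈ Finset.range (d + 1), (c i + if i = d then e * x else 0) * x ^ i * y ^ (d - i)
        = 0 := by
      apply mul_left_cancel₀ hy0
      simp only [add_mul, Finset.sum_add_distrib, ite_mul, zero_mul, Finset.sum_ite_eq',
        Finset.mem_range, Nat.lt_succ_self, if_true, Nat.sub_self, pow_zero, mul_one]
      rw [he] at h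
      linear_combination h
    have h3 := ih _ h2
    intro i hi
    rcases Nat.lt_or_ge d i with hid | hid
    · have : i = d + 1 := by lia
      rw [this, he]
      exact m.mul_mem_right _ hy
    · have h4 := h3 i hid
      refine (Ideal.add_mem_iff_left m ?_).1 h4
      split_ifs
      · exact m.mul_mem_left _ hx
      · exact m.zero_mem

lemma coeff_mem_of_isFormValue [IsDomain S] [UniqueFactorizationMonoid S] (hx : x ∈ m)
    (hy : y ∈ m) (hy0 : y ≠ 0) (hxy : IsRelPrime x y) (c : ℕ → S)
    (h : IsFormValue x y m d (∑ i ∈ Finset.range (d + 1), c i * x ^ i * y ^ (d - i))) :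
    ∀ i ≤ d, c i ∈ m := by
  obtain ⟨e, he, h⟩ := h
  intro i hi
  have := coeff_mem_of_form_eq_zero hx hy hy0 hxy (fun i => c i - e i) (by
    simp only [sub_mul, Finset.sum_sub_distrib]
    rw [h, sub_self]) i hi
  simpa using add_mem this (he i)

/-- The initial form of a nonzero element. -/
lemma IsRegularSystem.exists_initialForm (hxy : IsRegularSystem ![x, y]) (hz : z ≠ 0) :
    ∃ (d : ℕ) (c : ℕ → S), z = ∑ i ∈ Finset.range (d + 1), c i * x ^ i * y ^ (d - i) ∧
      ∃ i ≤ d, IsUnit (c i) := by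
  have := hxy.isLocalRing
  have := hxy.isNoetherianRing
  have hx : x ∈ IsLocalRing.maximalIdeal S := hxy.not_isUnit 0
  have hy : y ∈ IsLocalRing.maximalIdeal S := hxy.not_isUnit 1
  by_contra! hcon
  have hall : ∀ d, IsFormValue x y ⊤ d z := by
    intro d
    induction d with
    | zero => exact ⟨fun _ => z, fun _ => trivial, by simp⟩
    | succ d ih =>
      obtain ⟨c, -, hc⟩ := ih
      have h1 : ∀ i, ∃ p q, i ≤ d → c i = p * x + q * y := fun i => by
        by_cases hi : i ≤ d
        · obtain ⟨p, q, h⟩ := hxy.exists_of_not_isUnit (hcon d c hc i hi)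
          exact ⟨p, q, fun _ => h⟩
        · exact ⟨0, 0, fun h => absurd h hi⟩
      choose p q hpq using h1
      refine ⟨fun i => (if i = 0 then 0 else p (i - 1)) + if i = d + 1 then 0 else q i,
        fun _ => trivial, ?_⟩
      simp only [add_mul, Finset.sum_add_distrib]
      rw [Finset.sum_range_succ' _ (d + 1), Finset.sum_range_succ _ (d + 1), hc]
      simp only [if_true, zero_mul, add_zero, Nat.add_sub_cancel, Nat.succ_ne_zero, if_false,
        ← Finset.sum_add_distrib]
      refine Finset.sum_congr rfl fun i hi => ?_
      have hi' : i < d + 1 := Finset.mem_range.1 hi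
      rw [if_neg hi'.ne, hpq i (by lia), show d + 1 - (i + 1) = d - i by lia,
        show d + 1 - i = d - i + 1 by lia]
      ring
  have hmem : ∀ d, z ∈ IsLocalRing.maximalIdeal S ^ d := fun d => by
    obtain ⟨c, -, hc⟩ := hall d
    rw [hc]
    refine sum_mem fun i hi => ?_
    have hi' : i < d + 1 := Finset.mem_range.1 hi
    rw [mul_assoc]
    refine Ideal.mul_mem_left _ _ ?_
    have := Ideal.mul_mem_mul (Ideal.pow_mem_pow hx i) (Ideal.pow_mem_pow hy (d - i))
    rwa [← pow_add, show i + (d - i) = d by lia] at this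
  have := Ideal.iInf_pow_eq_bot_of_isLocalRing (IsLocalRing.maximalIdeal S)
    (Ideal.IsPrime.ne_top inferInstance)
  exact hz (by rw [← Ideal.mem_bot, ← this, Ideal.mem_iInf]; exact hmem)

end Forms

section QuadraticTransform

variable {F : Type} [Field F] {R S : Subring F} {x y : R}

lemma Dominates.isUnit_inclusion_iff (h : Dominates S R) (hle : R ≤ S) (z : R) :
    IsUnit (Subring.inclusion hle z) ↔ IsUnit z :=
  not_iff_not.1 (h.choose_spec z z.2 (hle z.2))

lemma eq_of_isRelPrime (hxy : IsRegularSystem ![x, y]) {s : Fin 2 → S} (hs : IsRegularSystem s)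
    (hSR : Dominates S R) (hle : R ≤ S) (hfrac : ∀ z ∈ S, ∃ a ∈ R, ∃ b ∈ R, b ≠ 0 ∧ z * b = a)
    (hrel : IsRelPrime (Subring.inclusion hle x) (Subring.inclusion hle y)) : S = R := by
  have := hs.uniqueFactorizationMonoid
  have := hxy.uniqueFactorizationMonoid
  refine le_antisymm (fun z hz => ?_) hle
  by_cases hz0 : z = 0
  · rw [hz0]
    exact R.zero_mem
  obtain ⟨a, ha, b, hb, hb0, h⟩ := hfrac z hz
  obtain ⟨a', b', c, hrel', hca, hcb⟩ :=
    UniqueFactorizationMonoid.exists_reduced_factors' (⟨a, ha⟩ : R) ⟨b, hb⟩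
      fun h => hb0 (congrArg Subtype.val h)
  have hca : (c : F) * a' = a := congrArg Subtype.val hca
  have hcb : (c : F) * b' = b := congrArg Subtype.val hcb
  have hc0 : (c : F) ≠ 0 := by
    rintro h
    exact hb0 (by rw [← hcb, h, zero_mul])
  have hzb : z * b' = a' := by
    apply mul_left_cancel₀ hc0
    rw [hca, ← h, ← hcb]
    ring
  have hb'0 : (b' : F) ≠ 0 := by
    rintro h
    exact hb0 (by rw [← hcb, h, mul_zero])
  by_cases hu : IsUnit b'
  · have := ((Subring.isUnit_iff b').1 hu).2
    rw [(eq_mul_inv_iff_mul_eq₀ hb'0).2 hzb]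
    exact R.mul_mem a'.2 this
  exfalso
  rw [← hSR.isUnit_inclusion_iff hle] at hu
  obtain ⟨q, hq, hqb⟩ := WfDvdMonoid.exists_irreducible_factor hu fun h =>
    hb'0 (congrArg Subtype.val h)
  have hq := hq.prime
  have hqP := (Ideal.span_singleton_prime hq.ne_zero).2 hq
  have hmem : ∀ w : R, w ∈ (Ideal.span {q}).comap (Subring.inclusion hle) ↔
      q ∣ Subring.inclusion hle w := fun w => by
    rw [Ideal.mem_comap, Ideal.mem_span_singleton]
  have hqa : q ∣ Subring.inclusion hle a' := by
    have : Subring.inclusion hle a' = ⟨z, hz⟩ * Subring.inclusion hle b' := Subtype.ext hzb.symm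
    rw [this]
    exact hqb.mul_left _
  have key := hxy.eq_maximalIdeal_of_coprime ((hmem _).2 hqb) (fun h => hb'0 (by rw [h]; rfl))
    ((hmem _).2 hqa) hrel'.symm
  exact hq.not_isUnit (hrel ((hmem x).1 (key 0)) ((hmem y).1 (key 1)))

/-- A two-dimensional regular local ring birationally dominating another one either equals it or
contains one of its quadratic transforms. -/
lemma eq_or_div_mem (hxy : IsRegularSystem ![x, y]) {s : Fin 2 → S} (hs : IsRegularSystem s)
    (hSR : Dominates S R) (hfrac : ∀ z ∈ S, ∃ a ∈ R, ∃ b ∈ R, b ≠ 0 ∧ z * b = a) :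
    S = R ∨ (x : F) / y ∈ S ∨ (y : F) / x ∈ S := by
  have := hs.uniqueFactorizationMonoid
  have := hs.isLocalRing
  have hle : R ≤ S := (dominates_iff.1 hSR).1
  set ι := Subring.inclusion hle with hι
  have hx0 : (x : F) ≠ 0 := fun h => hxy.ne_zero 0 (Subtype.ext h)
  have hy0 : (y : F) ≠ 0 := fun h => hxy.ne_zero 1 (Subtype.ext h)
  obtain ⟨x', y', g, hrel, hx, hy⟩ := UniqueFactorizationMonoid.exists_reduced_factors' (ι x) (ι y)
    fun h => hy0 (congrArg Subtype.val h)
  have hxF : (g : F) * x' = x := congrArg Subtype.val hx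
  have hyF : (g : F) * y' = y := congrArg Subtype.val hy
  have hg0 : (g : F) ≠ 0 := left_ne_zero_of_mul (hxF ▸ hx0)
  by_cases hxu : IsUnit x'
  · refine Or.inr (Or.inr ?_)
    rw [← hxF, ← hyF, mul_div_mul_left _ _ hg0, div_eq_mul_inv]
    exact S.mul_mem y'.2 ((Subring.isUnit_iff x').1 hxu).2
  by_cases hyu : IsUnit y'
  · refine Or.inr (Or.inl ?_)
    rw [← hxF, ← hyF, mul_div_mul_left _ _ hg0, div_eq_mul_inv]
    exact S.mul_mem x'.2 ((Subring.isUnit_iff y').1 hyu).2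
  refine Or.inl ?_
  by_cases hgu : IsUnit g
  · refine eq_of_isRelPrime hxy hs hSR hle hfrac ?_
    change IsRelPrime (ι x) (ι y)
    rw [← hx, ← hy]
    intro d hd1 hd2
    refine hrel (d := d) ?_ ?_
    · exact (hgu.dvd_mul_left).1 hd1
    · exact (hgu.dvd_mul_left).1 hd2
  exfalso
  have hgm : g ∈ IsLocalRing.maximalIdeal S := hgu
  have hxm : x' ∈ IsLocalRing.maximalIdeal S := hxu
  have hym : y' ∈ IsLocalRing.maximalIdeal S := hyu
  have hy'0 : y' ≠ 0 := by
    rintro rfl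
    exact hy0 (by rw [← hyF]; simp)
  obtain ⟨a, ha, b, hb, hb0, hab⟩ := hfrac g g.2
  have ha0 : a ≠ 0 := hab ▸ mul_ne_zero hg0 hb0
  obtain ⟨α, c, hc, i, hi, hiu⟩ := hxy.exists_initialForm (z := ⟨a, ha⟩)
    fun h => ha0 (congrArg Subtype.val h)
  obtain ⟨β, e, he, j, hj, hju⟩ := hxy.exists_initialForm (z := ⟨b, hb⟩)
    fun h => hb0 (congrArg Subtype.val h)
  have hform : ∀ (n : ℕ) (c : ℕ → R), ι (∑ i ∈ Finset.range (n + 1), c i * x ^ i * y ^ (n - i)) =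
      g ^ n * ∑ i ∈ Finset.range (n + 1), ι (c i) * x' ^ i * y' ^ (n - i) := fun n c => by
    rw [map_sum, Finset.mul_sum]
    refine Finset.sum_congr rfl fun i hi => ?_
    have hn : n = i + (n - i) := by
      have := Finset.mem_range.1 hi
      lia
    rw [map_mul, map_mul, map_pow, map_pow, ← hx, ← hy, mul_pow, mul_pow]
    nth_rw 3 [hn]
    rw [pow_add]
    ring
  have hrelation : g ^ (β + 1) * ∑ i ∈ Finset.range (β + 1), ι (e i) * x' ^ i * y' ^ (β - i) =
      g ^ α * ∑ i ∈ Finset.range (α + 1), ι (c i) * x' ^ i * y' ^ (α - i) := by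
    rw [← hform, ← hc, pow_succ', mul_assoc, ← hform, ← he]
    exact Subtype.ext hab
  have hgS : g ≠ 0 := fun h => hg0 (by rw [h]; rfl)
  set A := ∑ i ∈ Finset.range (α + 1), ι (c i) * x' ^ i * y' ^ (α - i) with hA
  set E := ∑ i ∈ Finset.range (β + 1), ι (e i) * x' ^ i * y' ^ (β - i) with hE
  have hAform : IsFormValue x' y' ⊤ α A := ⟨_, fun _ => trivial, rfl⟩
  have hEform : IsFormValue x' y' ⊤ β E := ⟨_, fun _ => trivial, rfl⟩
  rcases Nat.lt_or_ge β α with hlt | hge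
  · have h1 : E = g ^ (α - (β + 1)) * A := by
      apply mul_left_cancel₀ (pow_ne_zero (β + 1) hgS)
      rw [hrelation, ← mul_assoc, ← pow_add]
      congr 2
      lia
    have h2 : IsFormValue x' y' (IsLocalRing.maximalIdeal S) β E := by
      rw [h1]
      exact (hAform.of_lt hxm hym hlt).mul_left _
    exact coeff_mem_of_isFormValue hxm hym hy'0 hrel _ h2 j hj (hju.map ι)
  · have h1 : A = g * (g ^ (β - α) * E) := by
      apply mul_left_cancel₀ (pow_ne_zero α hgS)
      rw [← hrelation, ← mul_assoc, ← mul_assoc, ← pow_succ, ← pow_add]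
      congr 2
      lia
    have h2 : IsFormValue x' y' (IsLocalRing.maximalIdeal S) α A := by
      rw [h1]
      rcases Nat.eq_or_lt_of_le hge with rfl | hlt
      · exact (hEform.mul_left _).mul_mem hgm
      · exact ((hEform.of_lt hxm hym hlt).mul_left _).mul_left _
    exact coeff_mem_of_isFormValue hxm hym hy'0 hrel _ h2 i hi (hiu.map ι)

end QuadraticTransform

end

section PlanarIdeal

variable (k : Type) [Field k]

instance : (RingHom.ker (MvPolynomial.constantCoeff (σ := Fin 2) (R := k))).IsPrime :=
  RingHom.ker_isPrime _

lemma span_range_X_eq_ker :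
    Ideal.span (Set.range (MvPolynomial.X : Fin 2 → MvPolynomial (Fin 2) k)) =
    RingHom.ker (MvPolynomial.constantCoeff (σ := Fin 2) (R := k)) := by
  ext P
  rw [← pow_one (Ideal.span _), MvPolynomial.mem_pow_idealOfVars_iff', RingHom.mem_ker,
    MvPolynomial.constantCoeff_eq]
  refine ⟨fun h => h 0 (by simp), fun h m hm => ?_⟩
  rw [Nat.lt_one_iff, Finsupp.degree_eq_zero_iff] at hm
  rw [hm, h]

lemma height_ker_constantCoeff :
    (RingHom.ker (MvPolynomial.constantCoeff (σ := Fin 2) (R := k))).height = 2 := by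
  set P := RingHom.ker (MvPolynomial.constantCoeff (σ := Fin 2) (R := k)) with hP
  have hmem : ∀ i, (MvPolynomial.X i : MvPolynomial (Fin 2) k) ∈ P := fun i => by
    simp [hP, RingHom.mem_ker]
  apply le_antisymm
  · have h1 : P ∈ (Ideal.span
        (Set.range (MvPolynomial.X : Fin 2 → MvPolynomial (Fin 2) k))).minimalPrimes := by
      rw [span_range_X_eq_ker, Ideal.minimalPrimes_eq_subsingleton_self]
      rfl
    refine (Ideal.height_le_card_of_mem_minimalPrimes_span (Set.finite_range _) h1).trans ?_
    rw [← Set.image_univ]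
    exact_mod_cast (Set.ncard_image_le Set.finite_univ).trans (by simp)
  · have hX : Prime (MvPolynomial.X 0 : MvPolynomial (Fin 2) k) := MvPolynomial.X_prime
    have := (Ideal.span_singleton_prime hX.ne_zero).2 hX
    have h0 := Ideal.height_span_singleton_eq_one_of_mem_nonZeroDivisors
      (mem_nonZeroDivisors_of_ne_zero hX.ne_zero) hX.not_isUnit
    have hlt : Ideal.span {(MvPolynomial.X 0 : MvPolynomial (Fin 2) k)} < P := by
      refine lt_of_le_of_ne ((Ideal.span_singleton_le_iff_mem _).2 (hmem 0)) fun h => ?_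
      have h1 := hmem 1
      rw [← h, Ideal.mem_span_singleton, MvPolynomial.X_dvd_X] at h1
      simp at h1
    have h2 := Ideal.height_strict_mono_of_isPrime_of_isPrime hlt
    rw [h0] at h2
    have := Order.add_one_le_of_lt h2
    rwa [one_add_one_eq_two] at this

end PlanarIdeal

section PlanarRing

variable {F : Type} [Field F] (k : Type) [Field k] [Algebra k F]

/-- The localization of `k[a, b]` at the origin. -/
noncomputable def planarRing (a b : F) : Subring F :=
  locSubring (MvPolynomial.aeval ![a, b] : MvPolynomial (Fin 2) k →ₐ[k] F).toRingHom
    (RingHom.ker (MvPolynomial.constantCoeff (σ := Fin 2) (R := k)))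

variable {k} {a b : F}

lemma mem_planarRing {z : F} : z ∈ planarRing k a b ↔ ∃ P Q : MvPolynomial (Fin 2) k,
    MvPolynomial.constantCoeff Q ≠ 0 ∧
      z * MvPolynomial.aeval ![a, b] Q = MvPolynomial.aeval ![a, b] P := Iff.rfl

lemma aeval_mem_planarRing (P : MvPolynomial (Fin 2) k) :
    MvPolynomial.aeval ![a, b] P ∈ planarRing k a b :=
  map_mem_locSubring (MvPolynomial.aeval ![a, b] : MvPolynomial (Fin 2) k →ₐ[k] F).toRingHom _ P

lemma algebraMap_mem_planarRing (c : k) : algebraMap k F c ∈ planarRing k a b := by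
  simpa using aeval_mem_planarRing (a := a) (b := b) (MvPolynomial.C c)

lemma left_mem_planarRing : a ∈ planarRing k a b := by
  simpa using aeval_mem_planarRing (k := k) (a := a) (b := b) (MvPolynomial.X 0)

lemma right_mem_planarRing : b ∈ planarRing k a b := by
  simpa using aeval_mem_planarRing (k := k) (a := a) (b := b) (MvPolynomial.X 1)

lemma isRegularSystem_planarRing (h : AlgebraicIndependent k ![a, b]) :
    IsRegularSystem
      ![(⟨a, left_mem_planarRing⟩ : planarRing k a b), ⟨b, right_mem_planarRing⟩] := by
  have := isRegularSystem_locSubring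
    (MvPolynomial.aeval ![a, b] : MvPolynomial (Fin 2) k →ₐ[k] F).toRingHom
    (RingHom.ker (MvPolynomial.constantCoeff (σ := Fin 2) (R := k))) h
    (span_range_X_eq_ker k) (by rw [height_ker_constantCoeff]; simp)
  have h1 : ![(⟨a, left_mem_planarRing⟩ : planarRing k a b), ⟨b, right_mem_planarRing⟩] =
      fun i => toLocSubring (MvPolynomial.aeval ![a, b] : MvPolynomial (Fin 2) k →ₐ[k] F).toRingHom
        (RingHom.ker (MvPolynomial.constantCoeff (σ := Fin 2) (R := k))) (MvPolynomial.X i) := by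
    funext i
    apply Subtype.ext
    change _ = MvPolynomial.aeval ![a, b] _
    rw [MvPolynomial.aeval_X]
    fin_cases i <;> rfl
  rw [h1]
  exact this

lemma inv_aeval_mem_planarRing (h : AlgebraicIndependent k ![a, b]) {P : MvPolynomial (Fin 2) k}
    (hP : MvPolynomial.constantCoeff P ≠ 0) :
    (MvPolynomial.aeval ![a, b] P)⁻¹ ∈ planarRing k a b :=
  inv_map_mem_locSubring (MvPolynomial.aeval ![a, b] : MvPolynomial (Fin 2) k →ₐ[k] F).toRingHom _
    h hP

/-- `w` has value `c` at the origin of the plane with coordinates `a`, `b`. -/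
def HasValue (a b : F) (w : F) (c : k) : Prop :=
  ∃ α ∈ planarRing k a b, ∃ β ∈ planarRing k a b, w = algebraMap k F c + α * a + β * b

variable {w w' : F} {c c' : k}

lemma hasValue_algebraMap (c : k) : HasValue a b (algebraMap k F c) c :=
  ⟨0, zero_mem _, 0, zero_mem _, by ring⟩

lemma hasValue_one : HasValue a b (1 : F) (1 : k) := by
  simpa using hasValue_algebraMap (a := a) (b := b) (1 : k)

lemma hasValue_left : HasValue a b a (0 : k) := ⟨1, one_mem _, 0, zero_mem _, by simp⟩

lemma hasValue_right : HasValue a b b (0 : k) := ⟨0, zero_mem _, 1, one_mem _, by simp⟩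

namespace HasValue

lemma mem (h : HasValue a b w c) : w ∈ planarRing k a b := by
  obtain ⟨α, hα, β, hβ, rfl⟩ := h
  exact add_mem (add_mem (algebraMap_mem_planarRing c) (mul_mem hα left_mem_planarRing))
    (mul_mem hβ right_mem_planarRing)

lemma add (h : HasValue a b w c) (h' : HasValue a b w' c') : HasValue a b (w + w') (c + c') := by
  obtain ⟨α, hα, β, hβ, rfl⟩ := h
  obtain ⟨α', hα', β', hβ', rfl⟩ := h'
  exact ⟨α + α', add_mem hα hα', β + β', add_mem hβ hβ', by rw [map_add]; ring⟩

lemma mul (h : HasValue a b w c) (h' : HasValue a b w' c') : HasValue a b (w * w') (c * c') := by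
  have hm := h'.mem
  obtain ⟨α, hα, β, hβ, rfl⟩ := h
  obtain ⟨α', hα', β', hβ', rfl⟩ := h'
  have hc := algebraMap_mem_planarRing (a := a) (b := b) c
  refine ⟨algebraMap k F c * α' + α * _, add_mem (mul_mem hc hα') (mul_mem hα hm),
    algebraMap k F c * β' + β * _, add_mem (mul_mem hc hβ') (mul_mem hβ hm), ?_⟩
  rw [map_mul]
  ring

lemma neg (h : HasValue a b w c) : HasValue a b (-w) (-c) := by
  have := (hasValue_algebraMap (a := a) (b := b) (-1 : k)).mul h
  simpa using this

lemma sub (h : HasValue a b w c) (h' : HasValue a b w' c') : HasValue a b (w - w') (c - c') := by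
  simpa [sub_eq_add_neg] using h.add h'.neg

lemma pow (h : HasValue a b w c) (n : ℕ) : HasValue a b (w ^ n) (c ^ n) := by
  induction n with
  | zero => simpa using hasValue_one
  | succ n ih => simpa [pow_succ] using ih.mul h

lemma aeval (P : MvPolynomial (Fin 2) k) :
    HasValue a b (MvPolynomial.aeval ![a, b] P) (MvPolynomial.constantCoeff P) := by
  induction P using MvPolynomial.induction_on with
  | C c => simpa using hasValue_algebraMap c
  | add P Q hP hQ => simpa using hP.add hQ
  | mul_X P i hP =>
    have : HasValue a b (![a, b] i) (0 : k) := by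
      fin_cases i
      · exact hasValue_left
      · exact hasValue_right
    simpa using hP.mul this

lemma mem_zero (hw : w ∈ planarRing k a b) (h : HasValue a b w' (0 : k)) :
    HasValue a b (w * w') (0 : k) := by
  obtain ⟨α, hα, β, hβ, rfl⟩ := h
  exact ⟨w * α, mul_mem hw hα, w * β, mul_mem hw hβ, by simp only [map_zero]; ring⟩

lemma exists_of_mem (hab : AlgebraicIndependent k ![a, b]) (hw : w ∈ planarRing k a b) :
    ∃ c : k, HasValue a b w c := by
  obtain ⟨P, Q, hQ, h⟩ := mem_planarRing.1 hw
  set q := MvPolynomial.constantCoeff Q with hq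
  set e := MvPolynomial.constantCoeff P with he
  refine ⟨e / q, ?_⟩
  have hQ0 := inv_aeval_mem_planarRing hab hQ
  have hQne : MvPolynomial.aeval ![a, b] Q ≠ 0 := fun h => by
    rw [hab.eq_zero_of_aeval_eq_zero _ h] at hq
    exact hQ (by simp [hq])
  have h1 : HasValue a b (MvPolynomial.aeval ![a, b] P - algebraMap k F (e / q) *
      MvPolynomial.aeval ![a, b] Q) (0 : k) := by
    have := (HasValue.aeval (a := a) (b := b) P).sub
      ((hasValue_algebraMap (e / q)).mul (HasValue.aeval Q))
    rwa [← hq, ← he, div_mul_cancel₀ _ hQ, sub_self] at this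
  have h2 := (hasValue_algebraMap (a := a) (b := b) (e / q)).add (mem_zero hQ0 h1)
  rw [add_zero] at h2
  convert h2 using 1
  rw [← h]
  field_simp
  ring

lemma eq_zero_of_inv_mem (hab : AlgebraicIndependent k ![a, b]) (h : HasValue a b w (0 : k))
    (hw : w⁻¹ ∈ planarRing k a b) : w = 0 := by
  by_contra h0
  have hmem := h.mem
  have hunit := (Subring.isUnit_mk_iff hmem).2 ⟨h0, hw⟩
  obtain ⟨α, hα, β, hβ, hwe⟩ := h
  refine ((isRegularSystem_planarRing hab).mem_span_iff ⟨w, _⟩).1 ?_ hunit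
  have : (⟨w, hmem⟩ : planarRing k a b) = ⟨α, hα⟩ * ⟨a, left_mem_planarRing⟩ +
      ⟨β, hβ⟩ * ⟨b, right_mem_planarRing⟩ := Subtype.ext (by simpa using hwe)
  rw [this]
  exact add_mem (Ideal.mul_mem_left _ _ (Ideal.subset_span ⟨0, rfl⟩))
    (Ideal.mul_mem_left _ _ (Ideal.subset_span ⟨1, rfl⟩))

lemma unique (hab : AlgebraicIndependent k ![a, b]) (h : HasValue a b w c)
    (h' : HasValue a b w c') : c = c' := by
  by_contra hne
  have h1 := h.sub ((hasValue_algebraMap (c - c')).add h')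
  have h0 : c - c' ≠ 0 := sub_ne_zero.2 hne
  rw [sub_add_cancel, sub_self, sub_add_cancel_right] at h1
  have := h1.eq_zero_of_inv_mem hab (by
    rw [← map_neg, ← map_inv₀]
    exact algebraMap_mem_planarRing _)
  rw [← map_neg, map_eq_zero, neg_eq_zero] at this
  exact h0 this

lemma inv (hab : AlgebraicIndependent k ![a, b]) (h : HasValue a b w c) (hc : c ≠ 0) :
    HasValue a b w⁻¹ c⁻¹ := by
  have hloc := (isRegularSystem_planarRing hab).isLocalRing
  have hinv : w⁻¹ ∈ planarRing k a b := by
    obtain ⟨P, Q, hQ, hPQ⟩ := mem_planarRing.1 h.mem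
    have hP : MvPolynomial.constantCoeff P ≠ 0 := by
      have h1 := h.mul (HasValue.aeval Q)
      rw [hPQ] at h1
      rw [(HasValue.aeval P).unique hab h1]
      exact mul_ne_zero hc hQ
    have h2 := inv_aeval_mem_planarRing hab hP
    rw [← hPQ] at h2
    have hQne : MvPolynomial.aeval ![a, b] Q ≠ 0 := fun h => by
      rw [hab.eq_zero_of_aeval_eq_zero _ h] at hQ
      exact hQ (by simp)
    have := mul_mem h2 (aeval_mem_planarRing (a := a) (b := b) Q)
    rwa [mul_inv, mul_assoc, inv_mul_cancel₀ hQne, mul_one] at this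
  obtain ⟨c', hc'⟩ := exists_of_mem hab hinv
  have h1 := h.mul hc'
  have hw0 : w ≠ 0 := by
    rintro rfl
    have := h.unique hab (by simpa using hasValue_algebraMap (a := a) (b := b) (0 : k))
    exact hc this
  rw [mul_inv_cancel₀ hw0] at h1
  have := h1.unique hab hasValue_one
  rwa [eq_inv_of_mul_eq_one_right this] at hc'

lemma ne_zero (hab : AlgebraicIndependent k ![a, b]) (h : HasValue a b w c) (hc : c ≠ 0) :
    w ≠ 0 := by
  rintro rfl
  exact hc (h.unique hab (by simpa using hasValue_algebraMap (a := a) (b := b) (0 : k)))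

end HasValue

/-- An element of a subring that is not invertible in it. -/
def IsNonunit (V : Subring F) (z : F) : Prop := z ∈ V ∧ z⁻¹ ∉ V

end PlanarRing

section NonunitsAndValues

variable {F : Type} [Field F] {k : Type} [Field k] [Algebra k F] {V : Subring F} {a b z : F}

lemma exists_eq_add_X_mul (P : MvPolynomial (Fin 2) k) : ∃ P₀ P₁ : MvPolynomial (Fin 2) k,
    P = MvPolynomial.C (MvPolynomial.constantCoeff P) + P₀ * MvPolynomial.X 0 +
      P₁ * MvPolynomial.X 1 := by
  have h : P - MvPolynomial.C (MvPolynomial.constantCoeff P) ∈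
      Ideal.span (Set.range (MvPolynomial.X : Fin 2 → MvPolynomial (Fin 2) k)) := by
    rw [span_range_X_eq_ker, RingHom.mem_ker]
    simp
  obtain ⟨c, hc⟩ := Ideal.mem_span_range_iff_exists_fun.1 h
  rw [Fin.sum_univ_two] at hc
  exact ⟨c 0, c 1, by rw [add_assoc, hc]; ring⟩

lemma IsNonunit.not_isUnit (h : IsNonunit V z) : ¬ IsUnit (⟨z, h.1⟩ : V) := by
  rw [Subring.isUnit_mk_iff]
  exact fun h' => h.2 h'.2

lemma not_isUnit_add_mul (hV : IsLocalRing V) (ha : IsNonunit V a) (hb : IsNonunit V b) {α β : F}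
    (hα : α ∈ V) (hβ : β ∈ V) :
    ¬ IsUnit (⟨α * a + β * b, add_mem (mul_mem hα ha.1) (mul_mem hβ hb.1)⟩ : V) := by
  have h1 : (⟨a, ha.1⟩ : V) ∈ IsLocalRing.maximalIdeal V := ha.not_isUnit
  have h2 : (⟨b, hb.1⟩ : V) ∈ IsLocalRing.maximalIdeal V := hb.not_isUnit
  exact add_mem (Ideal.mul_mem_left _ ⟨α, hα⟩ h1) (Ideal.mul_mem_left _ ⟨β, hβ⟩ h2)

lemma inv_mem_of_value_ne_zero (hV : IsLocalRing V) (hk : ∀ c : k, algebraMap k F c ∈ V)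
    (ha : IsNonunit V a) (hb : IsNonunit V b) {α β : F} (hα : α ∈ V) (hβ : β ∈ V) {c : k}
    (hc : c ≠ 0) : algebraMap k F c + α * a + β * b ≠ 0 ∧
      (algebraMap k F c + α * a + β * b)⁻¹ ∈ V := by
  have hm := add_mem (mul_mem hα ha.1) (mul_mem hβ hb.1)
  have h := not_isUnit_add_mul hV ha hb hα hβ
  have hmem := add_mem (hk c) hm
  have hcu : IsUnit (⟨_, hk c⟩ : V) := (Subring.isUnit_mk_iff _).2
    ⟨by simpa using hc, by rw [← map_inv₀]; exact hk _⟩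
  rw [add_assoc]
  refine (Subring.isUnit_mk_iff hmem).1 ?_
  by_contra h'
  have h1 : (⟨_, hm⟩ : V) ∈ IsLocalRing.maximalIdeal V := h
  have h2 : (⟨_, hmem⟩ : V) ∈ IsLocalRing.maximalIdeal V := h'
  have h3 : (⟨_, hk c⟩ : V) ∈ IsLocalRing.maximalIdeal V := by
    convert sub_mem h2 h1 using 1
    apply Subtype.ext
    simp
  exact h3 hcu

lemma aeval_mem_of_mem (hk : ∀ c : k, algebraMap k F c ∈ V) (ha : a ∈ V) (hb : b ∈ V)
    (P : MvPolynomial (Fin 2) k) : MvPolynomial.aeval ![a, b] P ∈ V := by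
  induction P using MvPolynomial.induction_on with
  | C c => simpa using hk c
  | add P Q hP hQ => simpa using add_mem hP hQ
  | mul_X P i hP =>
    have : ![a, b] i ∈ V := by
      fin_cases i
      · exact ha
      · exact hb
    simpa using mul_mem hP this

lemma planarRing_le (hV : IsLocalRing V) (hk : ∀ c : k, algebraMap k F c ∈ V)
    (ha : IsNonunit V a) (hb : IsNonunit V b) : planarRing k a b ≤ V := by
  intro z hz
  obtain ⟨P, Q, hQ, h⟩ := mem_planarRing.1 hz
  obtain ⟨Q₀, Q₁, hQe⟩ := exists_eq_add_X_mul Q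
  have h1 := inv_mem_of_value_ne_zero hV hk ha hb (aeval_mem_of_mem hk ha.1 hb.1 Q₀)
    (aeval_mem_of_mem hk ha.1 hb.1 Q₁) hQ
  have h2 : MvPolynomial.aeval ![a, b] Q = algebraMap k F (MvPolynomial.constantCoeff Q) +
      MvPolynomial.aeval ![a, b] Q₀ * a + MvPolynomial.aeval ![a, b] Q₁ * b := by
    nth_rw 1 [hQe]
    simp
  rw [← h2] at h1
  rw [(eq_mul_inv_iff_mul_eq₀ h1.1).2 h]
  exact mul_mem (aeval_mem_of_mem hk ha.1 hb.1 P) h1.2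

lemma dominates_planarRing (hab : AlgebraicIndependent k ![a, b]) (hV : IsLocalRing V)
    (hk : ∀ c : k, algebraMap k F c ∈ V) (ha : IsNonunit V a) (hb : IsNonunit V b) :
    Dominates V (planarRing k a b) := by
  have hle := planarRing_le hV hk ha hb
  refine dominates_iff.2 ⟨hle, fun z hz hzV => ?_⟩
  obtain ⟨c, hc⟩ := HasValue.exists_of_mem hab hz
  by_cases h0 : c = 0
  · subst h0
    obtain ⟨α, hα, β, hβ, h⟩ := hc
    have h1 := not_isUnit_add_mul hV ha hb (hle hα) (hle hβ)
    rw [map_zero, zero_add] at h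
    rw [Subring.isUnit_mk_iff, ← h, not_and_or, not_not] at h1
    rcases h1 with h1 | h1
    · rw [h1, inv_zero]
      exact zero_mem _
    · exact absurd hzV h1
  · exact (hc.inv hab h0).mem

lemma HasValue.isNonunit (hab : AlgebraicIndependent k ![a, b]) (h : HasValue a b z (0 : k))
    (h0 : z ≠ 0) : IsNonunit (planarRing k a b) z :=
  ⟨h.mem, fun h' => h0 (h.eq_zero_of_inv_mem hab h')⟩

lemma AlgebraicIndependent.left_ne_zero (hab : AlgebraicIndependent k ![a, b]) : a ≠ 0 :=
  hab.ne_zero 0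

lemma AlgebraicIndependent.right_ne_zero (hab : AlgebraicIndependent k ![a, b]) : b ≠ 0 :=
  hab.ne_zero 1

lemma planarRing_le_of_hasValue {a' b' : F} (hab' : AlgebraicIndependent k ![a', b'])
    (ha0 : a ≠ 0) (hb0 : b ≠ 0)
    (ha : HasValue a' b' a (0 : k)) (hb : HasValue a' b' b (0 : k)) :
    planarRing k a b ≤ planarRing k a' b' :=
  planarRing_le (isRegularSystem_planarRing hab').isLocalRing algebraMap_mem_planarRing
    (ha.isNonunit hab' ha0) (hb.isNonunit hab' hb0)

lemma HasValue.of_hasValue {a' b' : F} (hab' : AlgebraicIndependent k ![a', b'])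
    (ha0 : a ≠ 0) (hb0 : b ≠ 0)
    (ha : HasValue a' b' a (0 : k)) (hb : HasValue a' b' b (0 : k)) {c : k}
    (h : HasValue a b z c) : HasValue a' b' z c := by
  have hle := planarRing_le_of_hasValue hab' ha0 hb0 ha hb
  obtain ⟨α, hα, β, hβ, rfl⟩ := h
  have := ((hasValue_algebraMap (a := a') (b := b') c).add (HasValue.mem_zero (hle hα) ha)).add
    (HasValue.mem_zero (hle hβ) hb)
  rwa [add_zero, add_zero] at this

end NonunitsAndValues

section Coordinates

variable {F : Type} [Field F] {k : Type} [Field k] [Algebra k F] {K : IntermediateField k F}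
  {a b : F}

/-- `a`, `b` are algebraically independent and generate the field `K` over `k`. -/
structure IsCoordinatePair (K : IntermediateField k F) (a b : F) : Prop where
  adjoin_eq : IntermediateField.adjoin k {a, b} = K
  algebraicIndependent : AlgebraicIndependent k ![a, b]

open scoped IntermediateField.algebraAdjoinAdjoin in
lemma isCoordinatePair_of_adjoin_eq [Algebra.IsAlgebraic K F] (htr : Algebra.trdeg k F = 2)
    (h : IntermediateField.adjoin k {a, b} = K) : IsCoordinatePair K a b := by
  refine ⟨h, ?_⟩
  subst h
  have hr : Set.range ![a, b] = {a, b} := Matrix.range_cons_cons_empty _ _ _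
  have : Algebra.IsAlgebraic (Algebra.adjoin k (Set.range ![a, b])) F := by
    rw [hr]
    exact (IsFractionRing.comap_isAlgebraic_iff (A := Algebra.adjoin k {a, b})
      (K := IntermediateField.adjoin k {a, b}) (C := F)).2 inferInstance
  exact (Algebra.IsAlgebraic.isTranscendenceBasis_of_le_trdeg_of_finite k ![a, b]
    (by rw [htr]; simp)).1

namespace IsCoordinatePair

lemma left_mem (h : IsCoordinatePair K a b) : a ∈ K := by
  rw [← h.adjoin_eq]
  exact IntermediateField.subset_adjoin _ _ (by simp)

lemma right_mem (h : IsCoordinatePair K a b) : b ∈ K := by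
  rw [← h.adjoin_eq]
  exact IntermediateField.subset_adjoin _ _ (by simp)

lemma exists_fraction (h : IsCoordinatePair K a b) {z : F} (hz : z ∈ K) :
    ∃ P Q : MvPolynomial (Fin 2) k, Q ≠ 0 ∧
      z * MvPolynomial.aeval ![a, b] Q = MvPolynomial.aeval ![a, b] P := by
  rw [← h.adjoin_eq, show ({a, b} : Set F) = Set.range ![a, b] from
      (Matrix.range_cons_cons_empty _ _ _).symm,
    IntermediateField.mem_adjoin_range_iff] at hz
  obtain ⟨P, Q, rfl⟩ := hz
  by_cases hQ : MvPolynomial.aeval ![a, b] Q = 0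
  · exact ⟨0, 1, one_ne_zero, by simp [hQ]⟩
  · exact ⟨P, Q, by rintro rfl; simp at hQ, div_mul_cancel₀ _ hQ⟩

lemma planarRing_subset (h : IsCoordinatePair K a b) : (planarRing k a b : Set F) ⊆ K := by
  have hm : ∀ P : MvPolynomial (Fin 2) k, MvPolynomial.aeval ![a, b] P ∈ K := fun P =>
    aeval_mem_of_mem (V := K.toSubring) K.algebraMap_mem h.left_mem h.right_mem P
  rintro z ⟨P, Q, hQ, hz⟩
  have hz : z * MvPolynomial.aeval ![a, b] Q = MvPolynomial.aeval ![a, b] P := hz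
  have hQne : MvPolynomial.aeval ![a, b] Q ≠ 0 := fun h' => by
    rw [h.algebraicIndependent.eq_zero_of_aeval_eq_zero _ h'] at hQ
    exact hQ (by simp)
  rw [(eq_div_iff hQne).2 hz]
  exact div_mem (hm P) (hm Q)

lemma exists_fraction_mem (h : IsCoordinatePair K a b) {R : Subring F}
    (hR : planarRing k a b ≤ R) {z : F} (hz : z ∈ K) :
    ∃ u ∈ R, ∃ w ∈ R, w ≠ 0 ∧ z * w = u := by
  obtain ⟨P, Q, hQ, h1⟩ := h.exists_fraction hz
  exact ⟨_, hR (aeval_mem_planarRing P), _, hR (aeval_mem_planarRing Q),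
    fun h' => hQ (h.algebraicIndependent.eq_zero_of_aeval_eq_zero _ h'), h1⟩

lemma isAlgebraicLocalRingOf (h : IsCoordinatePair K a b) :
    IsAlgebraicLocalRingOf k K (planarRing k a b) := by
  have hab := h.algebraicIndependent
  refine ⟨h.planarRing_subset, (isRegularSystem_planarRing hab).isLocalRing,
    fun z hz => h.exists_fraction_mem le_rfl hz,
    (MvPolynomial.aeval ![a, b] : MvPolynomial (Fin 2) k →ₐ[k] F).range, ?_, ?_, ?_⟩
  · rw [← Algebra.adjoin_range_eq_range_aeval]
    exact Subalgebra.fg_def.2 ⟨_, Set.finite_range _, rfl⟩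
  · rintro _ ⟨P, rfl⟩
    exact aeval_mem_planarRing P
  · rintro z ⟨P, Q, hQ, hz⟩
    refine ⟨_, ⟨P, rfl⟩, _, ⟨Q, rfl⟩, ⟨_, inv_aeval_mem_planarRing hab hQ, mul_inv_cancel₀ ?_⟩, hz⟩
    exact (HasValue.aeval Q).ne_zero hab hQ

end IsCoordinatePair

lemma planarRing_isRegularLocalOfDim (h : AlgebraicIndependent k ![a, b]) :
    IsRegularLocalOfDim (planarRing k a b) 2 :=
  isRegularLocalOfDim_iff.2 ⟨_, isRegularSystem_planarRing h⟩

end Coordinates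

section Stage

variable {F : Type} [Field F] {k : Type} [Field k] [Algebra k F] (p : ℕ)
  (K : IntermediateField k F)

/-- The local form of the field inclusion at the points of the valuation. -/
structure IsStage (x y u v : F) : Prop where
  pair_top : IsCoordinatePair (⊤ : IntermediateField k F) x y
  pair : IsCoordinatePair K u v
  form : ∃ γ₀ κ₀ l₀ t₀ : k, γ₀ ≠ 0 ∧ κ₀ ≠ 0 ∧ l₀ ≠ 0 ∧ t₀ ≠ 0 ∧ ∃ γ₁ ∈ planarRing k x y,
    ∃ l t : F, HasValue x y l l₀ ∧ HasValue x y t t₀ ∧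
      u = (algebraMap k F γ₀ + algebraMap k F κ₀ * y + γ₁ * x) * x ^ p ∧ v = l * y ^ p + t * x

variable {p K}

lemma adjoin_pair_eq {a b z : F} {c : k} {m : ℕ} (hb : b ≠ 0)
    (h : a = b ^ m * (algebraMap k F c + z)) :
    IntermediateField.adjoin k {b, z} = IntermediateField.adjoin k {a, b} := by
  have hm : ∀ s t : F,
      s ∈ IntermediateField.adjoin k {s, t} ∧ t ∈ IntermediateField.adjoin k {s, t} :=
    fun s t => ⟨IntermediateField.subset_adjoin _ _ (by simp),
      IntermediateField.subset_adjoin _ _ (by simp)⟩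
  have hz : z = a / b ^ m - algebraMap k F c := by
    rw [h]
    field_simp
    ring
  apply le_antisymm
  · rw [IntermediateField.adjoin_le_iff]
    rintro w (rfl | rfl)
    · exact (hm _ _).2
    · rw [hz]
      exact sub_mem (div_mem (hm _ _).1 (pow_mem (hm _ _).2 _))
        (IntermediateField.algebraMap_mem _ _)
  · rw [IntermediateField.adjoin_le_iff]
    rintro w (rfl | rfl)
    · rw [h]
      exact mul_mem (pow_mem (hm _ _).1 _)
        (add_mem (IntermediateField.algebraMap_mem _ _) (hm _ _).2)
    · exact (hm _ _).1

lemma IsCoordinatePair.next [Algebra.IsAlgebraic K F] (htr : Algebra.trdeg k F = 2) {a b z : F}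
    {c : k} {m : ℕ} (hab : IsCoordinatePair K a b) (h : a = b ^ m * (algebraMap k F c + z)) :
    IsCoordinatePair K b z :=
  isCoordinatePair_of_adjoin_eq htr
    ((adjoin_pair_eq hab.algebraicIndependent.right_ne_zero h).trans hab.adjoin_eq)

lemma IsStage.next [Fact p.Prime] [CharP k p] [Algebra.IsAlgebraic K F]
    (htr : Algebra.trdeg k F = 2) (hk : ∀ d : k, ∃ c : k, c ≠ 0 ∧ c ≠ d) {x y u v : F}
    (h : IsStage p K x y u v) : ∃ (c c' : k) (z w : F), c ≠ 0 ∧ c' ≠ 0 ∧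
      x = y ^ p * (algebraMap k F c + z) ∧ u = v ^ p * (algebraMap k F c' + w) ∧
      IsStage p K y z v w := by
  obtain ⟨hxy, huv, γ₀, κ₀, l₀, t₀, hγ₀, hκ₀, hl₀, ht₀, γ₁, hγ₁, l, t, hl, ht, hu, hv⟩ := h
  have : CharP F p := charP_of_injective_algebraMap (algebraMap k F).injective p
  have hp : p ≠ 0 := (Fact.out : p.Prime).ne_zero
  have hp1 : p - 1 ≠ 0 := by have := (Fact.out : p.Prime).two_le; lia
  have hx0 := hxy.algebraicIndependent.left_ne_zero
  have hy0 := hxy.algebraicIndependent.right_ne_zero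
  have hv0 := huv.algebraicIndependent.right_ne_zero
  obtain ⟨c, hc0, hc⟩ := hk (-(l₀ / t₀))
  have hA : l₀ + t₀ * c ≠ 0 := fun h => hc (by
    field_simp
    linear_combination h)
  have hD : (l₀ + t₀ * c) ^ p ≠ 0 := pow_ne_zero _ hA
  set z := x / y ^ p - algebraMap k F c with hz
  have hx : x = y ^ p * (algebraMap k F c + z) := by
    rw [hz]
    field_simp
    ring
  have hyz := hxy.next htr hx
  have hind := hyz.algebraicIndependent
  have hY : y ^ p = y ^ (p - 1) * y := (pow_sub_one_mul hp y).symm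
  set Y := y ^ (p - 1) with hYdef
  have hYv : HasValue y z Y (0 : k) := by
    have := (hasValue_left (k := k) (a := y) (b := z)).pow (p - 1)
    rwa [zero_pow hp1] at this
  have hzv : HasValue y z z (0 : k) := hasValue_right
  have hczv : HasValue y z (algebraMap k F c + z) c := by
    simpa using (hasValue_algebraMap c).add hzv
  have hxv : HasValue y z x (0 : k) := by
    have := ((hasValue_left (k := k) (a := y) (b := z)).pow p).mul hczv
    rwa [zero_pow hp, zero_mul, ← hx] at this
  have hle := planarRing_le_of_hasValue hind hx0 hy0 hxv hasValue_left
  have hl' := HasValue.of_hasValue hind hx0 hy0 hxv hasValue_left hl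
  have ht' := HasValue.of_hasValue hind hx0 hy0 hxv hasValue_left ht
  have split : ∀ {s : F} {s₀ : k}, HasValue x y s s₀ →
      ∃ s' ∈ planarRing k y z, s = algebraMap k F s₀ + y * s' := by
    rintro s s₀ ⟨α, hα, β, hβ, rfl⟩
    refine ⟨α * (Y * (algebraMap k F c + z)) + β,
      add_mem (mul_mem (hle hα) (mul_mem hYv.mem hczv.mem)) (hle hβ), ?_⟩
    have : x = Y * y * (algebraMap k F c + z) := by rw [← hY, ← hx]
    linear_combination α * this
  obtain ⟨l', hl'm, hle'⟩ := split hl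
  obtain ⟨t', ht'm, hte'⟩ := split ht
  set e := l' + t' * (algebraMap k F c + z) with he
  have hem : e ∈ planarRing k y z := add_mem hl'm (mul_mem ht'm hczv.mem)
  set G := l + t * (algebraMap k F c + z) with hG
  have hGv : HasValue y z G (l₀ + t₀ * c) := hl'.add (ht'.mul hczv)
  have hG0 : G ≠ 0 := hGv.ne_zero hind hA
  have hvG : v = G * y ^ p := by
    rw [hv, hG]
    linear_combination t * hx
  have hGe : G = algebraMap k F (l₀ + t₀ * c) + algebraMap k F t₀ * z + e * y := by
    rw [hG, he, hle', hte', map_add, map_mul]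
    ring
  have hGp : G ^ p = algebraMap k F (l₀ + t₀ * c) ^ p + algebraMap k F t₀ ^ p * z ^ p +
      e ^ p * (Y * y) := by
    rw [hGe, add_pow_char, add_pow_char, mul_pow, mul_pow, hY]
  have hD0 : algebraMap k F (l₀ + t₀ * c) ≠ 0 :=
    (map_ne_zero _).2 hA
  have hDe : algebraMap k F (l₀ + t₀ * c) ^ p =
      algebraMap k F l₀ ^ p + algebraMap k F t₀ ^ p * algebraMap k F c ^ p := by
    rw [map_add, map_mul, add_pow_char, mul_pow]
  set D := algebraMap k F (l₀ + t₀ * c) ^ p with hDdef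
  have hD0 : D ≠ 0 := pow_ne_zero _ hD0
  set c' := γ₀ * c ^ p / (l₀ + t₀ * c) ^ p with hc'
  have hc'0 : c' ≠ 0 := div_ne_zero (mul_ne_zero hγ₀ (pow_ne_zero _ hc0)) hD
  have hc'F : algebraMap k F c' = algebraMap k F γ₀ * algebraMap k F c ^ p / D := by
    rw [hc', map_div₀, map_mul, map_pow, map_pow]
  set w := u / v ^ p - algebraMap k F c' with hw
  have huw : u = v ^ p * (algebraMap k F c' + w) := by
    rw [hw]
    field_simp
    ring
  set g := algebraMap k F κ₀ + γ₁ * (Y * (algebraMap k F c + z)) with hg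
  have hgv : HasValue y z g κ₀ := by
    have h1 := hYv.mul hczv
    rw [zero_mul] at h1
    simpa using (hasValue_algebraMap (a := y) (b := z) κ₀).add (HasValue.mem_zero (hle hγ₁) h1)
  have hgy : algebraMap k F γ₀ + algebraMap k F κ₀ * y + γ₁ * x = algebraMap k F γ₀ + g * y := by
    have : x = Y * y * (algebraMap k F c + z) := by rw [← hY, ← hx]
    rw [hg]
    linear_combination γ₁ * this
  have hxp : x ^ p = (y ^ p) ^ p * (algebraMap k F c ^ p + z ^ p) := by
    rw [hx, mul_pow, add_pow_char]
  have hwe : w = (algebraMap k F γ₀ * algebraMap k F l₀ ^ p) * (D * G ^ p)⁻¹ * z ^ p +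
      (g * (algebraMap k F c ^ p + z ^ p) * D -
        algebraMap k F γ₀ * algebraMap k F c ^ p * Y * e ^ p) *
        (D * G ^ p)⁻¹ * y := by
    have hGp0 : G ^ p ≠ 0 := pow_ne_zero _ hG0
    have hyp0 : (y ^ p) ^ p ≠ 0 := pow_ne_zero _ (pow_ne_zero _ hy0)
    have h1 : u / v ^ p = (algebraMap k F γ₀ + g * y) * (algebraMap k F c ^ p + z ^ p) / G ^ p := by
      rw [hu, hgy, hvG, hxp, mul_pow]
      field_simp
    rw [hw, h1, hc'F]
    field_simp
    rw [hGp, hDe]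
    ring
  have hDv : HasValue y z (D * G ^ p)⁻¹ ((l₀ + t₀ * c) ^ p * (l₀ + t₀ * c) ^ p)⁻¹ := by
    refine (HasValue.mul ?_ (hGv.pow p)).inv hind (mul_ne_zero hD hD)
    exact (hasValue_algebraMap _).pow p
  refine ⟨c, c', z, w, hc0, hc'0, hx, huw, hyz, huv.next htr huw, l₀ + t₀ * c, t₀,
    γ₀ * l₀ ^ p * ((l₀ + t₀ * c) ^ p * (l₀ + t₀ * c) ^ p)⁻¹,
    κ₀ * c ^ p * (l₀ + t₀ * c) ^ p * ((l₀ + t₀ * c) ^ p * (l₀ + t₀ * c) ^ p)⁻¹, hA, ht₀,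
    ?_, ?_, e, hem, _, _, ?_, ?_, ?_, hwe⟩
  · positivity
  · positivity
  · exact ((hasValue_algebraMap _).mul ((hasValue_algebraMap _).pow p)).mul hDv
  · have h1 := ((((hasValue_algebraMap (a := y) (b := z) γ₀).mul
      ((hasValue_algebraMap c).pow p)).mul hYv))
    rw [mul_zero] at h1
    have h2 := (hgv.mul (((hasValue_algebraMap c).pow p).add (hzv.pow p))).mul
      ((hasValue_algebraMap (l₀ + t₀ * c)).pow p)
    rw [zero_pow hp, add_zero] at h2
    have h3 := h2.sub (HasValue.mem_zero (pow_mem hem p) h1)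
    rw [sub_zero] at h3
    convert h3.mul hDv using 2
    rw [hDdef]
    ring
  · rw [hvG, hGe]

end Stage

section

open Polynomial

section WeightedOrder

variable {k : Type} [Field k]

lemma coeff_single_one_eq (Q : MvPolynomial (Fin 2) k) (j : ℕ) :
    Q.coeff (Finsupp.single 1 j) = (MvPolynomial.aeval ![(0 : k[X]), X] Q).coeff j := by
  induction Q using MvPolynomial.induction_on' with
  | add P Q hP hQ => simp [hP, hQ]
  | monomial m e =>
    rw [MvPolynomial.aeval_monomial, MvPolynomial.coeff_monomial,
      Finsupp.prod_fintype _ _ (by simp),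
      Fin.prod_univ_two]
    by_cases h0 : m 0 = 0
    · have : m = Finsupp.single 1 j ↔ j = m 1 := by
        constructor
        · rintro rfl
          simp
        · rintro rfl
          ext i
          fin_cases i
          · simpa using h0
          · simp
      simp [h0, this, Polynomial.algebraMap_eq, coeff_X_pow]
    · have : m ≠ Finsupp.single 1 j := by
        rintro rfl
        simp at h0
      simp [h0, this]

/-- Division of a polynomial by the lowest power of `b` after the substitution
`a = b ^ p * (c + z)`. -/
lemma exists_strict_transform {p : ℕ} (hp : p ≠ 0) (c : k) {P : MvPolynomial (Fin 2) k}
    {m : Fin 2 →₀ ℕ} (hm : P.coeff m ≠ 0)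
    (hmin : ∀ m', P.coeff m' ≠ 0 → p * m 0 + m 1 ≤ p * m' 0 + m' 1) :
    ∃ Q : MvPolynomial (Fin 2) k,
      (∀ {F : Type} [Field F] [Algebra k F] (b z : F),
        MvPolynomial.aeval ![b ^ p * (algebraMap k F c + z), b] P =
          b ^ (p * m 0 + m 1) * MvPolynomial.aeval ![b, z] Q) ∧
      ∃ j ≤ (p * m 0 + m 1) / p, Q.coeff (Finsupp.single 1 j) ≠ 0 := by
  set N := p * m 0 + m 1 with hN
  let wt : (Fin 2 →₀ ℕ) → ℕ := fun m' => p * m' 0 + m' 1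
  set Q : MvPolynomial (Fin 2) k := ∑ m' ∈ P.support, MvPolynomial.C (P.coeff m') *
    MvPolynomial.X 0 ^ (wt m' - N) * (MvPolynomial.C c + MvPolynomial.X 1) ^ m' 0 with hQ
  refine ⟨Q, fun {F} _ _ b z => ?_, ?_⟩
  · nth_rw 1 [P.as_sum]
    rw [map_sum, hQ, map_sum, Finset.mul_sum]
    refine Finset.sum_congr rfl fun m' hm' => ?_
    have h1 : wt m' = N + (wt m' - N) := by
      have := hmin m' (MvPolynomial.mem_support_iff.1 hm')
      simp only [wt]
      lia
    rw [MvPolynomial.aeval_monomial, Finsupp.prod_fintype _ _ (by simp), Fin.prod_univ_two]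
    simp only [Matrix.cons_val_zero, Matrix.cons_val_one, map_mul, map_pow, map_add,
      MvPolynomial.algHom_C, MvPolynomial.aeval_X]
    have h2 : b ^ (p * m' 0) * b ^ m' 1 = b ^ N * b ^ (wt m' - N) := by
      rw [← pow_add, ← pow_add, ← h1]
    rw [mul_pow, ← pow_mul]
    linear_combination algebraMap k F (P.coeff m') * (algebraMap k F c + z) ^ m' 0 * h2
  · set q : k[X] := MvPolynomial.aeval ![(0 : k[X]), X] Q with hq
    have hqe : q = ∑ m' ∈ P.support with wt m' = N, C (P.coeff m') * (C c + X) ^ m' 0 := by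
      rw [hq, hQ, map_sum, Finset.sum_filter]
      refine Finset.sum_congr rfl fun m' hm' => ?_
      have h1 : N ≤ wt m' := hmin m' (MvPolynomial.mem_support_iff.1 hm')
      simp only [Matrix.cons_val_zero, Matrix.cons_val_one, map_mul, map_pow, map_add,
        MvPolynomial.algHom_C, MvPolynomial.aeval_X, Polynomial.algebraMap_eq]
      split_ifs with h
      · simp [h]
      · rw [zero_pow (by lia), mul_zero, zero_mul]
    have hq0 : q ≠ 0 := by
      intro h
      have h1 : (q.comp (X - C c)).coeff (m 0) = P.coeff m := by
        rw [hqe, Polynomial.sum_comp, Polynomial.finsetSum_coeff, Finset.sum_eq_single m]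
        · simp
        · intro m' hm' hne
          have h2 := (Finset.mem_filter.1 hm').2
          have h3 : m' 0 ≠ m 0 := by
            intro h3
            apply hne
            have h4 : m' 1 = m 1 := by
              simp only [wt, hN, h3] at h2
              lia
            ext i
            fin_cases i
            · exact h3
            · exact h4
          simp [coeff_X_pow, h3.symm]
        · intro h'
          exact absurd (Finset.mem_filter.2 ⟨MvPolynomial.mem_support_iff.2 hm,
            (rfl : wt m = N)⟩) h'
      rw [h, zero_comp, coeff_zero] at h1
      exact hm h1.symm
    refine ⟨q.natDegree, ?_, ?_⟩
    · rw [hqe]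
      refine natDegree_sum_le_of_forall_le _ _ fun m' hm' => ?_
      have h2 := (Finset.mem_filter.1 hm').2
      refine (natDegree_C_mul_le _ _).trans ((natDegree_pow_le).trans ?_)
      rw [add_comm, natDegree_X_add_C, mul_one, Nat.le_div_iff_mul_le (Nat.pos_of_ne_zero hp), ← h2]
      simp only [wt]
      rw [mul_comm]
      exact Nat.le_add_right _ _
    · rw [coeff_single_one_eq, ← hq]
      exact leadingCoeff_ne_zero.2 hq0

end WeightedOrder

section PlanarSequence

variable {F : Type} [Field F] {k : Type} [Field k] [Algebra k F]

/-- A sequence of coordinate pairs related by the substitutions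
`f r = f (r + 1) ^ p * (c r + f (r + 2))`. -/
structure IsPlanarSequence (p : ℕ) (K : IntermediateField k F) (f : ℕ → F) (c : ℕ → k) : Prop where
  pair : ∀ r, IsCoordinatePair K (f r) (f (r + 1))
  value_ne_zero : ∀ r, c r ≠ 0
  eq : ∀ r, f r = f (r + 1) ^ p * (algebraMap k F (c r) + f (r + 2))

namespace IsPlanarSequence

variable {p : ℕ} {K : IntermediateField k F} {f : ℕ → F} {c : ℕ → k}

lemma ne_zero (h : IsPlanarSequence p K f c) (r : ℕ) : f r ≠ 0 :=
  (h.pair r).algebraicIndependent.left_ne_zero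

lemma hasValue_unit (r : ℕ) :
    HasValue (f (r + 1)) (f (r + 2)) (algebraMap k F (c r) + f (r + 2)) (c r) := by
  simpa using (hasValue_algebraMap (c r)).add hasValue_right

lemma hasValue_left (h : IsPlanarSequence p K f c) (hp : p ≠ 0) (r : ℕ) :
    HasValue (f (r + 1)) (f (r + 2)) (f r) (0 : k) := by
  have := ((_root_.hasValue_left (k := k) (a := f (r + 1)) (b := f (r + 2))).pow p).mul
    (hasValue_unit (c := c) r)
  rwa [zero_pow hp, zero_mul, ← h.eq] at this

lemma hasValue_mono (h : IsPlanarSequence p K f c) (hp : p ≠ 0) {r s : ℕ} (hrs : r ≤ s) {w : F}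
    {e : k} (hw : HasValue (f r) (f (r + 1)) w e) : HasValue (f s) (f (s + 1)) w e := by
  induction s, hrs using Nat.le_induction with
  | base => exact hw
  | succ s _ ih =>
    exact HasValue.of_hasValue (h.pair (s + 1)).algebraicIndependent (h.ne_zero _) (h.ne_zero _)
      (h.hasValue_left hp s) _root_.hasValue_left ih

lemma planarRing_mono (h : IsPlanarSequence p K f c) (hp : p ≠ 0) {r s : ℕ} (hrs : r ≤ s) :
    planarRing k (f r) (f (r + 1)) ≤ planarRing k (f s) (f (s + 1)) := fun z hz => by
  obtain ⟨e, he⟩ := HasValue.exists_of_mem (h.pair r).algebraicIndependent hz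
  exact (h.hasValue_mono hp hrs he).mem

/-- The elements of the form `f s ^ M * w` with `w` a unit at the `s`-th point. -/
def IsMonomialAt (k : Type) [Field k] [Algebra k F] (f : ℕ → F) (s : ℕ) (z : F) (M : ℕ) : Prop :=
  ∃ w, w ≠ 0 ∧ w ∈ planarRing k (f s) (f (s + 1)) ∧ w⁻¹ ∈ planarRing k (f s) (f (s + 1)) ∧
    z = f s ^ M * w

lemma IsMonomialAt.mul {s : ℕ} {z z' : F} {M M' : ℕ} (h : IsMonomialAt k f s z M)
    (h' : IsMonomialAt k f s z' M') : IsMonomialAt k f s (z * z') (M + M') := by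
  obtain ⟨w, h1, h2, h3, rfl⟩ := h
  obtain ⟨w', h1', h2', h3', rfl⟩ := h'
  exact ⟨w * w', mul_ne_zero h1 h1', mul_mem h2 h2', by rw [mul_inv]; exact mul_mem h3 h3', by ring⟩

lemma IsMonomialAt.pow {s : ℕ} {z : F} {M : ℕ} (h : IsMonomialAt k f s z M) (n : ℕ) :
    IsMonomialAt k f s (z ^ n) (n * M) := by
  obtain ⟨w, h1, h2, h3, rfl⟩ := h
  exact ⟨w ^ n, pow_ne_zero _ h1, pow_mem h2 n, by rw [← inv_pow]; exact pow_mem h3 n, by ring⟩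

lemma IsMonomialAt.mono (h : IsPlanarSequence p K f c) (hp : p ≠ 0) {r s : ℕ} (hrs : r ≤ s) {z : F}
    {M : ℕ} (hz : IsMonomialAt k f r z M) : ∃ M', IsMonomialAt k f s z M' := by
  induction s, hrs using Nat.le_induction with
  | base => exact ⟨M, hz⟩
  | succ s _ ih =>
    obtain ⟨M', w, h1, h2, h3, rfl⟩ := ih
    have hle := h.planarRing_mono hp (Nat.le_succ s)
    have hv := hasValue_unit (f := f) (c := c) s
    have hind := (h.pair (s + 1)).algebraicIndependent
    have h4 : IsMonomialAt k f (s + 1) (f s) p := ⟨_, hv.ne_zero hind (h.value_ne_zero s), hv.mem,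
      (hv.inv hind (h.value_ne_zero s)).mem, h.eq s⟩
    exact ⟨_, (h4.pow M').mul (M' := 0) ⟨w, h1, hle h2, hle h3, by simp⟩⟩

lemma exists_isMonomialAt_aeval (h : IsPlanarSequence p K f c) (hp : 2 ≤ p) (N : ℕ) (r : ℕ)
    (P : MvPolynomial (Fin 2) k) (hP : ∃ m, P.coeff m ≠ 0 ∧ p * m 0 + m 1 ≤ N) :
    ∃ s M, IsMonomialAt k f s (MvPolynomial.aeval ![f r, f (r + 1)] P) M ∧ r ≤ s := by
  induction N using Nat.strong_induction_on generalizing r P with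
  | _ N ih =>
  obtain ⟨m₀, hm₀, hN⟩ := hP
  obtain ⟨m, hm, hmin⟩ := Finset.exists_min_image P.support (fun m => p * m 0 + m 1)
    ⟨m₀, MvPolynomial.mem_support_iff.2 hm₀⟩
  rw [MvPolynomial.mem_support_iff] at hm
  replace hmin : ∀ m', P.coeff m' ≠ 0 → p * m 0 + m 1 ≤ p * m' 0 + m' 1 := fun m' hm' =>
    hmin m' (MvPolynomial.mem_support_iff.2 hm')
  by_cases h0 : p * m 0 + m 1 = 0
  · have hm0 : m = 0 := by
      rw [Nat.add_eq_zero_iff, Nat.mul_eq_zero] at h0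
      ext i
      fin_cases i
      · exact h0.1.resolve_left (by lia)
      · exact h0.2
    have hc : MvPolynomial.constantCoeff P ≠ 0 := by rwa [MvPolynomial.constantCoeff_eq, ← hm0]
    have hind := (h.pair r).algebraicIndependent
    exact ⟨r, 0, ⟨_, (HasValue.aeval P).ne_zero hind hc, (HasValue.aeval P).mem,
      ((HasValue.aeval P).inv hind hc).mem, by simp⟩, le_rfl⟩
  · obtain ⟨Q, hQ, j, hj, hjc⟩ := exists_strict_transform (by lia) (c r) hm hmin
    have hlt : j < N := by
      have := Nat.div_lt_self (Nat.pos_of_ne_zero h0) hp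
      have := hmin m₀ hm₀
      lia
    obtain ⟨s, M, hs, hrs⟩ := ih j hlt (r + 1) Q ⟨_, hjc, by simp⟩
    obtain ⟨M', hM'⟩ := IsMonomialAt.mono h (by lia) hrs (z := f (r + 1)) (M := 1)
      ⟨1, one_ne_zero, one_mem _, by simp, by simp⟩
    have h1 := hQ (f (r + 1)) (f (r + 2))
    rw [← h.eq] at h1
    rw [h1]
    exact ⟨s, _, (hM'.pow _).mul hs, by lia⟩

/-- The union of the rings of a planar sequence. -/
noncomputable def limitRing (h : IsPlanarSequence p K f c) (hp : p ≠ 0) : Subring F where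
  carrier := {z | ∃ r, z ∈ planarRing k (f r) (f (r + 1))}
  zero_mem' := ⟨0, zero_mem _⟩
  one_mem' := ⟨0, one_mem _⟩
  neg_mem' := fun ⟨r, hr⟩ => ⟨r, neg_mem hr⟩
  add_mem' := fun ⟨r, hr⟩ ⟨s, hs⟩ => ⟨max r s, add_mem (h.planarRing_mono hp (le_max_left r s) hr)
    (h.planarRing_mono hp (le_max_right r s) hs)⟩
  mul_mem' := fun ⟨r, hr⟩ ⟨s, hs⟩ => ⟨max r s, mul_mem (h.planarRing_mono hp (le_max_left r s) hr)
    (h.planarRing_mono hp (le_max_right r s) hs)⟩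

lemma not_inv_mem_limitRing (h : IsPlanarSequence p K f c) (hp : p ≠ 0) {r : ℕ} {z : F}
    (hz : HasValue (f r) (f (r + 1)) z (0 : k)) (h0 : z ≠ 0) : z⁻¹ ∉ h.limitRing hp := by
  rintro ⟨s, hs⟩
  exact h0 ((h.hasValue_mono hp (le_max_left r s) hz).eq_zero_of_inv_mem
    (h.pair _).algebraicIndependent (h.planarRing_mono hp (le_max_right r s) hs))

lemma isNonunit_limitRing (h : IsPlanarSequence p K f c) (hp : p ≠ 0) (r : ℕ) :
    IsNonunit (h.limitRing hp) (f r) :=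
  ⟨⟨r, left_mem_planarRing⟩, h.not_inv_mem_limitRing hp _root_.hasValue_left (h.ne_zero r)⟩

lemma algebraMap_mem_limitRing (h : IsPlanarSequence p K f c) (hp : p ≠ 0) (e : k) :
    algebraMap k F e ∈ h.limitRing hp := ⟨0, algebraMap_mem_planarRing e⟩

lemma hasResidueField_limitRing (h : IsPlanarSequence p K f c) (hp : p ≠ 0) :
    HasResidueField k (h.limitRing hp) := by
  rintro z ⟨r, hr⟩
  obtain ⟨e, he⟩ := HasValue.exists_of_mem (h.pair r).algebraicIndependent hr
  refine ⟨e, or_iff_not_imp_left.2 fun h0 => h.not_inv_mem_limitRing hp (r := r) ?_ h0⟩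
  have := he.sub (hasValue_algebraMap e)
  rwa [sub_self] at this

lemma isValuationSubring_limitRing (h : IsPlanarSequence p (⊤ : IntermediateField k F) f c)
    (hp : 2 ≤ p) : IsValuationSubring (h.limitRing (p := p) (by lia)) := by
  have hp0 : p ≠ 0 := by lia
  refine ⟨fun h' => (h.isNonunit_limitRing hp0 0).2 (h' ▸ Subring.mem_top _), fun z hz => ?_⟩
  obtain ⟨P, Q, hQ, hPQ⟩ := (h.pair 0).exists_fraction (z := z) IntermediateField.mem_top
  have hind := (h.pair 0).algebraicIndependent
  have hQ0 : MvPolynomial.aeval ![f 0, f 1] Q ≠ 0 := fun h' =>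
    hQ (hind.eq_zero_of_aeval_eq_zero _ h')
  have hP : P ≠ 0 := by
    rintro rfl
    rw [map_zero] at hPQ
    exact mul_ne_zero hz hQ0 hPQ
  have main : ∀ P : MvPolynomial (Fin 2) k, P ≠ 0 →
      ∃ s M, IsMonomialAt k f s (MvPolynomial.aeval ![f 0, f 1] P) M := fun P hP => by
    obtain ⟨m, hm⟩ := MvPolynomial.ne_zero_iff.1 hP
    obtain ⟨s, M, h1, -⟩ := h.exists_isMonomialAt_aeval hp _ 0 P ⟨m, hm, le_rfl⟩
    exact ⟨s, M, h1⟩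
  obtain ⟨s, M, hM⟩ := main P hP
  obtain ⟨s', M', hM'⟩ := main Q hQ
  obtain ⟨m, w, h1, h2, h3, h4⟩ := IsMonomialAt.mono h hp0 (le_max_left s s') hM
  obtain ⟨m', w', h1', h2', h3', h4'⟩ := IsMonomialAt.mono h hp0 (le_max_right s s') hM'
  have hf := h.ne_zero (max s s')
  have hfm : f (max s s') ∈ planarRing k (f (max s s')) (f (max s s' + 1)) := left_mem_planarRing
  have hze : z = (f (max s s') ^ m * w) / (f (max s s') ^ m' * w') := by
    rw [← h4, ← h4', eq_div_iff hQ0, hPQ]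
  rcases le_total m' m with hle | hle
  · refine Or.inl ⟨max s s', ?_⟩
    obtain ⟨d, rfl⟩ := Nat.exists_eq_add_of_le hle
    have : z = f (max s s') ^ d * w * w'⁻¹ := by
      rw [hze]
      field_simp
      rw [pow_add]
    rw [this]
    exact mul_mem (mul_mem (pow_mem hfm _) h2) h3'
  · refine Or.inr ⟨max s s', ?_⟩
    obtain ⟨d, rfl⟩ := Nat.exists_eq_add_of_le hle
    have : z⁻¹ = f (max s s') ^ d * w' * w⁻¹ := by
      rw [hze]
      field_simp
      rw [pow_add]
    rw [this]
    exact mul_mem (mul_mem (pow_mem hfm _) h2') h3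

end IsPlanarSequence

end PlanarSequence

end

section Classification

variable {F : Type} [Field F] {k : Type} [Field k] [Algebra k F] {V S : Subring F} {a b z : F}

lemma planarRing_swap (hab : AlgebraicIndependent k ![a, b]) :
    planarRing k b a = planarRing k a b := by
  have hba : AlgebraicIndependent k ![b, a] := by
    have := hab.comp (Equiv.swap (0 : Fin 2) 1) (Equiv.injective _)
    convert this using 1
    ext i
    fin_cases i <;> simp
  exact le_antisymm
    (planarRing_le_of_hasValue hab hba.left_ne_zero hba.right_ne_zero hasValue_right hasValue_left)
    (planarRing_le_of_hasValue hba hab.left_ne_zero hab.right_ne_zero hasValue_right hasValue_left)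

lemma IsNonunit.of_dominates (h : Dominates V S) (hz : IsNonunit V z) (hzS : z ∈ S) :
    IsNonunit S z :=
  ⟨hzS, fun h' => hz.2 ((dominates_iff.1 h).1 h')⟩

lemma IsNonunit.mul (hz : IsNonunit V z) {w : F} (hw : w ∈ V) (hw0 : w ≠ 0) :
    IsNonunit V (z * w) := by
  refine ⟨mul_mem hz.1 hw, fun h => hz.2 ?_⟩
  have := mul_mem hw h
  rwa [mul_inv, mul_comm, mul_assoc, inv_mul_cancel₀ hw0, mul_one] at this

namespace IsPlanarSequence

variable {p : ℕ} {K : IntermediateField k F} {f : ℕ → F} {c : ℕ → k}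

lemma pair_div [Algebra.IsAlgebraic K F] (htr : Algebra.trdeg k F = 2)
    (h : IsPlanarSequence p K f c) (r i : ℕ) :
    IsCoordinatePair K (f (r + 1)) (f r / f (r + 1) ^ i) :=
  (h.pair r).next (c := 0) (m := i) htr (by
    have := h.ne_zero (r + 1)
    rw [map_zero, zero_add]
    field_simp)

lemma unit_mem (hk : ∀ c : k, algebraMap k F c ∈ V)
    (hf : ∀ r, IsNonunit V (f r)) (r : ℕ) : algebraMap k F (c r) + f (r + 2) ∈ V :=
  add_mem (hk _) (hf _).1

lemma unit_ne_zero (h : IsPlanarSequence p K f c) (r : ℕ) : algebraMap k F (c r) + f (r + 2) ≠ 0 :=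
  fun h0 => h.ne_zero r (by rw [h.eq, h0, mul_zero])

lemma div_eq (h : IsPlanarSequence p K f c) (r : ℕ) {i : ℕ} (hi : i < p) :
    f r / f (r + 1) ^ i =
      f (r + 1) * (f (r + 1) ^ (p - i - 1) * (algebraMap k F (c r) + f (r + 2))) := by
  have := h.ne_zero (r + 1)
  rw [div_eq_iff (pow_ne_zero _ this), h.eq r]
  have hpi : f (r + 1) ^ p = f (r + 1) * f (r + 1) ^ (p - i - 1) * f (r + 1) ^ i := by
    rw [← pow_succ', ← pow_add]
    congr 1
    lia
  rw [hpi]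
  ring

lemma isNonunit_div (h : IsPlanarSequence p K f c) (hk : ∀ c : k, algebraMap k F c ∈ V)
    (hf : ∀ r, IsNonunit V (f r)) (r : ℕ) {i : ℕ} (hi : i < p) :
    IsNonunit V (f r / f (r + 1) ^ i) := by
  rw [h.div_eq r hi]
  exact (hf (r + 1)).mul (mul_mem (pow_mem (hf _).1 _) (unit_mem hk hf r))
    (mul_ne_zero (pow_ne_zero _ (h.ne_zero _)) (h.unit_ne_zero r))

lemma div_zero_ring_eq (h : IsPlanarSequence p K f c) (r : ℕ) :
    planarRing k (f (r + 1)) (f r / f (r + 1) ^ 0) = planarRing k (f r) (f (r + 1)) := by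
  rw [pow_zero, div_one, planarRing_swap (h.pair r).algebraicIndependent]

lemma next_ring_le
    (hk : ∀ c : k, algebraMap k F c ∈ V) (hf : ∀ r, IsNonunit V (f r)) (hVS : Dominates V S)
    (hS : IsLocalRing S) (r : ℕ) (hkS : ∀ c : k, algebraMap k F c ∈ S) (hr : f (r + 1) ∈ S)
    (hu : algebraMap k F (c r) + f (r + 2) ∈ S ∨ (algebraMap k F (c r) + f (r + 2))⁻¹ ∈ S) :
    planarRing k (f (r + 1)) (f (r + 2)) ≤ S := by
  have hle := (dominates_iff.1 hVS).1
  have hu' : algebraMap k F (c r) + f (r + 2) ∈ S := by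
    rcases hu with hu | hu
    · exact hu
    · have := (dominates_iff.1 hVS).2 _ hu (by
        rw [inv_inv]
        exact unit_mem hk hf r)
      rwa [inv_inv] at this
  have hm : f (r + 2) ∈ S := by
    have := sub_mem hu' (hkS (c r))
    rwa [add_sub_cancel_left] at this
  exact planarRing_le hS hkS ((hf _).of_dominates hVS hr) ((hf _).of_dominates hVS hm)

lemma eq_div_ring_or_le [Algebra.IsAlgebraic K F] (htr : Algebra.trdeg k F = 2)
    (h : IsPlanarSequence p K f c) (hp : p ≠ 0) (hV : IsLocalRing V)
    (hk : ∀ c : k, algebraMap k F c ∈ V) (hf : ∀ r, IsNonunit V (f r)) (hVS : Dominates V S)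
    (hS : IsLocalRing S)
    (H : ∀ a b : F, IsCoordinatePair K a b → Dominates S (planarRing k a b) →
      S = planarRing k a b ∨ a / b ∈ S ∨ b / a ∈ S) (r : ℕ)
    (hr : planarRing k (f r) (f (r + 1)) ≤ S) :
    (∃ i < p, S = planarRing k (f (r + 1)) (f r / f (r + 1) ^ i)) ∨
      planarRing k (f (r + 1)) (f (r + 2)) ≤ S := by
  by_contra! hcon
  obtain ⟨hne, hnle⟩ := hcon
  have hkS : ∀ c : k, algebraMap k F c ∈ S := fun c => hr (algebraMap_mem_planarRing c)
  have hrS : f (r + 1) ∈ S := hr right_mem_planarRing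
  have hle := (dominates_iff.1 hVS).1
  have hnu : ¬ (algebraMap k F (c r) + f (r + 2) ∈ S ∨
      (algebraMap k F (c r) + f (r + 2))⁻¹ ∈ S) := fun hu =>
    hnle (next_ring_le hk hf hVS hS r hkS hrS hu)
  have h1 := h.ne_zero (r + 1)
  have main : ∀ i < p, planarRing k (f (r + 1)) (f r / f (r + 1) ^ i) ≤ S := by
    intro i
    induction i with
    | zero => intro _; rw [h.div_zero_ring_eq]; exact hr
    | succ i ih =>
      intro hi
      have hi' : i < p := by lia
      have hpair := h.pair_div htr r i
      have hdom := hVS.of_le (dominates_planarRing hpair.algebraicIndependent hV hk (hf (r + 1))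
        (h.isNonunit_div hk hf r hi')) (ih hi')
      rcases H _ _ hpair hdom with hH | hH | hH
      · exact absurd hH (hne i hi')
      · exfalso
        have h2 : (f r / f (r + 1) ^ (i + 1))⁻¹ ∈ S := by
          convert hH using 1
          rw [pow_succ]
          field_simp
        exact (h.isNonunit_div hk hf r hi).2 (hle h2)
      · have h2 : f r / f (r + 1) ^ (i + 1) ∈ S := by
          convert hH using 1
          rw [pow_succ]
          field_simp
        exact planarRing_le hS hkS ((hf _).of_dominates hVS hrS)
          ((h.isNonunit_div hk hf r hi).of_dominates hVS h2)
  have hi' : p - 1 < p := by lia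
  have hpair := h.pair_div htr r (p - 1)
  have hdom := hVS.of_le (dominates_planarRing hpair.algebraicIndependent hV hk (hf (r + 1))
    (h.isNonunit_div hk hf r hi')) (main _ hi')
  have he : f r / f (r + 1) ^ (p - 1) = f (r + 1) * (algebraMap k F (c r) + f (r + 2)) := by
    rw [h.div_eq r hi', show p - (p - 1) - 1 = 0 by lia, pow_zero, one_mul]
  have h3 := h.unit_ne_zero r
  rcases H _ _ hpair hdom with hH | hH | hH
  · exact hne _ hi' hH
  · rw [he, div_mul_eq_div_div, div_self h1, one_div] at hH
    exact hnu (Or.inr hH)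
  · rw [he, mul_div_cancel_left₀ _ h1] at hH
    exact hnu (Or.inl hH)

lemma exists_not_le (h : IsPlanarSequence p K f c) (hp : 2 ≤ p)
    (hk : ∀ c : k, algebraMap k F c ∈ V) (hf : ∀ r, IsNonunit V (f r)) (hVS : Dominates V S)
    (hS : IsNoetherianRing S) : ∃ r, ¬ planarRing k (f r) (f (r + 1)) ≤ S := by
  by_contra! hcon
  have hm : ∀ r, f r ∈ S := fun r => hcon r left_mem_planarRing
  have hmono : Monotone fun r => Ideal.span {(⟨f r, hm r⟩ : S)} := by
    refine monotone_nat_of_le_succ fun r => ?_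
    rw [Ideal.span_singleton_le_span_singleton]
    refine ⟨⟨f (r + 1), hm _⟩ ^ (p - 1) * ⟨algebraMap k F (c r) + f (r + 2),
      add_mem (hcon 0 (algebraMap_mem_planarRing _)) (hm _)⟩, Subtype.ext ?_⟩
    push_cast
    rw [← mul_assoc, ← pow_succ', Nat.sub_add_cancel (by lia), ← h.eq]
  obtain ⟨N, hN⟩ := monotone_stabilizes_iff_noetherian.2 hS ⟨_, hmono⟩
  have h1 : Ideal.span {(⟨f N, hm N⟩ : S)} = Ideal.span {⟨f (N + 1), hm _⟩} := hN (N + 1) (by lia)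
  obtain ⟨d, hd⟩ := Ideal.span_singleton_le_span_singleton.1 h1.ge
  have hd' : f (N + 1) = f N * d := congrArg Subtype.val hd
  have hle := (dominates_iff.1 hVS).1
  have h0 := h.ne_zero (N + 1)
  refine (hf (N + 1)).2 ?_
  have h2 : (f (N + 1))⁻¹ = f (N + 1) ^ (p - 2) * (algebraMap k F (c N) + f (N + 2)) * d := by
    rw [h.eq N] at hd'
    symm
    apply eq_inv_of_mul_eq_one_left
    apply mul_left_cancel₀ h0
    obtain ⟨q, rfl⟩ := Nat.exists_eq_add_of_le' hp
    rw [Nat.add_sub_cancel]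
    linear_combination -hd'
  rw [h2]
  exact mul_mem (mul_mem (pow_mem (hf _).1 _) (unit_mem hk hf N)) (hle d.2)

/-- The regular local rings dominating the first ring of a planar sequence are obtained from the
sequence by quadratic transforms. -/
lemma exists_eq_div_ring [Algebra.IsAlgebraic K F] (htr : Algebra.trdeg k F = 2)
    (h : IsPlanarSequence p K f c) (hp : 2 ≤ p) (hV : IsLocalRing V)
    (hk : ∀ c : k, algebraMap k F c ∈ V) (hf : ∀ r, IsNonunit V (f r)) (hVS : Dominates V S)
    (hS : IsLocalRing S) (hS' : IsNoetherianRing S)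
    (H : ∀ a b : F, IsCoordinatePair K a b → Dominates S (planarRing k a b) →
      S = planarRing k a b ∨ a / b ∈ S ∨ b / a ∈ S)
    (h0 : planarRing k (f 0) (f 1) ≤ S) :
    ∃ r, ∃ i < p, S = planarRing k (f (r + 1)) (f r / f (r + 1) ^ i) := by
  by_contra! hcon
  obtain ⟨r, hr⟩ := h.exists_not_le hp hk hf hVS hS'
  refine hr ?_
  clear hr
  induction r with
  | zero => exact h0
  | succ r ih =>
    rcases h.eq_div_ring_or_le htr (by lia) hV hk hf hVS hS H r ih with ⟨i, hi, hSi⟩ | h1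
    · exact absurd hSi (hcon r i hi)
    · exact h1

end IsPlanarSequence

end Classification

section Dimension

variable {F : Type} [Field F] {k : Type} [Field k] [Algebra k F] {V S : Subring F}

lemma IsRegularSystem.card_le_trdeg {n : ℕ} {s : Fin n → S} (hs : IsRegularSystem s)
    (hk : ∀ c : k, algebraMap k F c ∈ S) : (n : Cardinal) ≤ Algebra.trdeg k F := by
  let S' : Subalgebra k F := { S with algebraMap_mem' := hk }
  let s' : Fin n → S' := s
  have hs' : IsRegularSystem s' := hs
  have h1 := (hs'.algebraicIndependent k).map' (f := S'.val) Subtype.val_injective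
  have h2 := h1.cardinalMk_le_trdeg
  simpa using h2

lemma IsRegularSystem.div_mem_or {ι : Type*} [Fintype ι] [Unique ι] {s : ι → S}
    (hs : IsRegularSystem s) {a b : F} (ha : a ∈ S) (hb : b ∈ S) (ha0 : a ≠ 0) (hb0 : b ≠ 0) :
    a / b ∈ S ∨ b / a ∈ S := by
  have := hs.isPrincipalIdealRing
  have := hs.isLocalRing
  have : ValuationRing S := ValuationRing.iff_local_bezout_domain.2 ⟨inferInstance, inferInstance⟩
  rcases ValuationRing.dvd_total (⟨a, ha⟩ : S) ⟨b, hb⟩ with ⟨d, hd⟩ | ⟨d, hd⟩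
  · have hd' : b = a * d := congrArg Subtype.val hd
    right
    rw [hd', mul_div_cancel_left₀ _ ha0]
    exact d.2
  · have hd' : a = b * d := congrArg Subtype.val hd
    left
    rw [hd', mul_div_cancel_left₀ _ hb0]
    exact d.2

/-- Classification of the regular local rings dominating the first ring of a planar sequence. -/
lemma IsPlanarSequence.eq_two_and_exists_eq_div_ring {p : ℕ} {K : IntermediateField k F}
    {f : ℕ → F} {c : ℕ → k} [Algebra.IsAlgebraic K F] (htr : Algebra.trdeg k F = 2)
    (h : IsPlanarSequence p K f c) (hp : 2 ≤ p) (hV : IsLocalRing V)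
    (hk : ∀ c : k, algebraMap k F c ∈ V) (hf : ∀ r, IsNonunit V (f r)) (hVS : Dominates V S)
    (hSK : (S : Set F) ⊆ K) {n : ℕ} {s : Fin n → S} (hs : IsRegularSystem s)
    (h0 : planarRing k (f 0) (f 1) ≤ S) :
    n = 2 ∧ ∃ r, ∃ i < p, S = planarRing k (f (r + 1)) (f r / f (r + 1) ^ i) := by
  have hkS : ∀ c : k, algebraMap k F c ∈ S := fun c => h0 (algebraMap_mem_planarRing c)
  have hn : n ≤ 2 := by
    have := hs.card_le_trdeg hkS
    rw [htr] at this
    exact_mod_cast this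
  have main := h.exists_eq_div_ring htr hp hV hk hf hVS hs.isLocalRing hs.isNoetherianRing
  interval_cases n
  · exfalso
    have h1 : ¬ IsUnit (⟨f 0, h0 left_mem_planarRing⟩ : S) :=
      ((hf 0).of_dominates hVS (h0 left_mem_planarRing)).not_isUnit
    rw [← hs.mem_span_iff] at h1
    simp only [Set.range_eq_empty, Ideal.span_empty, Ideal.mem_bot] at h1
    exact h.ne_zero 0 (congrArg Subtype.val h1)
  · exfalso
    obtain ⟨r, i, hi, hS⟩ := main (fun a b hab hdom => by
      have hle := (dominates_iff.1 hdom).1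
      exact Or.inr (hs.div_mem_or (hle left_mem_planarRing) (hle right_mem_planarRing)
        hab.algebraicIndependent.left_ne_zero hab.algebraicIndependent.right_ne_zero)) h0
    have h1 := hs.ringKrullDim_eq
    have h2 :=
      (isRegularSystem_planarRing (h.pair_div htr r i).algebraicIndependent).ringKrullDim_eq
    rw [← hS, h1] at h2
    norm_num at h2
  · refine ⟨rfl, main (fun a b hab hdom => ?_) h0⟩
    exact eq_or_div_mem (isRegularSystem_planarRing hab.algebraicIndependent) hs hdom
      (fun z hz => hab.exists_fraction_mem le_rfl (hSK hz))

end Dimension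

section Climbing

variable {F : Type} [Field F] {k : Type} [Field k] [Algebra k F] {A S : Subring F}

/-- Monomial extensions of two-dimensional regular local rings. -/
def IsPlanarMonomial (A S : Subring F) : Prop :=
  ∃ X₁ X₂ : A, ∃ Y₁ Y₂ δ₁ δ₂ : S, ∃ a b c d : ℕ, IsRegularSystem ![X₁, X₂] ∧
    IsRegularSystem ![Y₁, Y₂] ∧ IsUnit δ₁ ∧ IsUnit δ₂ ∧ a * d ≠ b * c ∧
    (X₁ : F) = δ₁ * Y₁ ^ a * Y₂ ^ b ∧ (X₂ : F) = δ₂ * Y₁ ^ c * Y₂ ^ d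

lemma isPlanarMonomial_of_isMonomialExtension (h : IsMonomialExtension A S)
    (h2 : ∀ (n : ℕ) (y : Fin n → S), IsRegularSystem y → n = 2) : IsPlanarMonomial A S := by
  obtain ⟨n, hAB, x, y, δ, M, hx, hy, hδ, hM, hxy⟩ := isMonomialExtension_iff.1 h
  obtain rfl := h2 n y hy
  refine ⟨x 0, x 1, y 0, y 1, δ 0, δ 1, M 0 0, M 0 1, M 1 0, M 1 1, hx.pair_ext, hy.pair_ext,
    hδ 0, hδ 1, fun h' => hM ?_, ?_, ?_⟩
  · rw [Matrix.det_fin_two]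
    simp only [Matrix.map_apply]
    rw [sub_eq_zero]
    exact_mod_cast h'
  · have := congrArg Subtype.val (hxy 0)
    simpa [monom, mul_assoc] using this
  · have := congrArg Subtype.val (hxy 1)
    simpa [monom, mul_assoc] using this

lemma IsRegularSystem.le_of_mul_eq {Y₁ Y₂ δ w : S} (hY : IsRegularSystem ![Y₁, Y₂])
    (hδ : IsUnit δ) {a b c d : ℕ} (h : w * (Y₁ ^ c * Y₂ ^ d) = δ * Y₁ ^ a * Y₂ ^ b) :
    c ≤ a ∧ d ≤ b := by
  have key : ∀ {Y₁ Y₂ w : S} {a b c d : ℕ}, IsRegularSystem ![Y₁, Y₂] →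
      w * (Y₁ ^ c * Y₂ ^ d) = δ * Y₁ ^ a * Y₂ ^ b → c ≤ a := by
    intro Y₁ Y₂ w a b c d hY h
    by_contra! hlt
    have hp : Prime Y₁ := hY.prime 0
    have hnd : ¬ Y₁ ∣ Y₂ := hY.not_dvd (i := 0) (j := 1) (by simp)
    obtain ⟨e, rfl⟩ := Nat.exists_eq_add_of_lt hlt
    have h1 : Y₁ ^ a * (Y₁ * (w * Y₁ ^ e * Y₂ ^ d)) = Y₁ ^ a * (δ * Y₂ ^ b) := by
      linear_combination h
    have h2 := mul_left_cancel₀ (pow_ne_zero a hp.ne_zero) h1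
    rcases hp.dvd_or_dvd (Dvd.intro _ h2) with h3 | h3
    · exact hp.not_isUnit (isUnit_of_dvd_unit h3 hδ)
    · exact hnd (hp.dvd_of_dvd_pow h3)
  exact ⟨key hY h, key (a := b) (b := a) (c := d) (d := c) hY.pair_swap (w := w) (by
    linear_combination h)⟩

variable {a b z : F} {c : k}

lemma hasValue_blowup (e : a = b * (algebraMap k F c + z)) : HasValue b z a (0 : k) := by
  have := (hasValue_left (k := k) (a := b) (b := z)).mul
    ((hasValue_algebraMap (a := b) (b := z) c).add hasValue_right)
  rwa [zero_mul, ← e] at this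

lemma planarRing_le_blowup (hab : AlgebraicIndependent k ![a, b])
    (hbz : AlgebraicIndependent k ![b, z]) (e : a = b * (algebraMap k F c + z)) :
    planarRing k a b ≤ planarRing k b z :=
  planarRing_le_of_hasValue hbz hab.left_ne_zero hab.right_ne_zero (hasValue_blowup e) hasValue_left

lemma isRegularSystem_blowup (hab : AlgebraicIndependent k ![a, b])
    (hbz : AlgebraicIndependent k ![b, z]) (hcz : a = b * (algebraMap k F c + z))
    {X₁ X₂ : planarRing k a b} (hX : IsRegularSystem ![X₁, X₂]) {e₀ : k}
    (he : HasValue b z ((X₂ : F) / b) e₀) (he₀ : e₀ ≠ 0)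
    (hw : HasValue b z ((X₁ : F) / X₂) (0 : k)) :
    IsRegularSystem ![(⟨(X₁ : F) / X₂, hw.mem⟩ : planarRing k b z),
      ⟨X₂, planarRing_le_blowup hab hbz hcz X₂.2⟩] := by
  have hle := planarRing_le_blowup hab hbz hcz
  have hA := isRegularSystem_planarRing hab
  have hA1 := isRegularSystem_planarRing hbz
  have hb0 := hab.right_ne_zero
  have := hX.isDomain'
  have hX₁0 : (X₁ : F) ≠ 0 := fun h => hX.ne_zero 0 (Subtype.ext h)
  have hX₂0 : (X₂ : F) ≠ 0 := fun h => hX.ne_zero 1 (Subtype.ext h)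
  obtain ⟨p, q, hpq⟩ := hX.exists_of_not_isUnit (hA.not_isUnit 0)
  obtain ⟨r, s, hrs⟩ := hX.exists_of_not_isUnit (hA.not_isUnit 1)
  replace hpq : a = p * X₁ + q * X₂ := congrArg Subtype.val hpq
  replace hrs : b = r * X₁ + s * X₂ := congrArg Subtype.val hrs
  set w := (X₁ : F) / X₂ with hwdef
  set e := (X₂ : F) / b with hedef
  have hX₂ : (X₂ : F) = e * b := by rw [hedef]; field_simp
  have hX₁ : (X₁ : F) = w * e * b := by rw [mul_assoc, ← hX₂, hwdef]; field_simp
  have h1 : algebraMap k F c + z = (p * w + q) * e := by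
    apply mul_left_cancel₀ hb0
    rw [← hcz]
    nth_rw 1 [hpq]
    rw [hX₁, hX₂]
    ring
  have h2 : 1 = (r * w + s) * e := by
    apply mul_left_cancel₀ hb0
    rw [mul_one]
    nth_rw 1 [hrs]
    rw [hX₁, hX₂]
    ring
  obtain ⟨d, α, hα, β, hβ, hd⟩ := HasValue.exists_of_mem hab
    (sub_mem q.2 (mul_mem (algebraMap_mem_planarRing c) s.2))
  set η : F := α * (algebraMap k F c + z) + β with hη
  have hcm : algebraMap k F c ∈ planarRing k b z := algebraMap_mem_planarRing c
  have hηm : η ∈ planarRing k b z :=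
    add_mem (mul_mem (hle hα) (add_mem hcm right_mem_planarRing)) (hle hβ)
  have hpm : (p - algebraMap k F c * r) * e ∈ planarRing k b z :=
    mul_mem (sub_mem (hle p.2) (mul_mem hcm (hle r.2))) he.mem
  have hz : z = (p - algebraMap k F c * r) * e * w + (algebraMap k F d * e + η * e * b) := by
    have hd' : (q : F) - algebraMap k F c * s = algebraMap k F d + η * b := by
      rw [hd, hη, hcz]
      ring
    linear_combination h1 - algebraMap k F c * h2 + e * hd'
  have hd0 : d = 0 := by
    have h3 := (((hasValue_right (k := k) (a := b) (b := z)).sub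
      (HasValue.mem_zero hpm hw)).sub (HasValue.mem_zero (mul_mem hηm he.mem) hasValue_left))
    have h4 := (hasValue_algebraMap (a := b) (b := z) d).mul he
    have h5 : algebraMap k F d * e = z - (p - algebraMap k F c * r) * e * w - η * e * b := by
      linear_combination -hz
    rw [h5] at h4
    have := h4.unique hbz h3
    simpa [he₀] using this
  refine hA1.of_pair ?_ ?_ ⟨0, ⟨e⁻¹, (he.inv hbz he₀).mem⟩, Subtype.ext ?_⟩
    ⟨⟨_, hpm⟩, ⟨η, hηm⟩, Subtype.ext ?_⟩
  · exact (hw.isNonunit hbz (div_ne_zero hX₁0 hX₂0)).not_isUnit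
  · have h3 := HasValue.mem_zero he.mem (hasValue_left (k := k) (a := b) (b := z))
    rw [← hX₂] at h3
    exact (h3.isNonunit hbz hX₂0).not_isUnit
  · change b = 0 * w + e⁻¹ * X₂
    have : e ≠ 0 := he.ne_zero hbz he₀
    rw [hX₂]
    field_simp
    ring
  · change z = (p - algebraMap k F c * r) * e * w + η * X₂
    rw [hX₂]
    nth_rw 1 [hz]
    rw [hd0, map_zero]
    ring

/-- Monomiality is preserved by quadratic transforms of the source. -/
lemma IsPlanarMonomial.blowup (hab : AlgebraicIndependent k ![a, b])
    (hbz : AlgebraicIndependent k ![b, z]) (hcz : a = b * (algebraMap k F c + z))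
    (hS : Dominates S (planarRing k b z)) (h : IsPlanarMonomial (planarRing k a b) S) :
    IsPlanarMonomial (planarRing k b z) S := by
  have hle := planarRing_le_blowup hab hbz hcz
  have hA := isRegularSystem_planarRing hab
  have hleS := (dominates_iff.1 hS).1
  have hb0 := hab.right_ne_zero
  have core : ∀ X₁ X₂ : planarRing k a b, ∀ Y₁ Y₂ δ₁ δ₂ : S, ∀ l m n o : ℕ,
      IsRegularSystem ![X₁, X₂] → IsRegularSystem ![Y₁, Y₂] → IsUnit δ₁ → IsUnit δ₂ →
      l * o ≠ m * n → (X₁ : F) = δ₁ * Y₁ ^ l * Y₂ ^ m → (X₂ : F) = δ₂ * Y₁ ^ n * Y₂ ^ o →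
      (∃ e₀ ≠ 0, HasValue b z ((X₂ : F) / b) (e₀ : k)) → (X₁ : F) / b ∈ planarRing k b z →
      IsPlanarMonomial (planarRing k b z) S := by
    rintro X₁ X₂ Y₁ Y₂ δ₁ δ₂ l m n o hX hY hδ₁ hδ₂ hdet hX₁ hX₂ ⟨e₀, he₀, he⟩ hm
    have hX₁0 : (X₁ : F) ≠ 0 := fun h => hX.ne_zero 0 (Subtype.ext h)
    have hX₂0 : (X₂ : F) ≠ 0 := fun h => hX.ne_zero 1 (Subtype.ext h)
    have hwm : (X₁ : F) / X₂ ∈ planarRing k b z := by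
      have : (X₁ : F) / X₂ = X₁ / b * (X₂ / b)⁻¹ := by field_simp
      rw [this]
      exact mul_mem hm (he.inv hbz he₀).mem
    have := hY.isDomain'
    obtain ⟨δ₁', hδ₁'⟩ := hδ₁.exists_right_inv
    obtain ⟨δ₂', hδ₂'⟩ := hδ₂.exists_right_inv
    have hδ₁'' : (δ₁ : F) * δ₁' = 1 := congrArg Subtype.val hδ₁'
    have hδ₂'' : (δ₂ : F) * δ₂' = 1 := congrArg Subtype.val hδ₂'
    have hww : (X₁ : F) = X₁ / X₂ * X₂ := by field_simp
    have hlm : n ≤ l ∧ o ≤ m := by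
      refine hY.le_of_mul_eq (w := ⟨(X₁ : F) / X₂, hleS hwm⟩ * δ₂) hδ₁ (Subtype.ext ?_)
      push_cast
      rw [← hX₁, hww, hX₂]
      field_simp
    obtain ⟨w₀, hw₀⟩ := HasValue.exists_of_mem hbz hwm
    have hw0 : w₀ = 0 := by
      by_contra hw0
      have hinv := hleS (hw₀.inv hbz hw0).mem
      have hml : l ≤ n ∧ m ≤ o := by
        refine hY.le_of_mul_eq (w := ⟨_, hinv⟩ * δ₁) hδ₂ (Subtype.ext ?_)
        push_cast
        rw [← hX₂, inv_div, mul_assoc, ← mul_assoc (δ₁ : F), ← hX₁]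
        field_simp
      apply hdet
      rw [le_antisymm hlm.1 hml.1, le_antisymm hlm.2 hml.2, mul_comm]
    rw [hw0] at hw₀
    obtain ⟨l, rfl⟩ := Nat.exists_eq_add_of_le hlm.1
    obtain ⟨m, rfl⟩ := Nat.exists_eq_add_of_le hlm.2
    refine ⟨_, _, Y₁, Y₂, δ₁ * δ₂', δ₂, l, m, n, o,
      isRegularSystem_blowup hab hbz hcz hX he he₀ hw₀, hY,
      hδ₁.mul (IsUnit.of_mul_eq_one _ (by rw [mul_comm]; exact hδ₂')), hδ₂,
      fun h' => hdet ?_, ?_, hX₂⟩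
    · linear_combination h'
    · change (X₁ : F) / X₂ = _
      rw [div_eq_iff hX₂0, hX₁, hX₂]
      push_cast
      linear_combination (-δ₁ * Y₁ ^ (n + l) * Y₂ ^ (o + m) : F) * hδ₂''
  obtain ⟨X₁, X₂, Y₁, Y₂, δ₁, δ₂, l, m, n, o, hX, hY, hδ₁, hδ₂, hdet, hX₁, hX₂⟩ := h
  have hdiv : ∀ X : planarRing k a b, ¬ IsUnit X → (X : F) / b ∈ planarRing k b z := by
    intro X hX
    obtain ⟨α, β, hαβ⟩ := hA.exists_of_not_isUnit hX
    have h1 : (X : F) = α * a + β * b := congrArg Subtype.val hαβ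
    have h2 : (X : F) / b = α * (algebraMap k F c + z) + β := by
      rw [div_eq_iff hb0]
      linear_combination h1 + (α : F) * hcz
    rw [h2]
    exact add_mem (mul_mem (hle α.2) (add_mem (algebraMap_mem_planarRing c) right_mem_planarRing))
      (hle β.2)
  have hm₁ := hdiv X₁ (hX.not_isUnit 0)
  have hm₂ := hdiv X₂ (hX.not_isUnit 1)
  obtain ⟨e₁, he₁⟩ := HasValue.exists_of_mem hbz hm₁
  obtain ⟨e₂, he₂⟩ := HasValue.exists_of_mem hbz hm₂
  by_cases h₂ : e₂ = 0
  · by_cases h₁ : e₁ = 0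
    · exfalso
      rw [h₁] at he₁
      rw [h₂] at he₂
      obtain ⟨r, s, hrs⟩ := hX.exists_of_not_isUnit (hA.not_isUnit 1)
      have hrs' : b = r * X₁ + s * X₂ := congrArg Subtype.val hrs
      have h1 : (1 : F) = r * (X₁ / b) + s * (X₂ / b) := by
        field_simp
        exact hrs'
      have h3 := (HasValue.mem_zero (hle r.2) he₁).add (HasValue.mem_zero (hle s.2) he₂)
      rw [← h1] at h3
      have := h3.unique hbz hasValue_one
      simp at this
    · exact core X₂ X₁ Y₁ Y₂ δ₂ δ₁ n o l m hX.pair_swap hY hδ₂ hδ₁ (fun h' => hdet (by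
        linear_combination -h')) hX₂ hX₁ ⟨e₁, h₁, he₁⟩ hm₂
  · exact core X₁ X₂ Y₁ Y₂ δ₁ δ₂ l m n o hX hY hδ₁ hδ₂ hdet hX₁ hX₂ ⟨e₂, h₂, he₂⟩ hm₁

end Climbing

section NormalForm

variable {R : Type*} [CommRing R] {Z T X u : R} {i p : ℕ}

namespace IsRegularSystem

lemma isUnit_of_eq_add {a b a' : R} (h : IsRegularSystem ![a, b]) (h' : IsRegularSystem ![a', b])
    {α β : R} (e : a' = α * a + β * b) : IsUnit α := by
  by_contra hα
  have := h.isLocalRing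
  obtain ⟨r, s, hrs⟩ := h'.exists_of_not_isUnit hα
  have h1 : IsUnit (1 - r * a) := by
    have h2 : r * a ∈ IsLocalRing.maximalIdeal R :=
      Ideal.mul_mem_left _ _ ((IsLocalRing.mem_maximalIdeal _).2 (h.not_isUnit 0))
    by_contra h3
    have h4 := add_mem ((IsLocalRing.mem_maximalIdeal _).2 h3) h2
    rw [sub_add_cancel] at h4
    exact (IsLocalRing.mem_maximalIdeal _).1 h4 isUnit_one
  have h5 : b ∣ a' * (1 - r * a) := ⟨s * a + β, by linear_combination e + a * hrs⟩
  exact h'.not_dvd (i := 1) (j := 0) (by simp) (h1.dvd_mul_right.1 h5)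

lemma left_prime (h : IsRegularSystem ![Z, T]) : Prime Z := h.prime 0

lemma right_prime (h : IsRegularSystem ![Z, T]) : Prime T := h.prime 1

lemma not_dvd_left (h : IsRegularSystem ![Z, T]) : ¬ T ∣ Z := h.not_dvd (i := 1) (j := 0) (by simp)

lemma not_dvd_right (h : IsRegularSystem ![Z, T]) : ¬ Z ∣ T := h.not_dvd (i := 0) (j := 1) (by simp)

lemma mem_span_of_mul_mem (h : IsRegularSystem ![Z, T]) (hX : X = Z ^ i * T) {N l : ℕ} {e r s : R}
    (hN : i * l + 2 ≤ N) (he : e * X ^ l = r * X ^ (l + 1) + s * Z ^ N) :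
    e ∈ Ideal.span {T, Z ^ 2} := by
  have := h.isDomain'
  have hT := h.right_prime
  have hTs : T ^ l ∣ s * Z ^ N := ⟨Z ^ (i * l) * (e - r * X), by
    have : X ^ l = Z ^ (i * l) * T ^ l := by rw [hX, mul_pow, ← pow_mul]
    rw [pow_succ, this] at he
    linear_combination -he⟩
  obtain ⟨s', rfl⟩ := hT.pow_dvd_of_dvd_mul_right l (fun h' => h.not_dvd_left
    (hT.dvd_of_dvd_pow h')) hTs
  obtain ⟨d, rfl⟩ := Nat.exists_eq_add_of_le hN
  have h1 : Z ^ (i * l) * T ^ l * (e - r * X) = Z ^ (i * l) * T ^ l * (s' * Z ^ (2 + d)) := by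
    have : X ^ l = Z ^ (i * l) * T ^ l := by rw [hX, mul_pow, ← pow_mul]
    rw [pow_succ, this] at he
    rw [add_assoc, pow_add Z (i * l)] at he
    linear_combination he
  have h2 := mul_left_cancel₀ (mul_ne_zero (pow_ne_zero _ h.left_prime.ne_zero)
    (pow_ne_zero _ hT.ne_zero)) h1
  rw [Ideal.mem_span_pair]
  exact ⟨r * Z ^ i, s' * Z ^ d, by rw [pow_add, hX] at h2; linear_combination -h2⟩

lemma span_ne_top (h : IsRegularSystem ![Z, T]) : Ideal.span {T, Z ^ 2} ≠ ⊤ := by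
  have := h.isLocalRing
  refine fun h' => (IsLocalRing.maximalIdeal.isMaximal R).ne_top (top_le_iff.1 (h' ▸ ?_))
  rw [Ideal.span_le]
  rintro w (rfl | rfl)
  · exact (IsLocalRing.mem_maximalIdeal _).2 (h.not_isUnit 1)
  · exact Ideal.pow_mem_of_mem _ ((IsLocalRing.mem_maximalIdeal _).2 (h.not_isUnit 0)) _ two_pos

lemma pow_dvd_of_eq_monomial (h : IsRegularSystem ![Z, T]) (hX : X = Z ^ i * T) {γ μ δ b' : R}
    {N a b : ℕ} (hi : i ≤ N) (hp : p ≠ 0) (hδ : IsUnit δ) (hμ : IsUnit μ)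
    (hu : u = γ * X ^ p - μ * Z ^ N) (he : u + b' * X = δ * Z ^ a * T ^ b) :
    Z ^ (N - i) ∣ γ * X ^ (p - 1) + b' := by
  have := h.isDomain'
  have := h.isLocalRing
  have hT := h.right_prime
  have hZ := h.left_prime
  obtain ⟨q, rfl⟩ := Nat.exists_eq_succ_of_ne_zero hp
  have hTX : T ∣ X := ⟨Z ^ i, by rw [hX, mul_comm]⟩
  have hTe : T ∣ δ * Z ^ a * T ^ b + μ * Z ^ N := by
    rw [← he, hu]
    have : γ * X ^ (q + 1) - μ * Z ^ N + b' * X + μ * Z ^ N = X * (γ * X ^ q + b') := by ring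
    rw [this]
    exact hTX.mul_right _
  have hb : b = 0 := by
    by_contra hb
    have h1 : T ∣ μ * Z ^ N := (dvd_add_right ((dvd_pow_self T hb).mul_left _)).1 hTe
    exact h.not_dvd_left (hT.dvd_of_dvd_pow (hμ.dvd_mul_left.1 h1))
  have ha : N ≤ a := by
    by_contra! ha
    obtain ⟨d, rfl⟩ := Nat.exists_eq_add_of_lt ha
    have h1 : δ * Z ^ a * T ^ b + μ * Z ^ (a + d + 1) = Z ^ a * (δ + μ * Z ^ d * Z) := by
      rw [hb]
      ring
    rw [h1] at hTe
    rcases hT.dvd_or_dvd hTe with h2 | h2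
    · exact h.not_dvd_left (hT.dvd_of_dvd_pow h2)
    · have h3 : δ + μ * Z ^ d * Z ∈ IsLocalRing.maximalIdeal R :=
        Ideal.mem_of_dvd _ h2 ((IsLocalRing.mem_maximalIdeal _).2 hT.not_isUnit)
      have h4 : μ * Z ^ d * Z ∈ IsLocalRing.maximalIdeal R :=
        Ideal.mul_mem_left _ _ ((IsLocalRing.mem_maximalIdeal _).2 hZ.not_isUnit)
      exact (IsLocalRing.mem_maximalIdeal _).1 ((Ideal.add_mem_iff_left _ h4).1 h3) hδ
  obtain ⟨d, rfl⟩ := Nat.exists_eq_add_of_le ha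
  obtain ⟨M, rfl⟩ := Nat.exists_eq_add_of_le hi
  rw [Nat.add_sub_cancel_left, Nat.succ_sub_one]
  have h1 : Z ^ i * (T * (γ * X ^ q + b')) = Z ^ i * (Z ^ M * (δ * Z ^ d + μ)) := by
    rw [hu, hb, pow_succ] at he
    nth_rw 2 3 [hX] at he
    linear_combination he
  have h2 := mul_left_cancel₀ (pow_ne_zero i hZ.ne_zero) h1
  exact hZ.pow_dvd_of_dvd_mul_left M h.not_dvd_right ⟨_, h2⟩

lemma exists_add_mem_span {k : Type*} [Field k] (κ : k →+* R) (h : IsRegularSystem ![Z, T])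
    (hX : X = Z ^ i * T) {A : Set R}
    (hA : ∀ b ∈ A, ∃ c : k, ∃ b₁ ∈ A, ∃ b₂ : R, b = κ c + b₁ * X + b₂ * u)
    {γ μ b' : R} {N : ℕ} (hN : i * (p - 1) + 2 ≤ N) (hp : p ≠ 0) (hu : u = γ * X ^ p - μ * Z ^ N)
    (hb' : b' ∈ A) (hdvd : Z ^ N ∣ γ * X ^ (p - 1) + b') :
    ∃ c : k, γ + κ c ∈ Ideal.span {T, Z ^ 2} := by
  obtain ⟨q, rfl⟩ := Nat.exists_eq_succ_of_ne_zero hp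
  rw [Nat.succ_sub_one] at hN hdvd
  rw [Nat.succ_eq_add_one] at hu
  have key : ∀ l ≤ q, ∃ b ∈ A, ∃ r s, γ * X ^ q + b * X ^ l = r * X ^ (q + 1) + s * Z ^ N := by
    intro l
    induction l with
    | zero =>
      intro _
      obtain ⟨s, hs⟩ := hdvd
      exact ⟨b', hb', 0, s, by linear_combination hs⟩
    | succ l ih =>
      intro hl
      obtain ⟨b, hb, r, s, hrs⟩ := ih (by lia)
      obtain ⟨c, b₁, hb₁, b₂, rfl⟩ := hA b hb
      obtain ⟨d, rfl⟩ := Nat.exists_eq_add_of_le hl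
      have hc : κ c ∈ Ideal.span {T, Z ^ 2} := by
        have hNl : i * l + 2 ≤ N :=
          le_trans (Nat.add_le_add_right (Nat.mul_le_mul_left i (by lia)) 2) hN
        refine h.mem_span_of_mul_mem hX (l := l)
          (r := r * X ^ (d + 1) - γ * X ^ d - b₁ - b₂ * γ * X ^ (l + 1 + d))
          (s := s + b₂ * μ * X ^ l) hNl ?_
        linear_combination hrs - b₂ * X ^ l * hu
      have hc0 : c = 0 := by
        by_contra hc0
        exact h.span_ne_top (Ideal.eq_top_of_isUnit_mem _ hc ((IsUnit.mk0 c hc0).map κ))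
      refine ⟨b₁, hb₁, r - b₂ * γ * X ^ l, s + b₂ * μ * X ^ l, ?_⟩
      rw [hc0, map_zero] at hrs
      linear_combination hrs - b₂ * X ^ l * hu
  obtain ⟨b, hb, r, s, hrs⟩ := key q le_rfl
  obtain ⟨c, b₁, hb₁, b₂, rfl⟩ := hA b hb
  refine ⟨c, h.mem_span_of_mul_mem hX (l := q) (r := r - b₁ - b₂ * γ * X ^ q)
    (s := s + b₂ * μ * X ^ q) hN ?_⟩
  linear_combination hrs - b₂ * X ^ q * hu

end IsRegularSystem

end NormalForm

section NonMonomial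

variable {R : Type*} [CommRing R] {k : Type*} [Field k] {κ : k →+* R} {y t x X u γ γ₁ l τ α β : R}
  {γ₀ κ₀ τ₀ : k} {i p : ℕ}

namespace IsRegularSystem

lemma pair_linear (h : IsRegularSystem ![y, t]) (hip : i < p) (hτ : IsUnit τ) :
    IsRegularSystem ![y, l * y ^ (p - i) + τ * t] := by
  have := h.isLocalRing
  obtain ⟨τ', hτ'⟩ := hτ.exists_right_inv
  have he : y ^ (p - i) = y ^ (p - i - 1) * y := by rw [← pow_succ, Nat.sub_add_cancel (by lia)]
  refine h.of_pair (h.not_isUnit 0) ?_ ⟨1, 0, by ring⟩ ⟨-(τ' * l * y ^ (p - i - 1)), τ', ?_⟩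
  · rw [he]
    refine (IsLocalRing.mem_maximalIdeal _).1 (add_mem ?_ ?_)
    · exact Ideal.mul_mem_left _ _ (Ideal.mul_mem_left _ _
        ((IsLocalRing.mem_maximalIdeal _).2 (h.not_isUnit 0)))
    · exact Ideal.mul_mem_left _ _ ((IsLocalRing.mem_maximalIdeal _).2 (h.not_isUnit 1))
  · rw [he]
    linear_combination -t * hτ'

lemma add_not_mem_span [Fact p.Prime] [CharP R p] (h : IsRegularSystem ![y, t]) (hip : i < p)
    (hx : x = y ^ i * t) (hκ₀ : κ₀ ≠ 0)
    (hγ : γ = κ γ₀ + κ κ₀ * y + γ₁ * x) (hτ : τ = κ τ₀ + α * x + β * y) {τ' : R}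
    (hτ' : τ * τ' = 1) (c : k) :
    γ * τ' ^ p + κ c ∉ Ideal.span {l * y ^ (p - i) + τ * t, y ^ 2} := by
  intro hmem
  have hp := (Fact.out : p.Prime).two_le
  have hreg := h.pair_linear (l := l) hip (IsUnit.of_mul_eq_one _ hτ')
  have := h.isLocalRing
  set T := l * y ^ (p - i) + τ * t with hT
  set I := Ideal.span {T, y ^ 2} with hI
  have hTI : T ∈ I := Ideal.subset_span (by simp)
  have hyI : y ^ 2 ∈ I := Ideal.subset_span (by simp)
  have hypI : y ^ p ∈ I := Ideal.mem_of_dvd _ (pow_dvd_pow y hp) hyI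
  have hxI : x ∈ I := by
    have : x = τ' * y ^ i * T - τ' * l * y ^ p := by
      have he : y ^ p = y ^ i * y ^ (p - i) := by rw [← pow_add, Nat.add_sub_cancel' hip.le]
      rw [he, hx, hT]
      linear_combination -t * y ^ i * hτ'
    rw [this]
    exact sub_mem (Ideal.mul_mem_left _ _ hTI) (Ideal.mul_mem_left _ _ hypI)
  have hxpI : x ^ p ∈ I := Ideal.pow_mem_of_mem _ hxI _ (by lia)
  have hτp : τ ^ p = κ (τ₀ ^ p) + α ^ p * x ^ p + β ^ p * y ^ p := by
    rw [hτ, add_pow_char, add_pow_char, mul_pow, mul_pow, map_pow]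
  have h1 : κ (γ₀ + c * τ₀ ^ p) + κ κ₀ * y ∈ I := by
    have h2 : κ (γ₀ + c * τ₀ ^ p) + κ κ₀ * y = τ ^ p * (γ * τ' ^ p + κ c)
        - γ₁ * x - κ c * α ^ p * x ^ p - κ c * β ^ p * y ^ p := by
      have h3 : τ ^ p * τ' ^ p = 1 := by rw [← mul_pow, hτ', one_pow]
      rw [map_add, map_mul]
      linear_combination -γ * h3 - hγ - κ c * hτp
    rw [h2]
    exact sub_mem (sub_mem (sub_mem (Ideal.mul_mem_left _ _ hmem) (Ideal.mul_mem_left _ _ hxI))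
      (Ideal.mul_mem_left _ _ hxpI)) (Ideal.mul_mem_left _ _ hypI)
  have hym : y ∈ IsLocalRing.maximalIdeal R := (IsLocalRing.mem_maximalIdeal _).2 (h.not_isUnit 0)
  have hIm : I ≤ IsLocalRing.maximalIdeal R := IsLocalRing.le_maximalIdeal hreg.span_ne_top
  have hd : γ₀ + c * τ₀ ^ p = 0 := by
    by_contra hd
    have h2 := (Ideal.add_mem_iff_left _ (Ideal.mul_mem_left _ (κ κ₀) hym)).1 (hIm h1)
    exact (IsLocalRing.mem_maximalIdeal _).1 h2 ((IsUnit.mk0 _ hd).map κ)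
  rw [hd, map_zero, zero_add, hI, Ideal.mem_span_pair] at h1
  obtain ⟨r, s, hrs⟩ := h1
  have h3 : T ∣ y * (κ κ₀ - s * y) := ⟨r, by linear_combination -hrs⟩
  rcases hreg.right_prime.dvd_or_dvd h3 with h4 | h4
  · exact hreg.not_dvd_left h4
  · have h5 : κ κ₀ - s * y ∈ IsLocalRing.maximalIdeal R := Ideal.mem_of_dvd _ h4 (hIm hTI)
    have h6 := add_mem h5 (Ideal.mul_mem_left _ s hym)
    rw [sub_add_cancel] at h6
    exact (IsLocalRing.mem_maximalIdeal _).1 h6 ((IsUnit.mk0 _ hκ₀).map κ)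

/-- The extension given by `u = γ x ^ p` and `X = l y ^ p + τ x` has no monomial form. -/
lemma not_monomial_form [Fact p.Prime] [CharP R p] (h : IsRegularSystem ![y, t]) (hip : i < p)
    (hx : x = y ^ i * t) (hκ₀ : κ₀ ≠ 0) (hγu : IsUnit γ) (hl : IsUnit l) (hτu : IsUnit τ)
    (hγ : γ = κ γ₀ + κ κ₀ * y + γ₁ * x) (hτ : τ = κ τ₀ + α * x + β * y)
    (hu : u = γ * x ^ p) (hX : X = l * y ^ p + τ * x) {A : Set R}
    (hA : ∀ b ∈ A, ∃ c : k, ∃ b₁ ∈ A, ∃ b₂ : R, b = κ c + b₁ * X + b₂ * u)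
    {Y₁ Y₂ δ₁ δ₂ b' : R} {a b c d : ℕ} (hY : IsRegularSystem ![Y₁, Y₂]) (hδ₁ : IsUnit δ₁)
    (hδ₂ : IsUnit δ₂) (hb' : b' ∈ A) (hX₁ : u + b' * X = δ₁ * Y₁ ^ a * Y₂ ^ b)
    (hX₂ : X = δ₂ * Y₁ ^ c * Y₂ ^ d) : False := by
  have hdom := h.isDomain'
  have hp := (Fact.out : p.Prime).two_le
  obtain ⟨τ', hτ'⟩ := hτu.exists_right_inv
  have hreg := h.pair_linear (l := l) hip hτu
  have hnot := h.add_not_mem_span (l := l) hip hx hκ₀ hγ hτ hτ'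
  set T := l * y ^ (p - i) + τ * t with hT
  have hXT : X = y ^ i * T := by
    have he : y ^ p = y ^ i * y ^ (p - i) := by rw [← pow_add, Nat.add_sub_cancel' hip.le]
    rw [hX, he, hx, hT]
    ring
  set γ' := γ * τ' ^ p with hγ'
  set μ := γ' * l ^ p with hμ
  have hμu : IsUnit μ :=
    (hγu.mul ((IsUnit.of_mul_eq_one τ (by rw [mul_comm]; exact hτ')).pow p)).mul
    (hl.pow p)
  have huX : u = γ' * X ^ p - μ * y ^ p ^ 2 := by
    have h3 : τ ^ p * τ' ^ p = 1 := by rw [← mul_pow, hτ', one_pow]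
    have h4 : X ^ p = l ^ p * y ^ p ^ 2 + τ ^ p * x ^ p := by
      rw [hX, add_pow_char, mul_pow, mul_pow, ← pow_mul, sq]
    rw [h4, hμ, hγ', hu]
    linear_combination -γ * x ^ p * h3
  have hN : i * (p - 1) + 2 ≤ p ^ 2 - i := by
    obtain ⟨q, rfl⟩ : ∃ q, p = i + 1 + q := ⟨p - (i + 1), by lia⟩
    rw [Nat.le_sub_iff_add_le (by nlinarith)]
    have : i + 1 + q - 1 = i + q := by lia
    rw [this]
    nlinarith
  have core : ∀ (Y₁ Y₂ : R) (a b c d : ℕ), IsRegularSystem ![Y₁, Y₂] →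
      u + b' * X = δ₁ * Y₁ ^ a * Y₂ ^ b → X = δ₂ * Y₁ ^ c * Y₂ ^ d → T ∣ Y₂ → False := by
    intro Y₁ Y₂ a b c d hY hX₁ hX₂ hTY
    obtain ⟨ε₂, hε₂, rfl⟩ : ∃ ε₂, IsUnit ε₂ ∧ Y₂ = T * ε₂ := by
      obtain ⟨ε, hε⟩ := hTY
      refine ⟨ε, ?_, hε⟩
      rcases hY.right_prime.irreducible.isUnit_or_isUnit hε with h1 | h1
      · exact absurd h1 hreg.right_prime.not_isUnit
      · exact h1
    by_cases hi : i = 0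
    · subst hi
      obtain ⟨ε₂', hε₂'⟩ := hε₂.exists_right_inv
      have hreg' : IsRegularSystem ![Y₁, T] := hY.of_pair (hY.not_isUnit 0) (hreg.not_isUnit 1)
        ⟨1, 0, by ring⟩ ⟨0, ε₂, by ring⟩
      obtain ⟨ε, η, hεη⟩ := hreg'.exists_of_not_isUnit (hreg.not_isUnit 0)
      replace hεη : y = ε * Y₁ + η * T := hεη
      have hε := hreg'.isUnit_of_eq_add hreg hεη
      have hXT' : X = T := by rw [hXT, pow_zero, one_mul]
      have hyp : y ^ p ^ 2 = ε ^ p ^ 2 * Y₁ ^ p ^ 2 + η ^ p ^ 2 * T ^ (p ^ 2 - p) * T ^ p := by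
        rw [hεη, add_pow_char_pow, mul_pow, mul_pow, mul_assoc (η ^ p ^ 2), ← pow_add,
          Nat.sub_add_cancel (by nlinarith)]
      have huY : u =
          (γ' - μ * η ^ p ^ 2 * T ^ (p ^ 2 - p)) * X ^ p - μ * ε ^ p ^ 2 * Y₁ ^ p ^ 2 := by
        rw [huX, hyp, hXT']
        ring
      have hd := hreg'.pow_dvd_of_eq_monomial (i := 0) (X := X) (by rw [pow_zero, one_mul, hXT'])
        (Nat.zero_le _) (by lia) (δ := δ₁ * ε₂ ^ b) (hδ₁.mul (hε₂.pow b)) (hμu.mul (hε.pow _)) huY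
        (b' := b') (a := a) (b := b) (by rw [hX₁, mul_pow]; ring)
      obtain ⟨e, he⟩ := hreg'.exists_add_mem_span κ (i := 0) (X := X)
        (by rw [pow_zero, one_mul, hXT']) hA (N := p ^ 2) (by nlinarith) (by lia) huY hb' hd
      refine hnot e ?_
      have hTI : T ∈ Ideal.span {T, y ^ 2} := Ideal.subset_span (by simp)
      have hle : Ideal.span {T, Y₁ ^ 2} ≤ Ideal.span {T, y ^ 2} := by
        rw [Ideal.span_le]
        rintro w (rfl | rfl)
        · exact hTI
        · obtain ⟨ε', hε'⟩ := hε.exists_right_inv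
          refine Ideal.mem_span_pair.2 ⟨ε' ^ 2 * (η ^ 2 * T - 2 * y * η), ε' ^ 2, ?_⟩
          have : ε' * (y - η * T) = Y₁ := by
            rw [hεη]
            linear_combination Y₁ * hε'
          rw [← this]
          ring
      have he' := hle he
      have hsum := add_mem he' (Ideal.mul_mem_left _ (μ * η ^ p ^ 2 * T ^ (p ^ 2 - p - 1)) hTI)
      have hpp : 1 ≤ p ^ 2 - p := by
        rw [Nat.le_sub_iff_add_le (by nlinarith)]
        nlinarith
      convert hsum using 1
      nth_rw 1 [← Nat.sub_add_cancel hpp]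
      rw [pow_succ]
      ring
    · have hyY : y ∣ Y₁ := by
        have h1 : y ∣ δ₂ * Y₁ ^ c * (T * ε₂) ^ d := by
          rw [← hX₂, hXT]
          exact (dvd_pow_self y hi).mul_right _
        have hy := hreg.left_prime
        rcases hy.dvd_or_dvd h1 with h2 | h2
        · exact hy.dvd_of_dvd_pow (hδ₂.dvd_mul_left.1 h2)
        · exact absurd (hε₂.dvd_mul_right.1 (hy.dvd_of_dvd_pow h2)) hreg.not_dvd_right
      obtain ⟨ε₁, hε₁, rfl⟩ : ∃ ε₁, IsUnit ε₁ ∧ Y₁ = y * ε₁ := by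
        obtain ⟨ε, hε⟩ := hyY
        refine ⟨ε, ?_, hε⟩
        rcases hY.left_prime.irreducible.isUnit_or_isUnit hε with h1 | h1
        · exact absurd h1 hreg.left_prime.not_isUnit
        · exact h1
      have hi2 : i ≤ p ^ 2 := by nlinarith
      have hd := hreg.pow_dvd_of_eq_monomial hXT hi2 (by lia) (δ := δ₁ * ε₁ ^ a * ε₂ ^ b)
        ((hδ₁.mul (hε₁.pow a)).mul (hε₂.pow b)) hμu huX (b' := b') (a := a) (b := b)
        (by rw [hX₁, mul_pow, mul_pow]; ring)
      obtain ⟨e, he⟩ := hreg.exists_add_mem_span κ hXT hA hN (by lia) (γ := γ') (μ := μ * y ^ i)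
        (by rw [mul_assoc μ, ← pow_add, Nat.add_sub_cancel' hi2]; exact huX) hb' hd
      exact hnot e he
  have hT' := hreg.right_prime
  have h1 : T ∣ δ₂ * Y₁ ^ c * Y₂ ^ d := by
    rw [← hX₂, hXT]
    exact dvd_mul_left _ _
  rcases hT'.dvd_or_dvd h1 with h2 | h2
  · exact core Y₂ Y₁ b a d c hY.pair_swap (by rw [hX₁]; ring) (by rw [hX₂]; ring)
      (hT'.dvd_of_dvd_pow (hδ₂.dvd_mul_left.1 h2))
  · exact core Y₁ Y₂ a b c d hY hX₁ hX₂ (hT'.dvd_of_dvd_pow h2)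

end IsRegularSystem

end NonMonomial

section PlanarNonMonomial

namespace IsRegularSystem

variable {R : Type*} [CommRing R] {u v X₁ X₂ : R}

lemma exists_isUnit_coefficient (h : IsRegularSystem ![u, v]) (h' : IsRegularSystem ![X₁, X₂]) :
    (∃ α β, IsUnit β ∧ X₁ = α * u + β * v) ∨ ∃ α β, IsUnit β ∧ X₂ = α * u + β * v := by
  have := h.isLocalRing
  obtain ⟨α₁, β₁, h₁⟩ := h.exists_of_not_isUnit (h'.not_isUnit 0)
  obtain ⟨α₂, β₂, h₂⟩ := h.exists_of_not_isUnit (h'.not_isUnit 1)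
  by_contra! hcon
  have hβ₁ : ¬ IsUnit β₁ := fun h3 => hcon.1 α₁ β₁ h3 h₁
  have hβ₂ : ¬ IsUnit β₂ := fun h3 => hcon.2 α₂ β₂ h3 h₂
  obtain ⟨e, f, hv⟩ := h'.exists_of_not_isUnit (h.not_isUnit 1)
  have hv' : v = e * X₁ + f * X₂ := hv
  have h₁' : X₁ = α₁ * u + β₁ * v := h₁
  have h₂' : X₂ = α₂ * u + β₂ * v := h₂
  have h3 : IsUnit (1 - (e * β₁ + f * β₂)) := by
    by_contra h4
    have h5 := add_mem ((IsLocalRing.mem_maximalIdeal _).2 h4)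
      (add_mem (Ideal.mul_mem_left _ e ((IsLocalRing.mem_maximalIdeal _).2 hβ₁))
        (Ideal.mul_mem_left _ f ((IsLocalRing.mem_maximalIdeal _).2 hβ₂)))
    rw [sub_add_cancel] at h5
    exact (IsLocalRing.mem_maximalIdeal _).1 h5 isUnit_one
  have h4 : u ∣ v * (1 - (e * β₁ + f * β₂)) :=
    ⟨e * α₁ + f * α₂, by linear_combination hv' + e * h₁' + f * h₂'⟩
  exact h.not_dvd_right (h3.dvd_mul_right.1 h4)

lemma exists_isUnit_mul_add (h : IsRegularSystem ![u, v]) (h' : IsRegularSystem ![X₁, X₂])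
    {α β : R} (hβ : IsUnit β) (e : X₂ = α * u + β * v) :
    IsRegularSystem ![u, X₂] ∧ ∃ η b', IsUnit η ∧ u + b' * X₂ = η * X₁ := by
  have := h.isLocalRing
  obtain ⟨β', hβ'⟩ := hβ.exists_right_inv
  have hreg : IsRegularSystem ![u, X₂] :=
    h.of_pair (h.not_isUnit 0) (h'.not_isUnit 1) ⟨1, 0, by ring⟩
      ⟨-(β' * α), β', by linear_combination (-β') * e - v * hβ'⟩
  obtain ⟨α', b', h1⟩ := hreg.exists_of_not_isUnit (h'.not_isUnit 0)
  have h1' : X₁ = α' * u + b' * X₂ := h1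
  obtain ⟨η, hη⟩ := (hreg.isUnit_of_eq_add h' h1').exists_right_inv
  exact ⟨hreg, η, η * b', IsUnit.of_mul_eq_one _ (by rw [mul_comm]; exact hη),
    by linear_combination (-η) * h1' - u * hη⟩

end IsRegularSystem

variable {F : Type} [Field F] {k : Type} [Field k] [Algebra k F] {p : ℕ}
  {K : IntermediateField k F}

lemma HasValue.isUnit_mk {a b w : F} {c : k} (hab : AlgebraicIndependent k ![a, b])
    (h : HasValue a b w c) (hc : c ≠ 0) : IsUnit (⟨w, h.mem⟩ : planarRing k a b) :=
  (Subring.isUnit_mk_iff _).2 ⟨h.ne_zero hab hc, (h.inv hab hc).mem⟩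

namespace IsStage

variable {x y u v : F}

lemma hasValue_left (h : IsStage p K x y u v) (hp : p ≠ 0) : HasValue x y u (0 : k) := by
  obtain ⟨γ₀, κ₀, l₀, t₀, -, -, -, -, γ₁, hγ₁, l, t, -, -, hu, -⟩ := h.form
  rw [hu]
  have h1 := (_root_.hasValue_left (k := k) (a := x) (b := y)).pow p
  rw [zero_pow hp] at h1
  exact HasValue.mem_zero (add_mem (add_mem (algebraMap_mem_planarRing _)
    (mul_mem (algebraMap_mem_planarRing _) right_mem_planarRing))
    (mul_mem hγ₁ left_mem_planarRing)) h1

lemma hasValue_right (h : IsStage p K x y u v) (hp : p ≠ 0) : HasValue x y v (0 : k) := by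
  obtain ⟨γ₀, κ₀, l₀, t₀, -, -, -, -, γ₁, hγ₁, l, t, hl, ht, -, hv⟩ := h.form
  rw [hv]
  have h1 := (_root_.hasValue_right (k := k) (a := x) (b := y)).pow p
  rw [zero_pow hp] at h1
  have := (HasValue.mem_zero hl.mem h1).add
    (HasValue.mem_zero ht.mem (_root_.hasValue_left (k := k) (a := x) (b := y)))
  rwa [add_zero] at this

lemma not_isPlanarMonomial [Fact p.Prime] [CharP k p] (h : IsStage p K x y u v) {i : ℕ}
    (hip : i < p) {t : F} (hyt : AlgebraicIndependent k ![y, t]) (hx : x = y ^ i * t) :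
    ¬ IsPlanarMonomial (planarRing k u v) (planarRing k y t) := by
  have hp := (Fact.out : p.Prime)
  have huv := h.pair.algebraicIndependent
  have hxy := h.pair_top.algebraicIndependent
  have hA := isRegularSystem_planarRing huv
  have hS := isRegularSystem_planarRing hyt
  have huB := h.hasValue_left hp.ne_zero
  have hvB := h.hasValue_right hp.ne_zero
  have hxS : HasValue y t x (0 : k) := by
    rw [hx]
    exact HasValue.mem_zero (pow_mem left_mem_planarRing i) _root_.hasValue_right
  have hyS : HasValue y t y (0 : k) := _root_.hasValue_left
  have hBS := planarRing_le_of_hasValue hyt hxy.left_ne_zero hxy.right_ne_zero hxS hyS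
  have toB : ∀ {w : F} {c : k}, HasValue u v w c → HasValue x y w c := fun hw =>
    HasValue.of_hasValue hxy huv.left_ne_zero huv.right_ne_zero huB hvB hw
  have toS : ∀ {w : F} {c : k}, HasValue x y w c → HasValue y t w c := fun hw =>
    HasValue.of_hasValue hyt hxy.left_ne_zero hxy.right_ne_zero hxS hyS hw
  have hAB := planarRing_le_of_hasValue hxy huv.left_ne_zero huv.right_ne_zero huB hvB
  have hAS := hAB.trans hBS
  obtain ⟨γ₀, κ₀, l₀, τ₀, hγ₀, hκ₀, hl₀, hτ₀, γ₁, hγ₁, l, τ, hl, hτ, hu, hv⟩ := h.form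
  have hγ : HasValue x y (algebraMap k F γ₀ + algebraMap k F κ₀ * y + γ₁ * x) γ₀ := by
    have := ((hasValue_algebraMap (a := x) (b := y) γ₀).add
      (HasValue.mem_zero (algebraMap_mem_planarRing κ₀) _root_.hasValue_right)).add
      (HasValue.mem_zero hγ₁ _root_.hasValue_left)
    rwa [add_zero, add_zero] at this
  set γ := algebraMap k F γ₀ + algebraMap k F κ₀ * y + γ₁ * x with hγe
  let κ : k →+* planarRing k y t :=
    (algebraMap k F).codRestrict (planarRing k y t) algebraMap_mem_planarRing
  have : CharP (planarRing k y t) p := charP_of_injective_ringHom κ.injective p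
  have key : ∀ (X₁ X₂ α β : planarRing k u v) (Y₁ Y₂ δ₁ δ₂ : planarRing k y t) (a b c d : ℕ),
      IsRegularSystem ![X₁, X₂] → IsRegularSystem ![Y₁, Y₂] → IsUnit δ₁ → IsUnit δ₂ →
      IsUnit β → X₂ = α * ⟨u, left_mem_planarRing⟩ + β * ⟨v, right_mem_planarRing⟩ →
      (X₁ : F) = δ₁ * Y₁ ^ a * Y₂ ^ b → (X₂ : F) = δ₂ * Y₁ ^ c * Y₂ ^ d → False := by
    intro X₁ X₂ α β Y₁ Y₂ δ₁ δ₂ a b c d hX hY hδ₁ hδ₂ hβ he hX₁ hX₂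
    obtain ⟨hreg, η, b', hη, hb'⟩ := hA.exists_isUnit_mul_add hX hβ he
    have he' : (X₂ : F) = α * u + β * v := congrArg Subtype.val he
    have hb'' : u + b' * (X₂ : F) = η * X₁ := congrArg Subtype.val hb'
    obtain ⟨β₀, hβ₀⟩ := HasValue.exists_of_mem huv β.2
    have hβ0 : β₀ ≠ 0 := by
      rintro rfl
      have h1 := (Subring.isUnit_iff _).1 hβ
      exact h1.1 (hβ₀.eq_zero_of_inv_mem huv h1.2)
    have hx1 : HasValue x y (x ^ (p - 1)) (0 : k) := by
      have := (_root_.hasValue_left (k := k) (a := x) (b := y)).pow (p - 1)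
      rwa [zero_pow (Nat.sub_ne_zero_of_lt hp.one_lt)] at this
    have hτ' : HasValue x y (β * τ + (α : F) * γ * x ^ (p - 1)) (β₀ * τ₀) := by
      have := ((toB hβ₀).mul hτ).add (HasValue.mem_zero (mul_mem (hAB α.2) hγ.mem) hx1)
      rwa [add_zero] at this
    have hl' : HasValue x y (β * l) (β₀ * l₀) := (toB hβ₀).mul hl
    have hτS := toS hτ'
    have hlS := toS hl'
    have hγS := toS hγ
    have hηS : IsUnit (⟨η, hAS η.2⟩ : planarRing k y t) := by
      have h1 := (Subring.isUnit_iff _).1 hη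
      exact (Subring.isUnit_mk_iff _).2 ⟨h1.1, hAS h1.2⟩
    obtain ⟨τα, hτα, τβ, hτβ, hτe⟩ := hτ'
    have hxp : x ^ p = x ^ (p - 1) * x := by rw [← pow_succ, Nat.sub_add_cancel hp.one_le]
    refine hS.not_monomial_form (κ := κ) (x := ⟨x, hxS.mem⟩) (γ := ⟨γ, hγS.mem⟩)
      (l := ⟨_, hlS.mem⟩) (τ := ⟨_, hτS.mem⟩) (γ₁ := ⟨γ₁, hBS hγ₁⟩) (α := ⟨τα, hBS hτα⟩)
      (β := ⟨τβ, hBS hτβ⟩) (u := ⟨u, hAS left_mem_planarRing⟩) (X := ⟨X₂, hAS X₂.2⟩)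
      (A := {z | (z : F) ∈ planarRing k u v}) (b' := ⟨b', hAS b'.2⟩)
      (δ₁ := ⟨η, hAS η.2⟩ * δ₁) (a := a) (b := b) (γ₀ := γ₀) (τ₀ := β₀ * τ₀) hip
      (Subtype.ext hx) hκ₀
      (hγS.isUnit_mk hyt hγ₀) (hlS.isUnit_mk hyt (mul_ne_zero hβ0 hl₀))
      (hτS.isUnit_mk hyt (mul_ne_zero hβ0 hτ₀)) (Subtype.ext hγe) (Subtype.ext hτe)
      (Subtype.ext hu) (Subtype.ext ?_) ?_ hY (hηS.mul hδ₁) hδ₂ b'.2 (Subtype.ext ?_)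
      (Subtype.ext hX₂)
    · change (X₂ : F) = β * l * y ^ p + (β * τ + α * γ * x ^ (p - 1)) * x
      linear_combination he' + (α : F) * hu + β * hv + α * γ * hxp
    · intro w hw
      obtain ⟨e, hwe⟩ := HasValue.exists_of_mem huv hw
      have hw0 : HasValue u v ((w : F) - algebraMap k F e) (0 : k) := by
        have := hwe.sub (hasValue_algebraMap (a := u) (b := v) e)
        rwa [sub_self] at this
      have hnu : ¬ IsUnit (⟨_, hw0.mem⟩ : planarRing k u v) := by
        intro h1
        have h2 := (Subring.isUnit_mk_iff _).1 h1
        exact h2.1 (hw0.eq_zero_of_inv_mem huv h2.2)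
      obtain ⟨r, s, hrs⟩ := hreg.exists_of_not_isUnit hnu
      have hrs' : (w : F) - algebraMap k F e = r * u + s * X₂ := congrArg Subtype.val hrs
      refine ⟨e, ⟨s, hAS s.2⟩, s.2, ⟨r, hAS r.2⟩, Subtype.ext ?_⟩
      change (w : F) = algebraMap k F e + s * X₂ + r * u
      linear_combination hrs'
    · change u + b' * (X₂ : F) = η * δ₁ * Y₁ ^ a * Y₂ ^ b
      rw [hb'', hX₁]
      ring
  rintro ⟨X₁, X₂, Y₁, Y₂, δ₁, δ₂, a, b, c, d, hX, hY, hδ₁, hδ₂, -, hX₁, hX₂⟩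
  rcases hA.exists_isUnit_coefficient hX with ⟨α, β, hβ, he⟩ | ⟨α, β, hβ, he⟩
  · exact key X₂ X₁ α β Y₁ Y₂ δ₂ δ₁ c d a b hX.pair_swap hY hδ₂ hδ₁ hβ he hX₂ hX₁
  · exact key X₁ X₂ α β Y₁ Y₂ δ₁ δ₂ a b c d hX hY hδ₁ hδ₂ hβ he hX₁ hX₂

end IsStage

end PlanarNonMonomial

section NoMonomialization

variable {F : Type} [Field F] {k : Type} [Field k] [Algebra k F] {p : ℕ}
  {K : IntermediateField k F}

lemma IsStage.div_not_mem [Fact p.Prime] {x y u v : F} (h : IsStage p K x y u v) {i : ℕ}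
    (hip : i < p) {t : F} (hyt : AlgebraicIndependent k ![y, t]) (hx : x = y ^ i * t) :
    u / v ∉ planarRing k y t := by
  intro hmem
  have huv := h.pair.algebraicIndependent
  have hxy := h.pair_top.algebraicIndependent
  have hS := isRegularSystem_planarRing hyt
  have hxS : HasValue y t x (0 : k) := by
    rw [hx]
    exact HasValue.mem_zero (pow_mem left_mem_planarRing i) _root_.hasValue_right
  have toS : ∀ {w : F} {c : k}, HasValue x y w c → HasValue y t w c := fun hw =>
    HasValue.of_hasValue hyt hxy.left_ne_zero hxy.right_ne_zero hxS _root_.hasValue_left hw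
  obtain ⟨γ₀, κ₀, l₀, τ₀, hγ₀, hκ₀, hl₀, hτ₀, γ₁, hγ₁, l, τ, hl, hτ, hu, hv⟩ := h.form
  have hγ : HasValue x y (algebraMap k F γ₀ + algebraMap k F κ₀ * y + γ₁ * x) γ₀ := by
    have := ((hasValue_algebraMap (a := x) (b := y) γ₀).add
      (HasValue.mem_zero (algebraMap_mem_planarRing κ₀) _root_.hasValue_right)).add
      (HasValue.mem_zero hγ₁ _root_.hasValue_left)
    rwa [add_zero, add_zero] at this
  set γ := algebraMap k F γ₀ + algebraMap k F κ₀ * y + γ₁ * x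
  have hγu := (toS hγ).isUnit_mk hyt hγ₀
  have hlu := (toS hl).isUnit_mk hyt hl₀
  have hreg := hS.pair_linear (l := ⟨l, (toS hl).mem⟩) hip ((toS hτ).isUnit_mk hyt hτ₀)
  set y' : planarRing k y t := ⟨y, left_mem_planarRing⟩
  set t' : planarRing k y t := ⟨t, right_mem_planarRing⟩
  set l' : planarRing k y t := ⟨l, (toS hl).mem⟩
  set τ' : planarRing k y t := ⟨τ, (toS hτ).mem⟩
  set γ' : planarRing k y t := ⟨γ, (toS hγ).mem⟩
  set T := l' * y' ^ (p - i) + τ' * t' with hT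
  have hTp := hreg.right_prime
  have hTy : ¬ T ∣ y' := hreg.not_dvd_left
  have hTt : ¬ T ∣ t' := fun hd => by
    have h1 : T ∣ l' * y' ^ (p - i) := by
      rw [show l' * y' ^ (p - i) = T - τ' * t' by rw [hT]; ring]
      exact dvd_sub dvd_rfl (hd.mul_left _)
    exact hTy (hTp.dvd_of_dvd_pow (hlu.dvd_mul_left.1 h1))
  have h1 : γ' * (y' ^ i * t') ^ p = ⟨u / v, hmem⟩ * y' ^ i * T := by
    refine Subtype.ext ?_
    change γ * (y ^ i * t) ^ p = u / v * y ^ i * (l * y ^ (p - i) + τ * t)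
    have h2 : v = y ^ i * (l * y ^ (p - i) + τ * t) := by
      have he : y ^ p = y ^ i * y ^ (p - i) := by rw [← pow_add, Nat.add_sub_cancel' hip.le]
      rw [hv, he, hx]
      ring
    rw [mul_assoc, ← h2, div_mul_cancel₀ _ huv.right_ne_zero, hu, hx]
  have h2 : T ∣ γ' * (y' ^ i * t') ^ p := h1 ▸ dvd_mul_left _ _
  rcases hTp.dvd_or_dvd (hTp.dvd_of_dvd_pow (hγu.dvd_mul_left.1 h2)) with h3 | h3
  · exact hTy (hTp.dvd_of_dvd_pow h3)
  · exact hTt h3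

lemma AlgebraicIndependent.pair_swap {a b : F} (hab : AlgebraicIndependent k ![a, b]) :
    AlgebraicIndependent k ![b, a] := by
  have := hab.comp (Equiv.swap (0 : Fin 2) 1) (Equiv.injective _)
  convert this using 1
  ext i
  fin_cases i <;> simp

namespace IsPlanarSequence

variable {f : ℕ → F} {c : ℕ → k} {V S : Subring F}

lemma div_ring_le_next [Algebra.IsAlgebraic K F] (htr : Algebra.trdeg k F = 2)
    (h : IsPlanarSequence p K f c) (r : ℕ) {i : ℕ} (hi : i < p) :
    planarRing k (f (r + 1)) (f r / f (r + 1) ^ i) ≤ planarRing k (f (r + 1)) (f (r + 2)) := by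
  have hind := (h.pair_div htr r i).algebraicIndependent
  refine planarRing_le_of_hasValue (h.pair (r + 1)).algebraicIndependent hind.left_ne_zero
    hind.right_ne_zero _root_.hasValue_left ?_
  rw [h.div_eq r hi, mul_comm]
  exact HasValue.mem_zero (mul_mem (pow_mem left_mem_planarRing _) (hasValue_unit r).mem)
    _root_.hasValue_left

lemma ring_le_div_ring [Algebra.IsAlgebraic K F] (htr : Algebra.trdeg k F = 2)
    (h : IsPlanarSequence p K f c) (r i : ℕ) :
    planarRing k (f r) (f (r + 1)) ≤ planarRing k (f (r + 1)) (f r / f (r + 1) ^ i) := by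
  refine planarRing_le_of_hasValue (h.pair_div htr r i).algebraicIndependent (h.ne_zero r)
    (h.ne_zero (r + 1)) ?_ _root_.hasValue_left
  have := HasValue.mem_zero (pow_mem (left_mem_planarRing (k := k)) i)
    (_root_.hasValue_right (k := k) (a := f (r + 1)) (b := f r / f (r + 1) ^ i))
  rwa [mul_div_cancel₀ _ (pow_ne_zero _ (h.ne_zero (r + 1)))] at this

lemma isPlanarMonomial_next [Algebra.IsAlgebraic K F] (htr : Algebra.trdeg k F = 2)
    (h : IsPlanarSequence p K f c) (hV : IsLocalRing V) (hk : ∀ c : k, algebraMap k F c ∈ V)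
    (hf : ∀ r, IsNonunit V (f r)) (hVS : Dominates V S) (r : ℕ)
    (hle : planarRing k (f (r + 1)) (f (r + 2)) ≤ S) {i : ℕ} (hi : i < p)
    (hm : IsPlanarMonomial (planarRing k (f (r + 1)) (f r / f (r + 1) ^ i)) S) :
    IsPlanarMonomial (planarRing k (f (r + 1)) (f (r + 2))) S := by
  have h1 := h.ne_zero (r + 1)
  obtain ⟨d, hd⟩ : ∃ d, p = i + d + 1 := ⟨p - i - 1, by lia⟩
  induction d generalizing i with
  | zero =>
    have hind := (h.pair_div htr r i).algebraicIndependent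
    rw [← planarRing_swap hind] at hm
    refine hm.blowup hind.pair_swap (h.pair (r + 1)).algebraicIndependent (c := c r) ?_
      (hVS.of_le (dominates_planarRing (h.pair (r + 1)).algebraicIndependent hV hk (hf _) (hf _))
        hle)
    rw [h.div_eq r hi, show p - i - 1 = 0 by lia, pow_zero, one_mul]
  | succ d ih =>
    have hi' : i + 1 < p := by lia
    refine ih hi' ?_ (by lia)
    have hind := (h.pair_div htr r i).algebraicIndependent
    have hind' := (h.pair_div htr r (i + 1)).algebraicIndependent
    rw [← planarRing_swap hind] at hm
    refine hm.blowup hind.pair_swap hind' (c := 0) ?_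
      (hVS.of_le (dominates_planarRing hind' hV hk (hf _) (h.isNonunit_div hk hf r hi'))
        ((h.div_ring_le_next htr r hi').trans hle))
    rw [map_zero, zero_add, pow_succ]
    field_simp

lemma isPlanarMonomial_of_le [Algebra.IsAlgebraic K F] (htr : Algebra.trdeg k F = 2)
    (h : IsPlanarSequence p K f c) (hp : p ≠ 0) (hV : IsLocalRing V)
    (hk : ∀ c : k, algebraMap k F c ∈ V) (hf : ∀ r, IsNonunit V (f r)) (hVS : Dominates V S)
    {s r : ℕ} (hsr : s ≤ r) (hle : planarRing k (f r) (f (r + 1)) ≤ S)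
    (hm : IsPlanarMonomial (planarRing k (f s) (f (s + 1))) S) :
    IsPlanarMonomial (planarRing k (f r) (f (r + 1))) S := by
  induction r, hsr using Nat.le_induction with
  | base => exact hm
  | succ r _ ih =>
    have hm' := ih ((h.planarRing_mono hp (Nat.le_succ r)).trans hle)
    rw [← h.div_zero_ring_eq] at hm'
    exact h.isPlanarMonomial_next htr hV hk hf hVS r hle (Nat.pos_of_ne_zero hp) hm'

end IsPlanarSequence

lemma not_isMonomialExtension_of_isStage [Fact p.Prime] [CharP k p] [Algebra.IsAlgebraic K F]
    (htr : Algebra.trdeg k F = 2) {f g : ℕ → F} {c c' : ℕ → k}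
    (hf : IsPlanarSequence p (⊤ : IntermediateField k F) f c) (hg : IsPlanarSequence p K g c')
    (hfg : ∀ r, IsStage p K (f r) (f (r + 1)) (g r) (g (r + 1))) {V A B : Subring F}
    (hV : IsLocalRing V) (hk : ∀ c : k, algebraMap k F c ∈ V) (hfV : ∀ r, IsNonunit V (f r))
    (hgV : ∀ r, IsNonunit V (g r)) (hAK : (A : Set F) ⊆ K) (hVB : Dominates V B)
    (hBA : Dominates B A) (hA : planarRing k (g 0) (g 1) ≤ A)
    (hB : planarRing k (f 0) (f 1) ≤ B) : ¬ IsMonomialExtension A B := by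
  intro hAB
  have hp := (Fact.out : p.Prime)
  have hBn : ∀ n (y : Fin n → B), IsRegularSystem y →
      n = 2 ∧ ∃ r, ∃ i < p, B = planarRing k (f (r + 1)) (f r / f (r + 1) ^ i) := fun n y hy =>
    hf.eq_two_and_exists_eq_div_ring htr hp.two_le hV hk hfV hVB (by simp) hy hB
  have hm := isPlanarMonomial_of_isMonomialExtension hAB fun n y hy => (hBn n y hy).1
  obtain ⟨X₁, X₂, Y₁, Y₂, -, -, -, -, -, -, hX, hY, -⟩ := id hm
  obtain ⟨-, r, i, hi, hBr⟩ := hBn 2 _ hY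
  obtain ⟨-, s, j, hj, hAs⟩ := hg.eq_two_and_exists_eq_div_ring htr hp.two_le hV hk hgV
    (hVB.trans hBA) hAK hX hA
  have hind := (hf.pair_div htr r i).algebraicIndependent
  have hx : f r = f (r + 1) ^ i * (f r / f (r + 1) ^ i) := by
    have := hf.ne_zero (r + 1)
    field_simp
  have hABle := (dominates_iff.1 hBA).1
  have hnot : g r / g (r + 1) ∉ A := fun hmem =>
    (hfg r).div_not_mem hi hind hx (hBr ▸ hABle hmem)
  have hgr := hg.ne_zero (r + 1)
  have hle : planarRing k (g r) (g (r + 1)) ≤ B := by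
    have h1 := planarRing_le_of_hasValue (hfg r).pair_top.algebraicIndependent (hg.ne_zero r) hgr
      ((hfg r).hasValue_left hp.ne_zero) ((hfg r).hasValue_right hp.ne_zero)
    rw [hBr]
    exact h1.trans (hf.ring_le_div_ring htr r i)
  have hfin : IsPlanarMonomial (planarRing k (g r) (g (r + 1))) B := by
    rw [hAs] at hm
    rcases lt_trichotomy s r with hsr | hsr | hsr
    · exact hg.isPlanarMonomial_of_le htr hp.ne_zero hV hk hgV hVB hsr hle
        (hg.isPlanarMonomial_next htr hV hk hgV hVB s
          ((hg.planarRing_mono hp.ne_zero hsr).trans hle) hj hm)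
    · subst hsr
      rcases Nat.eq_zero_or_pos j with rfl | hj0
      · rwa [hg.div_zero_ring_eq] at hm
      · refine absurd ?_ hnot
        rw [hAs]
        have := mul_mem (pow_mem (left_mem_planarRing (k := k)) (j - 1))
          (right_mem_planarRing (k := k) (a := g (s + 1)) (b := g s / g (s + 1) ^ j))
        convert this using 1
        obtain ⟨j, rfl⟩ := Nat.exists_eq_add_of_le' hj0
        rw [Nat.add_sub_cancel, pow_succ]
        field_simp
    · refine absurd ?_ hnot
      have h1 : g r / g (r + 1) ∈ planarRing k (g (r + 1)) (g (r + 2)) := by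
        have := hg.div_eq r hp.one_lt
        rw [pow_one] at this
        rw [this]
        exact mul_mem left_mem_planarRing
          (mul_mem (pow_mem left_mem_planarRing _) (IsPlanarSequence.hasValue_unit r).mem)
      rw [hAs]
      exact hg.ring_le_div_ring htr s j (hg.planarRing_mono hp.ne_zero hsr h1)
  rw [hBr] at hfin
  exact (hfg r).not_isPlanarMonomial hi hind hx hfin

end NoMonomialization

section

open Polynomial

section PlanarExtension

variable {F : Type} [Field F] {k : Type} [Field k] [Algebra k F] {p : ℕ}
  {K : IntermediateField k F} {x y u v : F}

lemma map_planarRing (hxy : AlgebraicIndependent k ![x, y]) (φ : F →ₐ[k] F) :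
    (planarRing k x y).map (φ : F →+* F) = planarRing k (φ x) (φ y) := by
  have hcomp : ∀ P : MvPolynomial (Fin 2) k, MvPolynomial.aeval ![φ x, φ y] P =
      φ (MvPolynomial.aeval ![x, y] P) := fun P => by
    refine Eq.trans ?_ (MvPolynomial.comp_aeval_apply (f := ![x, y]) φ P).symm
    congr 2
    ext i
    fin_cases i <;> rfl
  ext z
  constructor
  · rintro ⟨w, hw, rfl⟩
    obtain ⟨P, Q, hQ, h⟩ := mem_planarRing.1 hw
    refine mem_planarRing.2 ⟨P, Q, hQ, ?_⟩
    rw [hcomp, hcomp, ← h, map_mul]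
    rfl
  · intro hz
    obtain ⟨P, Q, hQ, h⟩ := mem_planarRing.1 hz
    rw [hcomp, hcomp] at h
    have hQ0 : MvPolynomial.aeval ![x, y] Q ≠ 0 := fun h0 => hQ (by
      rw [hxy.eq_zero_of_aeval_eq_zero _ h0, map_zero])
    refine ⟨MvPolynomial.aeval ![x, y] P / MvPolynomial.aeval ![x, y] Q,
      mem_planarRing.2 ⟨P, Q, hQ, div_mul_cancel₀ _ hQ0⟩, ?_⟩
    change φ _ = z
    rw [map_div₀, ← h, mul_div_cancel_right₀ _ ((map_ne_zero φ).2 hQ0)]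

lemma exists_separable_polynomial [CharP k p] (hu : u ∈ K) (hv : v ∈ K) (hu0 : u ≠ 0)
    (hp : p.Prime) (hux : u = x ^ p * (1 + y)) (hvx : v = y ^ p + x) :
    ∃ P : K[X], P.Separable ∧ aeval y P = 0 := by
  have : CharP F p := charP_of_injective_algebraMap (algebraMap k F).injective p
  have : CharP K p := charP_of_injective_algebraMap (algebraMap k K).injective p
  have := Fact.mk hp
  set u' : K := ⟨u, hu⟩
  set v' : K := ⟨v, hv⟩
  have hu0' : u' ≠ 0 := fun h => hu0 (congrArg Subtype.val h)
  have hC : C u'⁻¹ * C u' = (1 : K[X]) := by rw [← C_mul, inv_mul_cancel₀ hu0', C_1]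
  have hd : derivative ((C v' ^ p - X ^ p ^ 2) * (1 + X) - C u') = C v' ^ p - X ^ p ^ 2 := by
    have h0 : ((p ^ 2 : ℕ) : K) = 0 := by
      rw [Nat.cast_pow, CharP.cast_eq_zero, zero_pow two_ne_zero]
    rw [← C_pow]
    simp [derivative_X_pow, -map_pow]
  refine ⟨(C v' ^ p - X ^ p ^ 2) * (1 + X) - C u', ⟨-C u'⁻¹, C u'⁻¹ * (1 + X), ?_⟩, ?_⟩
  · rw [hd]
    linear_combination hC
  · have h1 : algebraMap K F v' = v := rfl
    have h2 : algebraMap K F u' = u := rfl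
    simp only [map_sub, map_mul, map_pow, aeval_C, aeval_X, map_add, map_one, h1, h2]
    rw [hvx, hux, add_pow_char, ← pow_mul, ← sq]
    ring

lemma finite_and_isSeparable_of_eq [CharP k p] (hp : p.Prime)
    (hxy : IsCoordinatePair (⊤ : IntermediateField k F) x y) (hu : u ∈ K) (hv : v ∈ K)
    (hu0 : u ≠ 0) (hux : u = x ^ p * (1 + y)) (hvx : v = y ^ p + x) :
    FiniteDimensional K F ∧ Algebra.IsSeparable K F := by
  obtain ⟨P, hP, hPy⟩ := exists_separable_polynomial hu hv hu0 hp hux hvx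
  have hsep := isSeparable_of_separable_aeval hP hPy
  have htop : IntermediateField.adjoin K {y} = ⊤ := by
    have h1 : (⊤ : IntermediateField k F) ≤ (IntermediateField.adjoin K {y}).restrictScalars k := by
      have hy : y ∈ IntermediateField.adjoin K {y} := IntermediateField.mem_adjoin_simple_self K y
      rw [← hxy.adjoin_eq, IntermediateField.adjoin_le_iff]
      rintro z (rfl | rfl)
      · have : z = v - y ^ p := by rw [hvx]; ring
        rw [this]
        exact sub_mem ((IntermediateField.adjoin K {y}).algebraMap_mem (⟨v, hv⟩ : K))
          (pow_mem hy p)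
      · exact hy
    exact eq_top_iff.2 fun z _ => h1 IntermediateField.mem_top
  constructor
  · have := IntermediateField.adjoin.finiteDimensional hsep.isIntegral
    rw [htop] at this
    exact Module.Finite.equiv (IntermediateField.topEquiv (F := K) (E := F)).toLinearEquiv
  · have := (IntermediateField.isSeparable_adjoin_simple_iff_isSeparable K F).2 hsep
    rw [htop] at this
    exact AlgEquiv.Algebra.isSeparable (IntermediateField.topEquiv (F := K) (E := F))

lemma IsStage.exists_sequences [Fact p.Prime] [CharP k p] [Algebra.IsAlgebraic K F]
    (htr : Algebra.trdeg k F = 2) (hk : ∀ d : k, ∃ c : k, c ≠ 0 ∧ c ≠ d)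
    (h : IsStage p K x y u v) : ∃ (f g : ℕ → F) (c c' : ℕ → k),
      f 0 = x ∧ f 1 = y ∧ g 0 = u ∧ g 1 = v ∧
      IsPlanarSequence p (⊤ : IntermediateField k F) f c ∧ IsPlanarSequence p K g c' ∧
      ∀ r, IsStage p K (f r) (f (r + 1)) (g r) (g (r + 1)) := by
  let Q := {q : (F × F) × F × F // IsStage p K q.1.1 q.1.2 q.2.1 q.2.2}
  have step : ∀ q : Q, ∃ (q' : Q) (c c' : k), c ≠ 0 ∧ c' ≠ 0 ∧ q'.1.1.1 = q.1.1.2 ∧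
      q'.1.2.1 = q.1.2.2 ∧ q.1.1.1 = q.1.1.2 ^ p * (algebraMap k F c + q'.1.1.2) ∧
      q.1.2.1 = q.1.2.2 ^ p * (algebraMap k F c' + q'.1.2.2) := fun q => by
    obtain ⟨c, c', z, w, hc, hc', h1, h2, h3⟩ := q.2.next htr hk
    exact ⟨⟨((_, z), _, w), h3⟩, c, c', hc, hc', rfl, rfl, h1, h2⟩
  choose next e e' he he' hf hg hfe hge using step
  let q : ℕ → Q := fun r => next^[r] ⟨((x, y), u, v), h⟩
  have hq : ∀ r, q (r + 1) = next (q r) := fun r => Function.iterate_succ_apply' _ _ _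
  have hf' : ∀ r, (q (r + 1)).1.1.1 = (q r).1.1.2 := fun r => by rw [hq]; exact hf _
  have hg' : ∀ r, (q (r + 1)).1.2.1 = (q r).1.2.2 := fun r => by rw [hq]; exact hg _
  have hst : ∀ r, IsStage p K (q r).1.1.1 (q (r + 1)).1.1.1 (q r).1.2.1 (q (r + 1)).1.2.1 :=
    fun r => by rw [hf', hg']; exact (q r).2
  refine ⟨fun r => (q r).1.1.1, fun r => (q r).1.2.1, fun r => e (q r), fun r => e' (q r), rfl,
    hf' 0, rfl, hg' 0, ⟨fun r => (hst r).pair_top, fun r => he _, fun r => ?_⟩,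
    ⟨fun r => (hst r).pair, fun r => he' _, fun r => ?_⟩, hst⟩
  · have := hfe (q r)
    rwa [← hq, ← hf', ← hf' (r + 1)] at this
  · have := hge (q r)
    rwa [← hq, ← hg', ← hg' (r + 1)] at this

end PlanarExtension

end

section BaseCase

variable {k : Type} [Field k]

lemma exists_planar_field (k : Type) [Field k] : ∃ (F : Type) (_ : Field F) (_ : Algebra k F)
    (x y : F), Algebra.trdeg k F = 2 ∧ IsCoordinatePair (⊤ : IntermediateField k F) x y ∧
      ∀ u v : F, AlgebraicIndependent k ![u, v] → ∃ φ : F →ₐ[k] F, φ x = u ∧ φ y = v := by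
  let R := MvPolynomial (Fin 2) k
  let F := FractionRing R
  have htr : Algebra.trdeg k F = 2 := by
    have : Algebra.IsAlgebraic R F := IsLocalization.isAlgebraic F (nonZeroDivisors R)
    rw [← trdeg_add_eq k R, MvPolynomial.trdeg_of_isDomain, trdeg_eq_zero, add_zero]
    simp
  refine ⟨F, inferInstance, inferInstance, algebraMap R F (MvPolynomial.X 0),
    algebraMap R F (MvPolynomial.X 1), htr, isCoordinatePair_of_adjoin_eq htr ?_, fun u v huv => ?_⟩
  · set L := IntermediateField.adjoin k {algebraMap R F (MvPolynomial.X 0),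
      algebraMap R F (MvPolynomial.X 1)} with hL
    have hR : ∀ P : R, algebraMap R F P ∈ L := fun P => by
      induction P using MvPolynomial.induction_on with
      | C c => exact L.algebraMap_mem c
      | add P Q hP hQ =>
        rw [map_add]
        exact add_mem hP hQ
      | mul_X P i hP =>
        rw [map_mul]
        refine mul_mem hP (IntermediateField.subset_adjoin _ _ ?_)
        fin_cases i <;> simp
    refine eq_top_iff.2 fun z _ => ?_
    obtain ⟨a, b, -, rfl⟩ := IsFractionRing.div_surjective (A := R) z
    exact div_mem (hR a) (hR b)
  · have hinj : Function.Injective (MvPolynomial.aeval ![u, v] : R →ₐ[k] F) := huv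
    refine ⟨IsFractionRing.liftAlgHom (K := F) hinj, ?_, ?_⟩
    · refine (IsFractionRing.lift_algebraMap (K := F) hinj _).trans ?_
      simp
    · refine (IsFractionRing.lift_algebraMap (K := F) hinj _).trans ?_
      simp

lemma EndoCounterexample.nonempty_two (k : Type) [Field k] {p : ℕ} [Fact p.Prime] [CharP k p]
    (hk : ∀ d : k, ∃ c : k, c ≠ 0 ∧ c ≠ d) : Nonempty (EndoCounterexample k 2) := by
  have hp := (Fact.out : p.Prime)
  obtain ⟨F, _, _, x, y, htr, hxy, hφ⟩ := exists_planar_field k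
  have hind := hxy.algebraicIndependent
  set u := x ^ p * (1 + y) with hu
  set v := y ^ p + x with hv
  have hu0 : u ≠ 0 := by
    have h1 : HasValue x y (1 + y) (1 : k) := by
      simpa using (hasValue_one (k := k) (a := x) (b := y)).add hasValue_right
    exact mul_ne_zero (pow_ne_zero _ hind.left_ne_zero) (h1.ne_zero hind one_ne_zero)
  have huv : AlgebraicIndependent k ![u, v] := by
    obtain ⟨h1, -⟩ := finite_and_isSeparable_of_eq (K := IntermediateField.adjoin k {u, v}) hp hxy
      (IntermediateField.subset_adjoin _ _ (by simp))
      (IntermediateField.subset_adjoin _ _ (by simp)) hu0 hu hv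
    exact (isCoordinatePair_of_adjoin_eq (K := IntermediateField.adjoin k {u, v}) htr
      rfl).algebraicIndependent
  obtain ⟨φ, hφx, hφy⟩ := hφ u v huv
  obtain ⟨hfin, hsep⟩ := finite_and_isSeparable_of_eq (K := φ.fieldRange) hp hxy
    ⟨x, hφx⟩ ⟨y, hφy⟩ hu0 hu hv
  have hpair : IsCoordinatePair φ.fieldRange u v := by
    refine ⟨?_, huv⟩
    rw [AlgHom.fieldRange_eq_map, ← hxy.adjoin_eq, IntermediateField.adjoin_map, Set.image_pair,
      hφx, hφy]
  have hstage : IsStage p φ.fieldRange x y u v :=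
    ⟨hxy, hpair, 1, 1, 1, 1, one_ne_zero, one_ne_zero, one_ne_zero, one_ne_zero, 0, zero_mem _,
      1, 1, hasValue_one, hasValue_one, by rw [hu, map_one]; ring, by rw [hv]; ring⟩
  obtain ⟨f, g, c, c', hf0, hf1, hg0, hg1, hf, hg, hfg⟩ := hstage.exists_sequences htr hk
  have hBmap : (planarRing k x y).map (φ : F →+* F) = planarRing k u v := by
    rw [map_planarRing hind, hφx, hφy]
  have hVval := hf.isValuationSubring_limitRing hp.two_le
  have hVk := hf.algebraMap_mem_limitRing hp.ne_zero
  have hfV := hf.isNonunit_limitRing hp.ne_zero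
  have hgV : ∀ r, IsNonunit (hf.limitRing hp.ne_zero) (g r) := fun r =>
    ⟨⟨r, ((hfg r).hasValue_left hp.ne_zero).mem⟩,
      hf.not_inv_mem_limitRing hp.ne_zero ((hfg r).hasValue_left hp.ne_zero) (hg.ne_zero r)⟩
  have hVB : Dominates (hf.limitRing hp.ne_zero) (planarRing k x y) :=
    dominates_planarRing hind hVval.isLocalRing hVk (hf0 ▸ hfV 0) (hf1 ▸ hfV 1)
  refine ⟨{
    F := F
    φ := φ
    B := planarRing k x y
    V := hf.limitRing hp.ne_zero
    trdeg := htr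
    finite := hfin
    separable := hsep
    V_val := hVval
    V_k := hVk
    V_res := hf.hasResidueField_limitRing hp.ne_zero
    B_alg := hxy.isAlgebraicLocalRingOf
    B_reg := planarRing_isRegularLocalOfDim hind
    V_dom := hVB
    B_dom := ?_
    noMonomialization := ?_ }⟩
  · rw [hBmap]
    exact dominates_planarRing huv (isRegularSystem_planarRing hind).isLocalRing
      algebraMap_mem_planarRing ((hstage.hasValue_left hp.ne_zero).isNonunit hind huv.left_ne_zero)
      ((hstage.hasValue_right hp.ne_zero).isNonunit hind huv.right_ne_zero)
  · intro A B hA _ hVB' hBA hA' hB'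
    rw [hBmap] at hA'
    refine not_isMonomialExtension_of_isStage htr hf hg hfg hVval.isLocalRing hVk hfV hgV hA.1
      hVB' hBA ?_ ?_
    · rw [hg0, hg1]
      exact (dominates_iff.1 hA').1
    · rw [hf0, hf1]
      exact (dominates_iff.1 hB').1

lemma exists_ne_zero_ne (hcard : 3 ≤ Cardinal.mk k) (d : k) : ∃ c : k, c ≠ 0 ∧ c ≠ d := by
  by_contra! h
  have h1 : (Set.univ : Set k) ⊆ {0, d} := fun c _ => by
    by_cases h0 : c = 0
    · exact Or.inl h0
    · exact Or.inr (h c h0)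
  have h2 := Cardinal.mk_le_mk_of_subset h1
  rw [Cardinal.mk_univ] at h2
  have h3 := (hcard.trans h2).trans (Cardinal.mk_insert_le (s := {d}) (a := 0))
  rw [Cardinal.mk_singleton] at h3
  norm_num at h3

end BaseCase

/-- Theorem 1.3 of the paper.  Let `k` be a field of
characteristic `p > 0` with at least 3 elements and let `n ≥ 2`.  Then a
counterexample to local and weak local monomialization as above exists. -/
theorem stmt0 (k : Type) [Field k] (p : ℕ) (hp : p.Prime) [CharP k p]
    (hcard : 3 ≤ Cardinal.mk k) (n : ℕ) (hn : 2 ≤ n) :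
    Nonempty (MonomializationCounterexample k n) := by
  have := Fact.mk hp
  have h : Nonempty (EndoCounterexample k n) := by
    induction n, hn using Nat.le_induction with
    | base => exact EndoCounterexample.nonempty_two k (exists_ne_zero_ne hcard)
    | succ n _ ih =>
      obtain ⟨T⟩ := ih
      exact T.step
  obtain ⟨T⟩ := h
  exact T.nonempty
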